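/- Let a ∈ (ℤ\{0})⁴ with A = a₁a₂a₃a₄ not a perfect square, and let c ∈ ℤ⁴ satisfy F*_a(c) = 0. Then for every x ≥ 1 and every ε > 0, |Σ_{q ≤ x} q⁻³·S_{q,a}(c)| ≪_ε |A|^{3/16+ε}·Δ_c(a)^{3/8}·x^{1/2+ε}, where the implied constant depends only on ε. -/

import Mathlib

open scoped BigOperators
open MeasureTheory Filter

attribute [local instance 0] Classical.propDecidable

noncomputable section

/-- `e(t) = exp(2πit)`. -/
def eC (t : ℝ) : ℂ := Complex.exp (2 * Real.pi * Complex.I * t)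

/-- A nonzero integer `z` is squareful if `p² ∣ z` for every prime `p` dividing `z`. -/
def Squareful (z : ℤ) : Prop := ∀ p : ℕ, p.Prime → (p : ℤ) ∣ z → (p : ℤ) ^ 2 ∣ z

/-- The standard bump function in one variable. -/
def psi1 (t : ℝ) : ℝ := if |t| < 1 then Real.exp (-(1 - t ^ 2)⁻¹) else 0

/-- The smooth weight `w₁`. -/
def w1 (η : ℝ) (x : Fin 4 → ℝ) : ℝ :=
  if ‖x‖ ≤ η then 0
  else if ‖x‖ ≤ 2 * η then Real.exp 1 * psi1 (‖x‖ / η - 2)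
  else if ‖x‖ ≤ 1 - η then 1
  else if ‖x‖ ≤ 1 then Real.exp 1 * psi1 (‖x‖ / η - (1 - η) / η)
  else 0

/-- The smooth weight `w₂`. -/
def w2 (η : ℝ) (x : Fin 4 → ℝ) : ℝ :=
  if ‖x‖ ≤ η then 0
  else if ‖x‖ ≤ 2 * η then Real.exp 1 * psi1 (‖x‖ / η - 2)
  else if ‖x‖ ≤ 1 then 1
  else if ‖x‖ ≤ 1 + η then Real.exp 1 * psi1 (‖x‖ / η - 1 / η)
  else 0

/-- `u(t) = c₀ ψ₁(4t - 3)`, normalised so that `∫ u = 1`. -/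
def uFn (t : ℝ) : ℝ := (∫ s : ℝ, psi1 (4 * s - 3))⁻¹ * psi1 (4 * t - 3)

/-- Heath-Brown's function `h(x, y)`. -/
def hFn (x y : ℝ) : ℝ :=
  ∑' j : ℕ, (x * ((j : ℝ) + 1))⁻¹ *
    (uFn (x * ((j : ℝ) + 1)) - uFn (|y| / (x * ((j : ℝ) + 1))))

/-- The exponential sum `S_{q,a}(c)`. -/
def Sqa (a c : Fin 4 → ℤ) (q : ℕ) : ℂ :=
  ∑ k ∈ (Finset.range q).filter fun k => Nat.gcd k q = 1,
    ∑ b ∈ Fintype.piFinset fun _ : Fin 4 => Finset.range q,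
      eC (((((k : ℤ) * (∑ i, a i * (b i : ℤ) ^ 2) + ∑ i, (b i : ℤ) * c i) : ℤ) : ℝ) / (q : ℝ))

/-- Partial sums of the singular series `𝔊_a`. -/
def singularPartial (a : Fin 4 → ℤ) (T : ℕ) : ℂ :=
  ∑ q ∈ Finset.Icc 1 T, (1 / (q : ℂ) ^ 4) * Sqa a 0 q

/-- The quadratic form `G(x) = Σ εᵢ xᵢ²`. -/
def Gquad (e : Fin 4 → ℤ) (x : Fin 4 → ℝ) : ℝ := ∑ i, (e i : ℝ) * x i ^ 2

/-- The singular integral `σ_∞(ε)`. -/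
def sigmaInf (e : Fin 4 → ℤ) : ℂ :=
  ∫ θ : ℝ, ∫ x in Set.univ.pi fun _ : Fin 4 => Set.Icc (-1 : ℝ) 1, eC (-(θ * Gquad e x))

/-- The weighted singular integral `σ_∞(w)`. -/
def sigmaInfW (w : (Fin 4 → ℝ) → ℝ) (e : Fin 4 → ℤ) : ℂ :=
  ∫ θ : ℝ, ∫ x : Fin 4 → ℝ, (w x : ℂ) * eC (-(θ * Gquad e x))

/-- `Pᵢ = (B / |aᵢ|)^{1/2}`. -/
def Pvec (a : Fin 4 → ℤ) (B : ℝ) (i : Fin 4) : ℝ := Real.sqrt (B / ((a i).natAbs : ℝ))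

/-- The oscillatory integral `I_{q,a}(c)`. -/
def Iqa (w : (Fin 4 → ℝ) → ℝ) (a : Fin 4 → ℤ) (B : ℝ) (c : Fin 4 → ℤ) (q : ℝ) : ℂ :=
  ∫ x : Fin 4 → ℝ,
    (w (fun i => x i / Pvec a B i) : ℂ) *
      (hFn (q / Real.sqrt B) ((∑ i, (a i : ℝ) * x i ^ 2) / B) : ℂ) *
      eC (-(∑ i, (c i : ℝ) * x i) / q)

/-- `Δ(v) = ∏ᵢ gcd(vᵢ, ∏_{j≠i} vⱼ)`. -/
def Delta4 (v : Fin 4 → ℤ) : ℕ :=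
  ∏ i, Int.gcd (v i) (∏ j ∈ Finset.univ.erase i, v j)

/-- `Δ_c(a) = ∏ᵢ gcd(gcd(aᵢ,cᵢ), ∏_{j≠i} gcd(aⱼ,cⱼ))`. -/
def DeltaC (a c : Fin 4 → ℤ) : ℕ :=
  ∏ i, Int.gcd (Int.gcd (a i) (c i) : ℤ) (∏ j ∈ Finset.univ.erase i, (Int.gcd (a j) (c j) : ℤ))

/-- The dual form `F*_a(c)`. -/
def dualForm (a c : Fin 4 → ℤ) : ℤ :=
  ∑ i, (∏ j ∈ Finset.univ.erase i, a j) * c i ^ 2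

/-- The counting function `N_a(B)`. -/
def Na (a : Fin 4 → ℤ) (B : ℝ) : ℕ :=
  {x : Fin 4 → ℤ | (∀ i, x i ≠ 0) ∧ (∑ i, a i * x i ^ 2) = 0 ∧
    ∀ i, (((a i * x i ^ 2).natAbs : ℝ)) ≤ B}.ncard

/-- The smoothly weighted counting function `N_{w,a}(B)`. -/
def Nwa (w : (Fin 4 → ℝ) → ℝ) (a : Fin 4 → ℤ) (B : ℝ) : ℝ :=
  ∑' x : Fin 4 → ℤ,
    if (∀ i, x i ≠ 0) ∧ (∑ i, a i * x i ^ 2) = 0 then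
      w fun i => (x i : ℝ) / Pvec a B i
    else 0

/-- The inclusion-exclusion weights `ω(r, s, s₀)`. -/
def omegaFn (r s : Fin 4 → ℕ) (s0 : ℕ) : ℤ :=
  if (∀ i, Squarefree (r i)) ∧ (∀ i, Squarefree (s i)) ∧
      Finset.univ.gcd s = 1 ∧ (∀ i, Nat.gcd s0 (s i) = 1) ∧
      ∀ p : ℕ, p.Prime → p ∣ (∏ i, r i) * ∏ i, s i → ∀ i, p ∣ r i * s i then
    ArithmeticFunction.moebius s0 *
      ∏ p ∈ ((∏ i, r i) * ∏ i, s i).primeFactors,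
        (-1 : ℤ) ^ (((∏ i, r i) * ∏ i, s i).factorization p + 1)
  else 0

/-- The cardinality of the set `𝒩(B; r, s, s₀)`. -/
def calN (B D : ℝ) (r s : Fin 4 → ℕ) (s0 : ℕ) : ℕ :=
  {z : Fin 4 → ℤ | (∀ i, z i ≠ 0) ∧ (∀ i, Squareful (z i)) ∧
    (∀ i, (((z i).natAbs : ℝ)) ≤ B) ∧ (∑ i, z i) = 0 ∧
    ∃ x y : Fin 4 → ℤ,
      (∀ i, 0 < x i ∧ Squarefree (y i) ∧ z i = x i ^ 2 * y i ^ 3 ∧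
        (r i : ℤ) ∣ y i ∧ (s i : ℤ) ∣ x i ∧ (s0 : ℤ) ∣ x i) ∧
      (((∏ i, y i).natAbs : ℝ)) ≤ D ∧ ¬ IsSquare (∏ i, y i)}.ncard

/-- The local counting function `M_n(y, p)`. -/
def Mcount (y : Fin 4 → ℤ) (p n : ℕ) : ℕ :=
  {m : Fin 4 → ℕ | (∀ i, m i < p ^ n) ∧ ((p : ℤ) ^ n ∣ ∑ i, y i ^ 3 * (m i : ℤ) ^ 2) ∧
    ∃ j, ¬ (p : ℤ) ∣ (m j : ℤ) * y j}.ncard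

end

/-! ## Part 1: Stepanov method -/
section Stepanov
open Polynomial

variable {p : ℕ} [Fact p.Prime]

/-- The operator on coefficient polynomials coming from one derivative. -/
noncomputable def stepOp (f : (ZMod p)[X]) (e : ZMod p) : (ZMod p)[X] →ₗ[ZMod p] (ZMod p)[X] where
  toFun r := C e * (derivative f * r) + f * derivative r
  map_add' r s := by simp only [derivative_add]; ring
  map_smul' t r := by
    simp only [smul_eq_C_mul, derivative_C_mul, RingHom.id_apply]; ring

/-- iterated operators -/
noncomputable def stepIter (f : (ZMod p)[X]) (e : ZMod p) : ℕ → ((ZMod p)[X] →ₗ[ZMod p] (ZMod p)[X])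
  | 0 => LinearMap.id
  | k + 1 => (stepOp f (e - k)).comp (stepIter f e k)

lemma stepOp_degree (f : (ZMod p)[X]) (hf : f.natDegree ≤ 3) (e : ZMod p) (r : (ZMod p)[X]) (N : ℕ)
    (hN : 1 ≤ N) (hr : r ∈ degreeLT (ZMod p) N) : stepOp f e r ∈ degreeLT (ZMod p) (N + 2) := by
  have hr' : r.natDegree ≤ N - 1 := by
    rw [mem_degreeLT] at hr
    by_cases h0 : r = 0
    · subst h0; simp
    · have := (natDegree_lt_iff_degree_lt h0).2 hr
      omega
  have h1 : (stepOp f e r).natDegree ≤ N + 1 := by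
    show (C e * (derivative f * r) + f * derivative r).natDegree ≤ N + 1
    refine (natDegree_add_le _ _).trans (max_le ?_ ?_)
    · refine (natDegree_C_mul_le _ _).trans (natDegree_mul_le.trans ?_)
      have := natDegree_derivative_le f
      omega
    · by_cases h0 : r.natDegree = 0
      · rw [derivative_of_natDegree_zero h0]; simp
      · refine natDegree_mul_le.trans ?_
        have := natDegree_derivative_le r
        omega
  rw [mem_degreeLT]
  refine lt_of_le_of_lt degree_le_natDegree ?_
  exact_mod_cast Nat.lt_succ_of_le h1

lemma stepIter_degree (f : (ZMod p)[X]) (hf : f.natDegree ≤ 3) (e : ZMod p) (r : (ZMod p)[X]) (N : ℕ)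
    (hN : 1 ≤ N) (hr : r ∈ degreeLT (ZMod p) N) (k : ℕ) :
    stepIter f e k r ∈ degreeLT (ZMod p) (N + 2 * k) := by
  induction k with
  | zero => simpa [stepIter] using hr
  | succ k ih =>
    have := stepOp_degree f hf (e - k) (stepIter f e k r) (N + 2 * k) (by omega) ih
    have h2 : N + 2 * (k + 1) = N + 2 * k + 2 := by ring
    rw [h2]
    simpa [stepIter] using this

/-- one derivative of the auxiliary term -/
lemma deriv_term (f r s : (ZMod p)[X]) (u l j : ℕ) :
    derivative (f ^ (l + 1) * (r + s * f ^ (u + 1)) * X ^ (j * p)) =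
      f ^ l * (stepOp f ((l + 1 : ℕ) : ZMod p) r
        + stepOp f (((l + 1 : ℕ) : ZMod p) + ((u + 1 : ℕ) : ZMod p)) s * f ^ (u + 1))
        * X ^ (j * p) := by
  have hX : derivative (X ^ (j * p) : (ZMod p)[X]) = 0 := by
    rw [derivative_X_pow]; simp
  simp only [derivative_mul, hX, derivative_pow, stepOp, LinearMap.coe_mk,
    AddHom.coe_mk, map_add, Nat.add_sub_cancel]
  ring

lemma iter_deriv_term (f r s : (ZMod p)[X]) (u l j k : ℕ) (hk : k ≤ l) :
    derivative^[k] (f ^ l * (r + s * f ^ (u + 1)) * X ^ (j * p)) =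
      f ^ (l - k) * (stepIter f (l : ZMod p) k r
        + stepIter f ((l : ZMod p) + ((u + 1 : ℕ) : ZMod p)) k s * f ^ (u + 1))
        * X ^ (j * p) := by
  induction k with
  | zero => simp [stepIter]
  | succ k ih =>
    rw [Function.iterate_succ_apply', ih (by omega)]
    obtain ⟨m, hm⟩ : ∃ m, l = k + 1 + m := ⟨l - (k + 1), by omega⟩
    have e1 : l - k = m + 1 := by omega
    have e2 : l - (k + 1) = m := by omega
    rw [e1, e2, deriv_term]
    have e3 : ((m + 1 : ℕ) : ZMod p) = (l : ZMod p) - k := by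
      rw [hm]; push_cast; ring
    have e4 : ((m + 1 : ℕ) : ZMod p) + ((u + 1 : ℕ) : ZMod p)
        = (l : ZMod p) + ((u + 1 : ℕ) : ZMod p) - k := by
      rw [hm]; push_cast; ring
    rw [e4, e3]
    simp [stepIter]

lemma step_nonvanish_one (f : (ZMod p)[X]) (hf : f.natDegree = 3) (hf0 : f.coeff 0 ≠ 0) (n : ℕ)
    (hn : p = 2 * n + 3) (r s : (ZMod p)[X])
    (hr : r ∈ degreeLT (ZMod p) n) (hs : s ∈ degreeLT (ZMod p) n)
    (h : (X : (ZMod p)[X]) ^ p ∣ r + s * f ^ (n + 1)) : r = 0 ∧ s = 0 := by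
  have hfne : f ≠ 0 := by rintro rfl; simp at hf0
  have h1 : (X : (ZMod p)[X]) ^ p ∣ f * r ^ 2 - s ^ 2 * f ^ p := by
    have : f * r ^ 2 - s ^ 2 * f ^ p = (r + s * f ^ (n + 1)) * (f * (r - s * f ^ (n + 1))) := by
      have e : f ^ p = f * (f ^ (n + 1)) ^ 2 := by
        rw [← pow_mul, ← pow_succ']; congr 1; omega
      rw [e]; ring
    rw [this]; exact Dvd.dvd.mul_right h _
  have h2 : (X : (ZMod p)[X]) ^ p ∣ f ^ p - C (f.coeff 0) := by
    rw [← ZMod.expand_card f, X_pow_dvd_iff]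
    intro d hd
    have hp := (Fact.out : p.Prime).pos
    rw [coeff_sub, coeff_expand hp, coeff_C]
    by_cases hd0 : d = 0
    · subst hd0; simp
    · have : ¬ p ∣ d := fun hh => absurd (Nat.le_of_dvd (Nat.pos_of_ne_zero hd0) hh) (by omega)
      simp [this, hd0]
  have h3 : (X : (ZMod p)[X]) ^ p ∣ f * r ^ 2 - C (f.coeff 0) * s ^ 2 := by
    have : f * r ^ 2 - C (f.coeff 0) * s ^ 2
        = (f * r ^ 2 - s ^ 2 * f ^ p) + s ^ 2 * (f ^ p - C (f.coeff 0)) := by ring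
    rw [this]; exact dvd_add h1 (Dvd.dvd.mul_left h2 _)
  have nd : ∀ t : (ZMod p)[X], t ∈ degreeLT (ZMod p) n → t ≠ 0 → t.natDegree < n := by
    intro t ht ht0
    rw [mem_degreeLT] at ht
    exact (natDegree_lt_iff_degree_lt ht0).2 ht
  have h4 : f * r ^ 2 - C (f.coeff 0) * s ^ 2 = 0 := by
    by_contra hne
    have hle := natDegree_le_of_dvd h3 hne
    rw [natDegree_X_pow] at hle
    have hd : (f * r ^ 2 - C (f.coeff 0) * s ^ 2).natDegree < p := by
      refine lt_of_le_of_lt (natDegree_sub_le _ _) (max_lt ?_ ?_)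
      · by_cases hr0 : r = 0
        · subst hr0; simp; omega
        · rw [natDegree_mul hfne (pow_ne_zero _ hr0), natDegree_pow]
          have := nd r hr hr0; omega
      · by_cases hs0 : s = 0
        · subst hs0; simp; omega
        · refine lt_of_le_of_lt (natDegree_C_mul_le _ _) ?_
          rw [natDegree_pow]
          have := nd s hs hs0; omega
    omega
  have h5 : f * r ^ 2 = C (f.coeff 0) * s ^ 2 := sub_eq_zero.1 h4
  have hC : (C (f.coeff 0) : (ZMod p)[X]) ≠ 0 := by simpa using hf0
  by_cases hr0 : r = 0
  · subst hr0
    refine ⟨rfl, ?_⟩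
    have : C (f.coeff 0) * s ^ 2 = 0 := by rw [← h5]; ring
    rcases mul_eq_zero.1 this with h | h
    · exact absurd h hC
    · exact pow_eq_zero_iff (two_ne_zero) |>.1 h
  · exfalso
    have hs0 : s ≠ 0 := by
      rintro rfl
      have : f * r ^ 2 = 0 := by rw [h5]; ring
      rcases mul_eq_zero.1 this with h | h
      · exact hfne h
      · exact hr0 (pow_eq_zero_iff (two_ne_zero) |>.1 h)
    have := congrArg natDegree h5
    rw [natDegree_mul hfne (pow_ne_zero _ hr0), natDegree_mul hC (pow_ne_zero _ hs0), natDegree_C,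
      natDegree_pow, natDegree_pow, hf] at this
    omega

lemma step_nonvanish (f : (ZMod p)[X]) (hf : f.natDegree = 3) (hf0 : f.coeff 0 ≠ 0) (n : ℕ)
    (hn : p = 2 * n + 3) (J : ℕ) (r s : ℕ → (ZMod p)[X])
    (hr : ∀ j, r j ∈ degreeLT (ZMod p) n) (hs : ∀ j, s j ∈ degreeLT (ZMod p) n)
    (h : ∑ j ∈ Finset.range J, (r j + s j * f ^ (n + 1)) * X ^ (j * p) = 0) :
    ∀ j < J, r j = 0 ∧ s j = 0 := by
  intro j
  induction j using Nat.strong_induction_on with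
  | _ j ih =>
  intro hj
  apply step_nonvanish_one f hf hf0 n hn _ _ (hr j) (hs j)
  have hX : (X : (ZMod p)[X]) ^ (j * p) ≠ 0 := pow_ne_zero _ X_ne_zero
  rw [← mul_dvd_mul_iff_right hX]
  have h1 : (r j + s j * f ^ (n + 1)) * X ^ (j * p) =
      - ∑ i ∈ (Finset.range J).erase j, (r i + s i * f ^ (n + 1)) * X ^ (i * p) := by
    rw [eq_neg_iff_add_eq_zero, Finset.add_sum_erase (Finset.range J) (fun i => (r i + s i * f ^ (n + 1)) * X ^ (i * p)) (by simpa using hj)]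
    exact h
  rw [h1]
  refine (dvd_neg).2 (Finset.dvd_sum ?_)
  intro i hi
  rw [Finset.mem_erase, Finset.mem_range] at hi
  rcases lt_or_gt_of_ne hi.1 with hlt | hgt
  · obtain ⟨e1, e2⟩ := ih i hlt hi.2
    simp [e1, e2]
  · refine Dvd.dvd.mul_left ?_ _
    rw [← pow_add]
    apply pow_dvd_pow
    have : (j + 1) * p ≤ i * p := Nat.mul_le_mul_right _ hgt
    linarith [this, add_mul j 1 p]

/-- Existence of the auxiliary coefficients. -/
lemma step_exists (f : (ZMod p)[X]) (hf : f.natDegree = 3) (n L : ℕ) (a : ZMod p)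
    (hL : 1 ≤ L) (hn : 6 * L ^ 2 < n) (u : ZMod p) :
    ∃ r s : ℕ → (ZMod p)[X], (∀ j, r j ∈ degreeLT (ZMod p) n) ∧ (∀ j, s j ∈ degreeLT (ZMod p) n) ∧
      (∃ j < L + 1, r j ≠ 0 ∨ s j ≠ 0) ∧
      ∀ k < 2 * L, ∑ j ∈ Finset.range (L + 1),
        (stepIter f ((2 * L : ℕ) : ZMod p) k (r j) + C a * stepIter f (((2 * L : ℕ) : ZMod p) + u) k (s j))
          * X ^ j = 0 := by
  classical
  let V := Fin (L + 1) × Bool → degreeLT (ZMod p) n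
  let D := n + 2 * (2 * L) + (L + 1)
  let W := Fin (2 * L) → degreeLT (ZMod p) D
  have hn1 : 1 ≤ n := by omega
  let T0 : Fin (2 * L) → (V →ₗ[ZMod p] (ZMod p)[X]) := fun k =>
    ∑ j : Fin (L + 1),
      ((LinearMap.mulRight (ZMod p) ((X : (ZMod p)[X]) ^ (j : ℕ))).comp
        ((stepIter f ((2 * L : ℕ) : ZMod p) k).comp ((degreeLT (ZMod p) n).subtype.comp (LinearMap.proj (j, true)))
        + (LinearMap.mulLeft (ZMod p) (C a)).comp ((stepIter f (((2 * L : ℕ) : ZMod p) + u) k).comp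
          ((degreeLT (ZMod p) n).subtype.comp (LinearMap.proj (j, false))))))
  have hT0 : ∀ k (v : V), T0 k v = ∑ j : Fin (L + 1), (stepIter f ((2 * L : ℕ) : ZMod p) k (v (j, true))
      + C a * stepIter f (((2 * L : ℕ) : ZMod p) + u) k (v (j, false))) * X ^ (j : ℕ) := by
    intro k v
    simp [T0]
    rfl
  have hmem : ∀ k (v : V), T0 k v ∈ degreeLT (ZMod p) D := by
    intro k v
    rw [hT0]
    refine Submodule.sum_mem _ ?_
    intro j _
    have hk := k.2
    have hj := j.2
    have m1 := stepIter_degree f hf.le ((2 * L : ℕ) : ZMod p) _ n hn1 (v (j, true)).2 k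
    have m2 := stepIter_degree f hf.le (((2 * L : ℕ) : ZMod p) + u) _ n hn1 (v (j, false)).2 k
    have m3 : C a * stepIter f (((2 * L : ℕ) : ZMod p) + u) k (v (j, false))
        ∈ degreeLT (ZMod p) (n + 2 * k) := by
      rw [← smul_eq_C_mul]; exact Submodule.smul_mem _ _ m2
    have m4 := Submodule.add_mem _ m1 m3
    rw [mem_degreeLT] at m4 ⊢
    rw [degree_mul, degree_X_pow]
    by_cases h0 : stepIter f ((2 * L : ℕ) : ZMod p) k (v (j, true))
      + C a * stepIter f (((2 * L : ℕ) : ZMod p) + u) k (v (j, false)) = 0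
    · rw [h0]; simp
    · rw [degree_eq_natDegree h0] at m4 ⊢
      have m5 := Nat.cast_lt.1 m4
      norm_cast
      simp only [D]
      omega
  let T : V →ₗ[ZMod p] W := LinearMap.pi fun k => (T0 k).codRestrict _ (hmem k)
  have fd : ∀ N, Module.finrank (ZMod p) (degreeLT (ZMod p) N) = N := by
    intro N
    rw [(degreeLTEquiv (ZMod p) N).finrank_eq]; simp
  have hlt : Module.finrank (ZMod p) W < Module.finrank (ZMod p) V := by
    rw [Module.finrank_pi_fintype, Module.finrank_pi_fintype]
    simp only [fd, Finset.sum_const, Finset.card_univ, Fintype.card_fin, Fintype.card_prod,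
      Fintype.card_bool, smul_eq_mul, D]
    nlinarith [hn, hL]
  have hk := LinearMap.ker_ne_bot_of_finrank_lt (f := T) hlt
  obtain ⟨v, hv, hv0⟩ := (Submodule.ne_bot_iff _).1 hk
  refine ⟨fun j => if h : j < L + 1 then v (⟨j, h⟩, true) else 0,
    fun j => if h : j < L + 1 then v (⟨j, h⟩, false) else 0, ?_, ?_, ?_, ?_⟩
  · intro j; dsimp only; split_ifs
    · exact (v _).2
    · exact Submodule.zero_mem _
  · intro j; dsimp only; split_ifs
    · exact (v _).2
    · exact Submodule.zero_mem _
  · by_contra hcon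
    push Not at hcon
    apply hv0
    funext ⟨j, b⟩
    have := hcon j j.2
    simp only [j.2, dif_pos, Fin.eta] at this
    cases b
    · exact Subtype.ext this.2
    · exact Subtype.ext this.1
  · intro k hk
    have h1 : T v = 0 := hv
    have h2 : T0 ⟨k, hk⟩ v = 0 := by
      have := congrFun h1 ⟨k, hk⟩
      exact congrArg Subtype.val this
    rw [hT0] at h2
    refine Eq.trans (Fin.sum_univ_eq_sum_range (fun j => (stepIter f ((2 * L : ℕ) : ZMod p) k (if h : j < L + 1 then ((v (⟨j, h⟩, true) : degreeLT (ZMod p) n) : (ZMod p)[X]) else 0) + C a * stepIter f (((2 * L : ℕ) : ZMod p) + u) k (if h : j < L + 1 then ((v (⟨j, h⟩, false) : degreeLT (ZMod p) n) : (ZMod p)[X]) else 0))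
          * X ^ j) (L + 1)).symm (Eq.trans (Finset.sum_congr rfl ?_) h2)
    intro j _
    simp only [j.2, dif_pos, Fin.eta]

/-- Stepanov bound for the number of points. -/
lemma stepanov_count (f : (ZMod p)[X]) (hf : f.natDegree = 3) (hf0 : f.coeff 0 ≠ 0) (n L : ℕ)
    (hp : p = 2 * n + 3) (hL : 1 ≤ L) (hn : 6 * L ^ 2 < n) (a : ZMod p) (S : Finset (ZMod p))
    (hS : ∀ x ∈ S, (f.eval x) ^ (n + 1) = a) :
    2 * L * S.card ≤ 6 * L + 2 * p + L * p := by
  classical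
  have hpp : p.Prime := Fact.out
  obtain ⟨r, s, hr, hs, ⟨j0, hj0, hne⟩, hk⟩ :=
    step_exists f hf n L a hL hn ((n + 1 : ℕ) : ZMod p)
  set h : (ZMod p)[X] := ∑ j ∈ Finset.range (L + 1),
    f ^ (2 * L) * (r j + s j * f ^ (n + 1)) * X ^ (j * p) with hh
  have hfne : f ≠ 0 := by rintro rfl; simp at hf0
  have hne0 : h ≠ 0 := by
    intro h0
    have h1 : f ^ (2 * L) * ∑ j ∈ Finset.range (L + 1), (r j + s j * f ^ (n + 1)) * X ^ (j * p) = 0 := by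
      rw [Finset.mul_sum, ← h0, hh]
      exact Finset.sum_congr rfl fun j _ => by ring
    rcases mul_eq_zero.1 h1 with h2 | h2
    · exact pow_ne_zero _ hfne h2
    · obtain ⟨e1, e2⟩ := step_nonvanish f hf hf0 n hp (L + 1) r s hr hs h2 j0 hj0
      rcases hne with h | h
      · exact h e1
      · exact h e2
  have hder : ∀ x ∈ S, ∀ k < 2 * L, (derivative^[k] h).IsRoot x := by
    intro x hx k hkl
    have e0 : derivative^[k] h = ∑ j ∈ Finset.range (L + 1),
        f ^ (2 * L - k) * (stepIter f ((2 * L : ℕ) : ZMod p) k (r j)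
        + stepIter f (((2 * L : ℕ) : ZMod p) + ((n + 1 : ℕ) : ZMod p)) k (s j) * f ^ (n + 1))
        * X ^ (j * p) := by
      rw [hh, iterate_derivative_sum]
      exact Finset.sum_congr rfl fun j _ => iter_deriv_term f (r j) (s j) n (2 * L) j k hkl.le
    have e1 := congrArg (eval x) (hk k hkl)
    rw [IsRoot, e0, eval_finsetSum]
    rw [eval_finsetSum, eval_zero] at e1
    have : ∀ j ∈ Finset.range (L + 1), eval x (f ^ (2 * L - k) * (stepIter f ((2 * L : ℕ) : ZMod p) k (r j)
        + stepIter f (((2 * L : ℕ) : ZMod p) + ((n + 1 : ℕ) : ZMod p)) k (s j) * f ^ (n + 1))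
        * X ^ (j * p)) = eval x f ^ (2 * L - k) * eval x ((stepIter f ((2 * L : ℕ) : ZMod p) k (r j) + C a * stepIter f (((2 * L : ℕ) : ZMod p) + ((n + 1 : ℕ) : ZMod p)) k (s j)) * X ^ j) := by
      intro j _
      simp only [eval_mul, eval_pow, eval_add, eval_X, eval_C, hS x hx]
      rw [mul_comm j p, pow_mul, ZMod.pow_card]; ring
    rw [Finset.sum_congr rfl this, ← Finset.mul_sum, e1, mul_zero]
  have hLp : 2 * L ≤ p := by nlinarith
  have hmult : ∀ x ∈ S, 2 * L ≤ h.rootMultiplicity x := by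
    intro x hx
    have := lt_rootMultiplicity_of_isRoot_iterate_derivative_of_mem_nonZeroDivisors (n := 2 * L - 1)
      (t := x) hne0 (fun m hm => hder x hx m (by omega)) ?_
    · omega
    · rw [mem_nonZeroDivisors_iff_ne_zero]
      intro h0
      rw [ZMod.natCast_eq_zero_iff, hpp.dvd_factorial] at h0
      omega
  have hcount : S.card * (2 * L) ≤ h.natDegree := by
    calc S.card * (2 * L) ≤ ∑ x ∈ S, h.roots.count x := by
          rw [← smul_eq_mul]
          refine Finset.card_nsmul_le_sum _ _ _ ?_
          intro x hx
          rw [count_roots]; exact hmult x hx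
      _ ≤ ∑ x ∈ S ∪ h.roots.toFinset, h.roots.count x :=
          Finset.sum_le_sum_of_subset (Finset.subset_union_left)
      _ = h.roots.card := by
          apply Multiset.sum_count_eq_card
          intro x hx
          exact Finset.mem_union_right _ (Multiset.mem_toFinset.2 hx)
      _ ≤ h.natDegree := card_roots' h
  have hdeg : h.natDegree ≤ 6 * L + 2 * p + L * p := by
    rw [hh]
    refine natDegree_sum_le_of_forall_le _ _ ?_
    intro j hj
    have hj' : j ≤ L := by rw [Finset.mem_range] at hj; omega
    have nd : ∀ t : (ZMod p)[X], t ∈ degreeLT (ZMod p) n → t.natDegree ≤ n := by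
      intro t ht
      rw [mem_degreeLT] at ht
      exact natDegree_le_iff_degree_le.2 ht.le
    have b1 : (f ^ (2 * L)).natDegree ≤ 6 * L := by
      rw [natDegree_pow, hf]; omega
    have b2 : (r j + s j * f ^ (n + 1)).natDegree ≤ 2 * p := by
      refine (natDegree_add_le _ _).trans (max_le ((nd _ (hr j)).trans (by omega)) ?_)
      refine natDegree_mul_le.trans ?_
      rw [natDegree_pow, hf]
      have := nd _ (hs j)
      omega
    have b3 : (X ^ (j * p) : (ZMod p)[X]).natDegree ≤ L * p := by
      rw [natDegree_X_pow]; exact Nat.mul_le_mul_right _ hj'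
    refine natDegree_mul_le.trans ?_
    have := (natDegree_mul_le (p := f ^ (2 * L)) (q := r j + s j * f ^ (n + 1)))
    omega
  calc 2 * L * S.card = S.card * (2 * L) := by ring
    _ ≤ _ := hcount.trans hdeg

end Stepanov

/-! ## Part 2: complete character sums -/
section CharSums
open Polynomial

/-- The Jacobi symbol as a function on `ZMod m`. -/
noncomputable def jz (m : ℕ) (x : ZMod m) : ℤ := jacobiSym (x.val : ℤ) m

lemma jz_intCast (m : ℕ) [NeZero m] (n : ℤ) : jz m (n : ZMod m) = jacobiSym n m := by
  unfold jz
  rw [ZMod.val_intCast, ← jacobiSym.mod_left]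

lemma jz_mul (m : ℕ) [NeZero m] (x y : ZMod m) : jz m (x * y) = jz m x * jz m y := by
  obtain ⟨a, rfl⟩ := ZMod.intCast_surjective x
  obtain ⟨b, rfl⟩ := ZMod.intCast_surjective y
  rw [← Int.cast_mul, jz_intCast, jz_intCast, jz_intCast, jacobiSym.mul_left]

lemma jz_abs_le (m : ℕ) (x : ZMod m) : |jz m x| ≤ 1 := by
  unfold jz
  rcases jacobiSym.trichotomy (x.val : ℤ) m with h | h | h <;> rw [h] <;> norm_num

lemma jz_prime (p : ℕ) [Fact p.Prime] (x : ZMod p) : jz p x = quadraticChar (ZMod p) x := by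
  obtain ⟨a, rfl⟩ := ZMod.intCast_surjective x
  rw [jz_intCast, ← jacobiSym.legendreSym.to_jacobiSym]
  rfl

lemma jz_crt (m n : ℕ) [NeZero m] [NeZero n] (h : m.Coprime n) (x : ZMod (m * n)) :
    jz (m * n) x = jz m (ZMod.chineseRemainder h x).1 * jz n (ZMod.chineseRemainder h x).2 := by
  obtain ⟨a, rfl⟩ := ZMod.intCast_surjective x
  haveI : NeZero (m * n) := ⟨mul_ne_zero (NeZero.ne m) (NeZero.ne n)⟩
  rw [map_intCast, jz_intCast]
  simp only [Prod.fst_intCast, Prod.snd_intCast]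
  rw [jz_intCast, jz_intCast, jacobiSym.mul_right]

/-- complete sum with four shifts -/
noncomputable def cs4 (m : ℕ) [NeZero m] (b : Fin 4 → ℤ) : ℤ :=
  ∑ x : ZMod m, jz m ((x + b 0) * (x + b 1) * (x + b 2) * (x + b 3))

/-- complete sum with two shifts -/
noncomputable def cs2 (m : ℕ) [NeZero m] (b c : ℤ) : ℤ :=
  ∑ x : ZMod m, jz m ((x + b) * (x + c))

lemma cs_crt (m n : ℕ) [NeZero m] [NeZero n] (h : m.Coprime n)
    (F : ZMod (m * n) → ZMod (m * n)) (F1 : ZMod m → ZMod m) (F2 : ZMod n → ZMod n)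
    (hF : ∀ x, ZMod.chineseRemainder h (F x) =
      (F1 (ZMod.chineseRemainder h x).1, F2 (ZMod.chineseRemainder h x).2)) :
    haveI : NeZero (m * n) := ⟨mul_ne_zero (NeZero.ne m) (NeZero.ne n)⟩
    ∑ x : ZMod (m * n), jz (m * n) (F x) = (∑ x, jz m (F1 x)) * ∑ x, jz n (F2 x) := by
  haveI : NeZero (m * n) := ⟨mul_ne_zero (NeZero.ne m) (NeZero.ne n)⟩
  rw [Finset.sum_mul_sum, ← Fintype.sum_prod_type']
  refine Fintype.sum_equiv (ZMod.chineseRemainder h).toEquiv _ _ ?_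
  intro x
  rw [jz_crt m n h, hF]
  rfl

lemma cs4_crt (m n : ℕ) [NeZero m] [NeZero n] (h : m.Coprime n) (b : Fin 4 → ℤ) :
    haveI : NeZero (m * n) := ⟨mul_ne_zero (NeZero.ne m) (NeZero.ne n)⟩
    cs4 (m * n) b = cs4 m b * cs4 n b := by
  haveI : NeZero (m * n) := ⟨mul_ne_zero (NeZero.ne m) (NeZero.ne n)⟩
  exact cs_crt m n h (fun x => (x + b 0) * (x + b 1) * (x + b 2) * (x + b 3))
    (fun x => (x + b 0) * (x + b 1) * (x + b 2) * (x + b 3))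
    (fun x => (x + b 0) * (x + b 1) * (x + b 2) * (x + b 3)) (fun x => by
      simp only [map_mul, map_add, map_intCast]; rfl)

lemma cs2_crt (m n : ℕ) [NeZero m] [NeZero n] (h : m.Coprime n) (b c : ℤ) :
    haveI : NeZero (m * n) := ⟨mul_ne_zero (NeZero.ne m) (NeZero.ne n)⟩
    cs2 (m * n) b c = cs2 m b c * cs2 n b c := by
  haveI : NeZero (m * n) := ⟨mul_ne_zero (NeZero.ne m) (NeZero.ne n)⟩
  exact cs_crt m n h (fun x => (x + b) * (x + c)) (fun x => (x + b) * (x + c))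
    (fun x => (x + b) * (x + c)) (fun x => by
      simp only [map_mul, map_add, map_intCast]; rfl)

lemma sum_jz_abs_le (m : ℕ) [NeZero m] (F : ZMod m → ZMod m) : |∑ x, jz m (F x)| ≤ m := by
  refine (Finset.abs_sum_le_sum_abs _ _).trans ?_
  refine (Finset.sum_le_sum fun x _ => jz_abs_le m (F x)).trans ?_
  simp [ZMod.card]

lemma cs4_abs_le (m : ℕ) [NeZero m] (b : Fin 4 → ℤ) : |cs4 m b| ≤ m := sum_jz_abs_le m _

lemma cs2_abs_le (m : ℕ) [NeZero m] (b c : ℤ) : |cs2 m b c| ≤ m := sum_jz_abs_le m _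

/-- Weil type bound for cubics, from Stepanov method. -/
lemma cubic_bound (p : ℕ) [Fact p.Prime] (f : (ZMod p)[X]) (hf : f.natDegree = 3)
    (hf0 : f.coeff 0 ≠ 0) :
    |((∑ x : ZMod p, jz p (f.eval x) : ℤ) : ℝ)| ≤ 20 * Real.sqrt p := by
  classical
  have hpp : p.Prime := Fact.out
  have hs0 : 0 ≤ Real.sqrt p := Real.sqrt_nonneg _
  have hsq : Real.sqrt p * Real.sqrt p = p := Real.mul_self_sqrt (Nat.cast_nonneg p)
  by_cases hsmall : p ≤ 400
  · have h1 : |((∑ x : ZMod p, jz p (f.eval x) : ℤ) : ℝ)| ≤ p := by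
      exact_mod_cast sum_jz_abs_le p (fun x => f.eval x)
    have h2 : Real.sqrt p ≤ 20 := by
      rw [Real.sqrt_le_left (by norm_num)]
      have : (p : ℝ) ≤ 400 := by exact_mod_cast hsmall
      linarith
    nlinarith
  · push Not at hsmall
    have hodd : p % 2 = 1 := by
      rcases hpp.eq_two_or_odd with h | h
      · omega
      · exact h
    obtain ⟨n, hn⟩ : ∃ n, p = 2 * n + 3 := ⟨(p - 3) / 2, by omega⟩
    set L := Nat.sqrt p / 4 with hLdef
    have hs20 : 20 ≤ Nat.sqrt p := by rw [Nat.le_sqrt]; omega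
    have hL4 : 4 * L ≤ Nat.sqrt p := by omega
    have hL1 : 1 ≤ L := by omega
    have hLp : 16 * L ^ 2 ≤ p := by
      have := Nat.sqrt_le' p
      nlinarith
    have hLn : 6 * L ^ 2 < n := by omega
    have hLlow : Real.sqrt p ≤ 5 * L := by
      have a1 : Real.sqrt p ≤ Nat.sqrt p + 1 := by
        rw [Real.sqrt_le_left (by positivity)]
        have := Nat.lt_succ_sqrt' p
        have h3 : (p : ℝ) < ((Nat.sqrt p + 1 : ℕ) : ℝ) ^ 2 := by exact_mod_cast this
        push_cast at h3; linarith
      have a2 : Nat.sqrt p + 1 ≤ 5 * L := by omega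
      have a3 : ((Nat.sqrt p + 1 : ℕ) : ℝ) ≤ ((5 * L : ℕ) : ℝ) := by exact_mod_cast a2
      push_cast at a3; linarith
    have key : ∀ e : ℤ, 2 * L * (Finset.univ.filter fun x : ZMod p => jz p (f.eval x) = e).card
        ≤ 6 * L + 2 * p + L * p := by
      intro e
      refine stepanov_count f hf hf0 n L hn hL1 hLn (e : ZMod p) _ ?_
      intro x hx
      have hx' := (Finset.mem_filter.1 hx).2
      rw [← hx', jz_prime, quadraticChar_eq_pow_of_char_ne_two' (by
        rw [ZMod.ringChar_zmod_n]; omega), ZMod.card]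
      congr 1; omega
    set N1 := (Finset.univ.filter fun x : ZMod p => jz p (f.eval x) = 1).card with hN1
    set N2 := (Finset.univ.filter fun x : ZMod p => jz p (f.eval x) = -1).card with hN2
    set N0 := (Finset.univ.filter fun x : ZMod p => jz p (f.eval x) = 0).card with hN0
    have hN0le : N0 ≤ 3 := by
      have hfne : f ≠ 0 := by rintro rfl; simp at hf0
      rw [← hf]
      refine le_trans ?_ (card_roots' f)
      refine le_trans ?_ (Multiset.toFinset_card_le _)
      refine Finset.card_le_card ?_
      intro x hx
      have hx' := (Finset.mem_filter.1 hx).2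
      rw [jz_prime, quadraticChar_eq_zero_iff] at hx'
      rw [Multiset.mem_toFinset, mem_roots hfne]
      exact hx'
    have hpt : ∀ y : ZMod p, jz p y = (if jz p y = 1 then 1 else 0) - (if jz p y = -1 then 1 else 0) ∧
        (1 : ℤ) = (if jz p y = 1 then 1 else 0) + (if jz p y = -1 then 1 else 0)
          + (if jz p y = 0 then 1 else 0) := by
      intro y
      rcases jacobiSym.trichotomy (y.val : ℤ) p with h | h | h <;>
        · change jz p y = _ at h
          rw [h]; norm_num
    have hsum : (∑ x : ZMod p, jz p (f.eval x)) = (N1 : ℤ) - N2 := by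
      rw [Finset.sum_congr rfl fun x _ => (hpt (f.eval x)).1, Finset.sum_sub_distrib, hN1, hN2]
      simp
    have htot : (p : ℤ) = N1 + N2 + N0 := by
      have : (p : ℤ) = ∑ x : ZMod p, (1 : ℤ) := by simp [ZMod.card]
      rw [this, Finset.sum_congr rfl fun x _ => (hpt (f.eval x)).2, Finset.sum_add_distrib,
        Finset.sum_add_distrib, hN1, hN2, hN0]
      simp
    have k1 := key 1
    have k2 := key (-1)
    rw [← hN1] at k1
    rw [← hN2] at k2
    have k1r : 2 * (L : ℝ) * N1 ≤ 6 * L + 2 * p + L * p := by exact_mod_cast k1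
    have k2r : 2 * (L : ℝ) * N2 ≤ 6 * L + 2 * p + L * p := by exact_mod_cast k2
    have htr : (p : ℝ) = N1 + N2 + N0 := by exact_mod_cast htot
    have hN0r : (N0 : ℝ) ≤ 3 := by exact_mod_cast hN0le
    have hLpos : (1 : ℝ) ≤ L := by exact_mod_cast hL1
    have hpL : (p : ℝ) ≤ L * (5 * Real.sqrt p) := by
      nlinarith
    have hs9 : 9 ≤ Real.sqrt p := by
      refine Real.le_sqrt_of_sq_le ?_
      have : (400 : ℝ) < p := by exact_mod_cast hsmall
      linarith
    rw [hsum]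
    push_cast
    have c1 : 2 * (L : ℝ) * (N1 : ℝ) ≤ L * (6 + 10 * Real.sqrt p + p) := by nlinarith
    have c2 : 2 * (L : ℝ) * (N2 : ℝ) ≤ L * (6 + 10 * Real.sqrt p + p) := by nlinarith
    have d1 : 2 * (N1 : ℝ) ≤ 6 + 10 * Real.sqrt p + p := by
      by_contra hcon
      push Not at hcon
      nlinarith
    have d2 : 2 * (N2 : ℝ) ≤ 6 + 10 * Real.sqrt p + p := by
      by_contra hcon
      push Not at hcon
      nlinarith
    rw [abs_le]
    constructor <;> linarith

lemma jz_inv_pow (p : ℕ) [Fact p.Prime] (y : ZMod p) (hy : y ≠ 0) : jz p (y⁻¹ * y⁻¹) = 1 := by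
  rw [jz_prime, map_mul, ← pow_two]
  exact quadraticChar_sq_one (inv_ne_zero hy)

lemma cs4_prime (p : ℕ) [Fact p.Prime] (b : Fin 4 → ℤ)
    (hb : ¬ (p : ℤ) ∣ (b 0 - b 1) * (b 0 - b 2) * (b 0 - b 3)) :
    |((cs4 p b : ℤ) : ℝ)| ≤ 21 * Real.sqrt p := by
  have hpp : p.Prime := Fact.out
  have hne : ∀ i : Fin 4, (p : ℤ) ∣ b 0 - b i → (p : ℤ) ∣ (b 0 - b 1) * (b 0 - b 2) * (b 0 - b 3) ∨ i = 0 := by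
    intro i hi
    fin_cases i
    · right; rfl
    · left; exact Dvd.dvd.mul_right (Dvd.dvd.mul_right hi _) _
    · left; exact Dvd.dvd.mul_right (Dvd.dvd.mul_left hi _) _
    · left; exact Dvd.dvd.mul_left hi _
  have hd : ∀ i : Fin 4, i ≠ 0 → ((b i : ZMod p) - b 0) ≠ 0 := by
    intro i hi h0
    have h1 : ((b 0 - b i : ℤ) : ZMod p) = 0 := by push_cast; linear_combination -h0
    rw [ZMod.intCast_zmod_eq_zero_iff_dvd] at h1
    rcases hne i h1 with h | h
    · exact hb h
    · exact hi h
  set d1 : ZMod p := (b 1 : ZMod p) - b 0 with hd1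
  set d2 : ZMod p := (b 2 : ZMod p) - b 0 with hd2
  set d3 : ZMod p := (b 3 : ZMod p) - b 0 with hd3
  set f : (ZMod p)[X] := (C d1 * X + C 1) * (C d2 * X + C 1) * (C d3 * X + C 1) with hf
  have n1 : d1 ≠ 0 := hd 1 (by decide)
  have n2 : d2 ≠ 0 := hd 2 (by decide)
  have n3 : d3 ≠ 0 := hd 3 (by decide)
  have hz : ∀ d : ZMod p, d ≠ 0 → (C d * X + C 1 : (ZMod p)[X]) ≠ 0 := by
    intro d h h0
    have := natDegree_linear (b := (1 : ZMod p)) h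
    rw [h0] at this
    simp at this
  have hdeg : f.natDegree = 3 := by
    rw [hf, natDegree_mul (mul_ne_zero (hz _ n1) (hz _ n2)) (hz _ n3),
      natDegree_mul (hz _ n1) (hz _ n2), natDegree_linear n1, natDegree_linear n2,
      natDegree_linear n3]
  have hc0 : f.coeff 0 ≠ 0 := by
    rw [hf, coeff_zero_eq_eval_zero]
    simp
  have hev : ∀ y, f.eval y = (d1 * y + 1) * (d2 * y + 1) * (d3 * y + 1) := by
    intro y; simp [hf]
  have hB := cubic_bound p f hdeg hc0
  have hmain : cs4 p b = (∑ y : ZMod p, jz p (f.eval y)) - 1 := by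
    unfold cs4
    have e1 : ∑ x : ZMod p, jz p ((x + b 0) * (x + b 1) * (x + b 2) * (x + b 3)) =
        ∑ y : ZMod p, jz p (y⁻¹ * (y⁻¹ + d1) * (y⁻¹ + d2) * (y⁻¹ + d3)) := by
      symm
      refine Fintype.sum_equiv ((Equiv.inv (ZMod p)).trans (Equiv.subRight (b 0 : ZMod p))) _ _ ?_
      intro y
      simp only [Equiv.trans_apply, Equiv.inv_apply, Equiv.subRight_apply, hd1, hd2, hd3]
      congr 1; ring
    rw [e1, ← Finset.add_sum_erase _ _ (Finset.mem_univ (0 : ZMod p)),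
      ← Finset.add_sum_erase Finset.univ (fun y => jz p (f.eval y)) (Finset.mem_univ (0 : ZMod p))]
    have e2 : jz p (f.eval 0) = 1 := by
      rw [hev, jz_prime]; simp
    have e3 : jz p ((0 : ZMod p)⁻¹ * ((0 : ZMod p)⁻¹ + d1) * ((0 : ZMod p)⁻¹ + d2) * ((0 : ZMod p)⁻¹ + d3)) = 0 := by
      rw [jz_prime]; simp
    rw [e2, e3]
    have e4 : ∀ y ∈ Finset.univ.erase (0 : ZMod p),
        jz p (y⁻¹ * (y⁻¹ + d1) * (y⁻¹ + d2) * (y⁻¹ + d3)) = jz p (f.eval y) := by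
      intro y hy
      have hy0 : y ≠ 0 := (Finset.mem_erase.1 hy).1
      have : y⁻¹ * (y⁻¹ + d1) * (y⁻¹ + d2) * (y⁻¹ + d3)
          = (y⁻¹ * y⁻¹) * ((y⁻¹ * y⁻¹) * f.eval y) := by
        rw [hev]; field_simp; try ring
      rw [this, jz_mul p (y⁻¹ * y⁻¹), jz_mul p (y⁻¹ * y⁻¹), jz_inv_pow p y hy0]; ring
    rw [Finset.sum_congr rfl e4]; ring
  rw [hmain]
  have hs1 : 1 ≤ Real.sqrt p := by
    rw [Real.one_le_sqrt]; exact_mod_cast hpp.one_lt.le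
  push_cast
  push_cast at hB
  rw [abs_le] at hB ⊢
  constructor <;> linarith [hB.1, hB.2]

lemma cs2_prime (p : ℕ) [Fact p.Prime] (hp2 : p ≠ 2) (b c : ℤ)
    (hb : ¬ (p : ℤ) ∣ (b - c)) :
    |cs2 p b c| ≤ 1 := by
  have hpp : p.Prime := Fact.out
  set d : ZMod p := (c : ZMod p) - b with hd
  have n1 : d ≠ 0 := by
    intro h0
    have h1 : ((b - c : ℤ) : ZMod p) = 0 := by push_cast; linear_combination -h0
    rw [ZMod.intCast_zmod_eq_zero_iff_dvd] at h1
    exact hb h1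
  have hz : ∑ y : ZMod p, jz p (d * y + 1) = 0 := by
    have e : ∑ y : ZMod p, jz p (d * y + 1) = ∑ y : ZMod p, jz p y := by
      refine Fintype.sum_equiv ((Equiv.mulLeft₀ d n1).trans (Equiv.addRight (1 : ZMod p))) _ _ ?_
      intro y; simp
    rw [e, Finset.sum_congr rfl fun x _ => jz_prime p x]
    exact quadraticChar_sum_zero (by rw [ZMod.ringChar_zmod_n]; exact hp2)
  have hmain : cs2 p b c = (∑ y : ZMod p, jz p (d * y + 1)) - 1 := by
    unfold cs2
    have e1 : ∑ x : ZMod p, jz p ((x + b) * (x + c)) =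
        ∑ y : ZMod p, jz p (y⁻¹ * (y⁻¹ + d)) := by
      symm
      refine Fintype.sum_equiv ((Equiv.inv (ZMod p)).trans (Equiv.subRight (b : ZMod p))) _ _ ?_
      intro y
      simp only [Equiv.trans_apply, Equiv.inv_apply, Equiv.subRight_apply, hd]
      congr 1; ring
    rw [e1, ← Finset.add_sum_erase _ _ (Finset.mem_univ (0 : ZMod p)),
      ← Finset.add_sum_erase Finset.univ (fun y => jz p (d * y + 1)) (Finset.mem_univ (0 : ZMod p))]
    have e2 : jz p (d * 0 + 1) = 1 := by
      rw [jz_prime]; simp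
    have e3 : jz p ((0 : ZMod p)⁻¹ * ((0 : ZMod p)⁻¹ + d)) = 0 := by
      rw [jz_prime]; simp
    rw [e2, e3]
    have e4 : ∀ y ∈ Finset.univ.erase (0 : ZMod p),
        jz p (y⁻¹ * (y⁻¹ + d)) = jz p (d * y + 1) := by
      intro y hy
      have hy0 : y ≠ 0 := (Finset.mem_erase.1 hy).1
      have : y⁻¹ * (y⁻¹ + d) = (y⁻¹ * y⁻¹) * (d * y + 1) := by
        field_simp; try ring
      rw [this, jz_mul, jz_inv_pow p y hy0]; ring
    rw [Finset.sum_congr rfl e4]; ring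
  rw [hmain, hz]; norm_num

/-- Bound for squarefree moduli. -/
lemma cs4_bound (b : Fin 4 → ℤ) (m : ℕ) : ∀ [NeZero m], Squarefree m →
    |((cs4 m b : ℤ) : ℝ)| ≤ 21 ^ m.primeFactors.card * Real.sqrt m *
      Real.sqrt (Int.gcd m ((b 0 - b 1) * (b 0 - b 2) * (b 0 - b 3))) := by
  induction m using Nat.recOnPosPrimePosCoprime with
  | prime_pow p n hp hn =>
    intro _ hsq
    have hn1 : n = 1 := by
      by_contra h
      have h2 : p * p ∣ p ^ n := by
        rw [← pow_two]; exact pow_dvd_pow _ (by omega)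
      have := hsq p h2
      exact hp.one_lt.ne' (Nat.isUnit_iff.1 this)
    subst hn1
    haveI : Fact (p ^ 1).Prime := ⟨by simpa using hp⟩
    have hp' : (p ^ 1).Prime := by simpa using hp
    rw [Nat.Prime.primeFactors hp', Finset.card_singleton, pow_one (21 : ℝ)]
    have hs0 : 0 ≤ Real.sqrt ((p ^ 1 : ℕ) : ℝ) := Real.sqrt_nonneg _
    by_cases hb : ((p ^ 1 : ℕ) : ℤ) ∣ (b 0 - b 1) * (b 0 - b 2) * (b 0 - b 3)
    · have e : Int.gcd ((p ^ 1 : ℕ) : ℤ) ((b 0 - b 1) * (b 0 - b 2) * (b 0 - b 3)) = p ^ 1 := by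
        simp only [Int.gcd, Int.natAbs_natCast]; exact Nat.gcd_eq_left (Int.natCast_dvd.1 hb)
      rw [e]
      have h1 : |((cs4 (p ^ 1) b : ℤ) : ℝ)| ≤ ((p ^ 1 : ℕ) : ℝ) := by
        exact_mod_cast cs4_abs_le (p ^ 1) b
      rw [mul_assoc, Real.mul_self_sqrt (Nat.cast_nonneg _)]
      have : (0 : ℝ) ≤ ((p ^ 1 : ℕ) : ℝ) := Nat.cast_nonneg _
      linarith
    · have h1 := cs4_prime (p ^ 1) b hb
      refine h1.trans (le_mul_of_one_le_right (by positivity) ?_)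
      rw [Real.one_le_sqrt]
      have : 0 < Int.gcd ((p ^ 1 : ℕ) : ℤ) ((b 0 - b 1) * (b 0 - b 2) * (b 0 - b 3)) :=
        Int.gcd_pos_of_ne_zero_left _ (by exact_mod_cast hp'.ne_zero)
      exact_mod_cast this
  | zero => intro h; exact absurd rfl h.out
  | one =>
    intro _ _
    have h1 : |((cs4 1 b : ℤ) : ℝ)| ≤ ((1 : ℕ) : ℝ) := by
      exact_mod_cast cs4_abs_le 1 b
    simpa using h1
  | coprime m n hm hn hmn ihm ihn =>
    intro _ hsq
    haveI : NeZero m := ⟨by omega⟩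
    haveI : NeZero n := ⟨by omega⟩
    have hsm : Squarefree m := hsq.squarefree_of_dvd (Dvd.intro _ rfl)
    have hsn : Squarefree n := hsq.squarefree_of_dvd (Dvd.intro_left _ rfl)
    have a1 := ihm hsm
    have a2 := ihn hsn
    rw [cs4_crt m n hmn b, Nat.Coprime.primeFactors_mul hmn,
      Finset.card_union_of_disjoint hmn.disjoint_primeFactors]
    have hg : Int.gcd ((m * n : ℕ) : ℤ) ((b 0 - b 1) * (b 0 - b 2) * (b 0 - b 3)) =
        Int.gcd (m : ℤ) ((b 0 - b 1) * (b 0 - b 2) * (b 0 - b 3)) *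
        Int.gcd (n : ℤ) ((b 0 - b 1) * (b 0 - b 2) * (b 0 - b 3)) := by
      simp only [Int.gcd, Int.natAbs_natCast]
      rw [Nat.gcd_comm, Nat.Coprime.gcd_mul _ hmn, Nat.gcd_comm _ m, Nat.gcd_comm _ n]
    rw [hg]
    push_cast
    rw [abs_mul, Real.sqrt_mul (Nat.cast_nonneg _), Real.sqrt_mul (Nat.cast_nonneg _), pow_add]
    calc _ ≤ _ := mul_le_mul a1 a2 (abs_nonneg _) (by positivity)
      _ = _ := by ring

lemma cs2_bound (b c : ℤ) (m : ℕ) : ∀ [NeZero m], Squarefree m → Odd m →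
    |cs2 m b c| ≤ Int.gcd m (b - c) := by
  induction m using Nat.recOnPosPrimePosCoprime with
  | prime_pow p n hp hn =>
    intro _ hsq hodd
    have hn1 : n = 1 := by
      by_contra h
      have h2 : p * p ∣ p ^ n := by
        rw [← pow_two]; exact pow_dvd_pow _ (by omega)
      have := hsq p h2
      exact hp.one_lt.ne' (Nat.isUnit_iff.1 this)
    subst hn1
    haveI : Fact (p ^ 1).Prime := ⟨by simpa using hp⟩
    have hp' : (p ^ 1).Prime := by simpa using hp
    by_cases hb : ((p ^ 1 : ℕ) : ℤ) ∣ b - c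
    · have e : Int.gcd ((p ^ 1 : ℕ) : ℤ) (b - c) = p ^ 1 := by
        simp only [Int.gcd, Int.natAbs_natCast]; exact Nat.gcd_eq_left (Int.natCast_dvd.1 hb)
      rw [e]
      exact_mod_cast cs2_abs_le (p ^ 1) b c
    · refine (cs2_prime (p ^ 1) (by rintro h; rw [h] at hodd; exact absurd hodd (by decide)) b c hb).trans ?_
      have : 0 < Int.gcd ((p ^ 1 : ℕ) : ℤ) (b - c) :=
        Int.gcd_pos_of_ne_zero_left _ (by exact_mod_cast hp'.ne_zero)
      exact_mod_cast this
  | zero => intro h; exact absurd rfl h.out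
  | one =>
    intro _ _ _
    have h1 := cs2_abs_le 1 b c
    simpa using h1
  | coprime m n hm hn hmn ihm ihn =>
    intro _ hsq hodd
    haveI : NeZero m := ⟨by omega⟩
    haveI : NeZero n := ⟨by omega⟩
    have hsm : Squarefree m := hsq.squarefree_of_dvd (Dvd.intro _ rfl)
    have hsn : Squarefree n := hsq.squarefree_of_dvd (Dvd.intro_left _ rfl)
    have a1 := ihm hsm (Nat.odd_mul.1 hodd).1
    have a2 := ihn hsn (Nat.odd_mul.1 hodd).2
    have hg : Int.gcd ((m * n : ℕ) : ℤ) (b - c) = Int.gcd (m : ℤ) (b - c) * Int.gcd (n : ℤ) (b - c) := by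
      simp only [Int.gcd, Int.natAbs_natCast]
      rw [Nat.gcd_comm, Nat.Coprime.gcd_mul _ hmn, Nat.gcd_comm _ m, Nat.gcd_comm _ n]
    rw [cs2_crt m n hmn b c, hg, abs_mul]
    push_cast
    exact mul_le_mul a1 a2 (abs_nonneg _) (by positivity)

end CharSums

/-! ## Part 3: arithmetic preliminaries -/

/-- `K ^ ω(n)` is bounded by a small power of `n`. -/
lemma omega_pow_le (K δ : ℝ) (hK : 1 ≤ K) (hδ : 0 < δ) :
    ∃ C : ℝ, 1 ≤ C ∧ ∀ n : ℕ, n ≠ 0 → K ^ n.primeFactors.card ≤ C * (n : ℝ) ^ δ := by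
  set N0 : ℕ := ⌈K ^ (1 / δ)⌉₊ with hN0
  refine ⟨K ^ N0, one_le_pow₀ hK, ?_⟩
  intro n hn
  have hbig : ∀ p : ℕ, N0 ≤ p → K ≤ (p : ℝ) ^ δ := by
    intro p hp
    have h1 : K ^ (1 / δ) ≤ p := (Nat.le_ceil _).trans (by exact_mod_cast hp)
    have h2 := Real.rpow_le_rpow (by positivity) h1 hδ.le
    rwa [← Real.rpow_mul (by positivity), one_div_mul_cancel hδ.ne', Real.rpow_one] at h2
  have h1 : K ^ n.primeFactors.card ≤
      ∏ p ∈ n.primeFactors, ((if p < N0 then K else 1) * (p : ℝ) ^ δ) := by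
    rw [← Finset.prod_const]
    refine Finset.prod_le_prod (fun _ _ => by positivity) ?_
    intro p hp
    have hp1 : (1 : ℝ) ≤ (p : ℝ) ^ δ := by
      refine Real.one_le_rpow ?_ hδ.le
      exact_mod_cast (Nat.prime_of_mem_primeFactors hp).one_lt.le
    split_ifs with h
    · nlinarith
    · rw [one_mul]; exact hbig p (by omega)
  refine h1.trans ?_
  rw [Finset.prod_mul_distrib]
  refine mul_le_mul ?_ ?_ (Finset.prod_nonneg fun _ _ => by positivity) (by positivity)
  · rw [Finset.prod_ite, Finset.prod_const, Finset.prod_const_one, mul_one]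
    refine pow_le_pow_right₀ hK ?_
    calc _ ≤ (Finset.range N0).card := by
          refine Finset.card_le_card ?_
          intro p hp
          exact Finset.mem_range.2 (Finset.mem_filter.1 hp).2
      _ = N0 := Finset.card_range _
  · rw [Real.finsetProd_rpow _ _ (fun _ _ => by positivity)]
    refine Real.rpow_le_rpow (Finset.prod_nonneg fun _ _ => by positivity) ?_ hδ.le
    have := Nat.le_of_dvd (Nat.pos_of_ne_zero hn) (Nat.prod_primeFactors_dvd n)
    have h3 : ((∏ p ∈ n.primeFactors, p : ℕ) : ℝ) ≤ (n : ℝ) := by exact_mod_cast this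
    rwa [Nat.cast_prod] at h3

/-- integers up to `X` all of whose prime factors divide `P` -/
noncomputable def smoothSet (P X : ℕ) : Finset ℕ :=
  (Finset.Icc 1 X).filter fun d => ∀ p : ℕ, p.Prime → p ∣ d → p ∣ P

lemma smooth_count (δ : ℝ) (hδ : 0 < δ) (P X : ℕ) (hP : P ≠ 0) :
    ((smoothSet P X).card : ℝ) ≤ (X : ℝ) ^ δ * ((1 - (2 : ℝ) ^ (-δ))⁻¹) ^ P.primeFactors.card := by
  have hlt : ∀ p : ℕ, p.Prime → ‖((p : ℝ) ^ (-δ))‖ < 1 := by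
    intro p hp
    rw [Real.norm_of_nonneg (by positivity)]
    exact Real.rpow_lt_one_of_one_lt_of_neg (by exact_mod_cast hp.one_lt) (by linarith)
  let f : ℕ →* ℝ :=
    { toFun := fun n => (n : ℝ) ^ (-δ)
      map_one' := by simp
      map_mul' := by
        intro a b; push_cast
        exact Real.mul_rpow (Nat.cast_nonneg _) (Nat.cast_nonneg _) }
  have hE := EulerProduct.summable_and_hasSum_factoredNumbers_prod_filter_prime_geometric
    (f := f) (fun {p} hp => hlt p hp) P.primeFactors
  have hsum := hE.2
  have hfil : P.primeFactors.filter (fun p => p.Prime) = P.primeFactors :=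
    Finset.filter_true_of_mem fun p hp => Nat.prime_of_mem_primeFactors hp
  rw [hfil] at hsum
  have hmem : ∀ d ∈ smoothSet P X, d ∈ Nat.factoredNumbers P.primeFactors := by
    intro d hd
    rw [smoothSet, Finset.mem_filter, Finset.mem_Icc] at hd
    rw [Nat.mem_factoredNumbers_iff_primeFactors_subset]
    refine ⟨by omega, ?_⟩
    intro p hp
    exact Nat.mem_primeFactors.2 ⟨Nat.prime_of_mem_primeFactors hp,
      hd.2 p (Nat.prime_of_mem_primeFactors hp) (Nat.dvd_of_mem_primeFactors hp), hP⟩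
  have h1 : ∑ d ∈ smoothSet P X, f d ≤ ∏ p ∈ P.primeFactors, (1 - f p)⁻¹ := by
    rw [← hsum.tsum_eq]
    have : ∑ d ∈ smoothSet P X, f d = ∑ d ∈ (smoothSet P X).subtype (· ∈ Nat.factoredNumbers P.primeFactors), f d := by
      rw [Finset.sum_subtype_of_mem (fun d => f d) hmem]
    rw [this]
    refine hsum.summable.sum_le_tsum _ ?_
    intro i _
    change 0 ≤ ((i : ℕ) : ℝ) ^ (-δ)
    positivity
  have h2 : ∏ p ∈ P.primeFactors, (1 - f p)⁻¹ ≤ ((1 - (2 : ℝ) ^ (-δ))⁻¹) ^ P.primeFactors.card := by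
    rw [← Finset.prod_const]
    refine Finset.prod_le_prod ?_ ?_
    · intro p hp
      have := hlt p (Nat.prime_of_mem_primeFactors hp)
      rw [Real.norm_of_nonneg (by positivity)] at this
      exact inv_nonneg.2 (sub_nonneg.2 this.le)
    · intro p hp
      have h2p : (2 : ℝ) ≤ p := by exact_mod_cast (Nat.prime_of_mem_primeFactors hp).two_le
      have hh : ((p : ℝ) ^ (-δ)) ≤ (2 : ℝ) ^ (-δ) :=
        Real.rpow_le_rpow_of_nonpos (by norm_num) h2p (by linarith)
      have h22 : (2 : ℝ) ^ (-δ) < 1 :=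
        Real.rpow_lt_one_of_one_lt_of_neg (by norm_num) (by linarith)
      refine inv_anti₀ (by linarith) ?_
      change 1 - (2 : ℝ) ^ (-δ) ≤ 1 - (p : ℝ) ^ (-δ)
      linarith
  have h3 : ((smoothSet P X).card : ℝ) ≤ (X : ℝ) ^ δ * ∑ d ∈ smoothSet P X, f d := by
    rw [Finset.mul_sum, Finset.card_eq_sum_ones]
    push_cast
    refine Finset.sum_le_sum ?_
    intro d hd
    rw [smoothSet, Finset.mem_filter, Finset.mem_Icc] at hd
    change (1 : ℝ) ≤ (X : ℝ) ^ δ * (d : ℝ) ^ (-δ)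
    have hd0 : (0 : ℝ) < d := by exact_mod_cast hd.1.1
    rw [Real.rpow_neg hd0.le, ← div_eq_mul_inv, one_le_div (by positivity)]
    exact Real.rpow_le_rpow hd0.le (by exact_mod_cast hd.1.2) hδ.le
  calc _ ≤ _ := h3
    _ ≤ _ := mul_le_mul_of_nonneg_left (h1.trans h2) (by positivity)

lemma smooth_bound (δ : ℝ) (hδ : 0 < δ) : ∃ C : ℝ, 1 ≤ C ∧ ∀ P X : ℕ, P ≠ 0 →
    ((smoothSet P X).card : ℝ) ≤ C * (P : ℝ) ^ δ * (X : ℝ) ^ δ := by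
  have h22 : (2 : ℝ) ^ (-δ) < 1 :=
    Real.rpow_lt_one_of_one_lt_of_neg (by norm_num) (by linarith)
  have hpos : (0 : ℝ) < (2 : ℝ) ^ (-δ) := by positivity
  obtain ⟨C, hC, h⟩ := omega_pow_le ((1 - (2 : ℝ) ^ (-δ))⁻¹) δ
    ((one_le_inv₀ (by linarith)).2 (by linarith)) hδ
  refine ⟨C, hC, ?_⟩
  intro P X hP
  refine (smooth_count δ hδ P X hP).trans ?_
  have := h P hP
  calc _ ≤ (X : ℝ) ^ δ * (C * (P : ℝ) ^ δ) := mul_le_mul_of_nonneg_left this (by positivity)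
    _ = _ := by ring

/-- decomposition of an integer with respect to the primes dividing `P` -/
lemma exists_smooth_decomp (P : ℕ) (n : ℕ) (hn : n ≠ 0) :
    ∃ d e : ℕ, n = d * e ∧ (∀ p : ℕ, p.Prime → p ∣ d → p ∣ P) ∧ Nat.Coprime e P := by
  induction n using Nat.strong_induction_on with
  | _ n ih =>
    by_cases h : Nat.Coprime n P
    · exact ⟨1, n, by simp, fun p hp h1 => absurd (Nat.dvd_one.1 h1) hp.one_lt.ne', h⟩
    · obtain ⟨p, hp, hpn, hpP⟩ := Nat.Prime.not_coprime_iff_dvd.1 h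
      obtain ⟨k, rfl⟩ := hpn
      have hk : k ≠ 0 := by rintro rfl; simp at hn
      obtain ⟨d, e, rfl, h1, h2⟩ := ih k (by nlinarith [hp.two_le, Nat.pos_of_ne_zero hk]) hk
      refine ⟨p * d, e, by ring, ?_, h2⟩
      intro r hr hrd
      rcases (Nat.Prime.dvd_mul hr).1 hrd with h3 | h3
      · rwa [(Nat.prime_dvd_prime_iff_eq hr hp).1 h3]
      · exact h1 r hr h3

/-- integers in `[1, A]` coprime to `m` -/
noncomputable def copSet (m A : ℕ) : Finset ℕ := (Finset.Icc 1 A).filter fun a => a.Coprime m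

lemma copSet_card (m A : ℕ) : A ≤ (smoothSet m A).card * (copSet m A).card := by
  rw [← Finset.card_product]
  calc A = (Finset.Icc 1 A).card := by simp
    _ ≤ ((smoothSet m A ×ˢ copSet m A).image fun z => z.1 * z.2).card := by
        refine Finset.card_le_card ?_
        intro n hn
        rw [Finset.mem_Icc] at hn
        obtain ⟨d, e, rfl, h1, h2⟩ := exists_smooth_decomp m n (by omega)
        have hd : 0 < d := Nat.pos_of_ne_zero (by rintro rfl; simp at hn)
        have he : 0 < e := Nat.pos_of_ne_zero (by rintro rfl; simp at hn)
        rw [Finset.mem_image]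
        refine ⟨(d, e), ?_, rfl⟩
        rw [Finset.mem_product, smoothSet, copSet, Finset.mem_filter, Finset.mem_filter,
          Finset.mem_Icc, Finset.mem_Icc]
        exact ⟨⟨⟨hd, by nlinarith⟩, h1⟩, ⟨he, by nlinarith⟩, h2⟩
    _ ≤ _ := Finset.card_image_le

lemma sum_gcd_le (m B : ℕ) (hm : m ≠ 0) :
    ∑ t ∈ Finset.Ioc 0 B, Nat.gcd m t ≤ B * m.divisors.card := by
  calc ∑ t ∈ Finset.Ioc 0 B, Nat.gcd m t
      ≤ ∑ t ∈ Finset.Ioc 0 B, ∑ d ∈ m.divisors, if d ∣ t then d else 0 := by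
        refine Finset.sum_le_sum ?_
        intro t _
        have h1 : Nat.gcd m t ∈ m.divisors := Nat.mem_divisors.2 ⟨Nat.gcd_dvd_left _ _, hm⟩
        refine le_trans ?_ (Finset.single_le_sum (f := fun d => if d ∣ t then d else 0)
          (fun _ _ => Nat.zero_le _) h1)
        simp [Nat.gcd_dvd_right]
    _ = ∑ d ∈ m.divisors, ∑ t ∈ Finset.Ioc 0 B, if d ∣ t then d else 0 := Finset.sum_comm
    _ ≤ ∑ d ∈ m.divisors, B := by
        refine Finset.sum_le_sum ?_
        intro d _
        rw [← Finset.sum_filter, Finset.sum_const, Nat.Ioc_filter_dvd_card_eq_div, smul_eq_mul]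
        exact Nat.div_mul_le_self _ _
    _ = _ := by rw [Finset.sum_const, smul_eq_mul, mul_comm]

/-- off-diagonal gcd weight -/
noncomputable def gw (m b c : ℕ) : ℕ := if b = c then 0 else Int.gcd m ((b : ℤ) - c)

lemma sum_gw_le (m B : ℕ) (hm : m ≠ 0) (b : ℕ) (hb : b < B) :
    ∑ c ∈ Finset.range B, gw m b c ≤ 2 * B * m.divisors.card := by
  have h := sum_gcd_le m B hm
  have key : ∀ c ∈ Finset.range B, gw m b c ≤
      (if c < b then Nat.gcd m (b - c) else 0) + (if b < c then Nat.gcd m (c - b) else 0) := by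
    intro c _
    unfold gw
    rcases lt_trichotomy b c with h1 | h1 | h1
    · rw [if_neg (by omega), if_neg (by omega), if_pos h1, zero_add]
      have : ((b : ℤ) - c).natAbs = c - b := by omega
      rw [Int.gcd, this]; simp
    · simp [h1]
    · rw [if_neg (by omega), if_pos h1, if_neg (by omega), add_zero]
      have : ((b : ℤ) - c).natAbs = b - c := by omega
      rw [Int.gcd, this]; simp
  refine (Finset.sum_le_sum key).trans ?_
  rw [Finset.sum_add_distrib, ← Finset.sum_filter, ← Finset.sum_filter]
  have e1 : ∑ c ∈ (Finset.range B).filter (fun c => c < b), Nat.gcd m (b - c) ≤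
      ∑ t ∈ Finset.Ioc 0 B, Nat.gcd m t := by
    rw [← Finset.sum_image (f := fun t => Nat.gcd m t) (g := fun c => b - c)
      (s := (Finset.range B).filter (fun c => c < b))]
    · refine Finset.sum_le_sum_of_subset ?_
      intro t ht
      obtain ⟨c, hc, rfl⟩ := Finset.mem_image.1 ht
      rw [Finset.mem_filter, Finset.mem_range] at hc
      rw [Finset.mem_Ioc]; omega
    · intro x hx y hy hxy
      have hx' := (Finset.mem_filter.1 hx).2
      have hy' := (Finset.mem_filter.1 hy).2
      simp only at hxy; omega
  have e2 : ∑ c ∈ (Finset.range B).filter (fun c => b < c), Nat.gcd m (c - b) ≤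
      ∑ t ∈ Finset.Ioc 0 B, Nat.gcd m t := by
    rw [← Finset.sum_image (f := fun t => Nat.gcd m t) (g := fun c => c - b)
      (s := (Finset.range B).filter (fun c => b < c))]
    · refine Finset.sum_le_sum_of_subset ?_
      intro t ht
      obtain ⟨c, hc, rfl⟩ := Finset.mem_image.1 ht
      rw [Finset.mem_filter, Finset.mem_range] at hc
      rw [Finset.mem_Ioc]; omega
    · intro x hx y hy hxy
      have hx' := (Finset.mem_filter.1 hx).2
      have hy' := (Finset.mem_filter.1 hy).2
      simp only at hxy; omega
  nlinarith

/-- harmonic sum -/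
noncomputable def harm (A : ℕ) : ℝ := ∑ a ∈ Finset.Icc 1 A, (1 : ℝ) / a

lemma harm_nonneg (A : ℕ) : 0 ≤ harm A := Finset.sum_nonneg fun _ _ => by positivity

lemma harm_le (A : ℕ) : harm A ≤ 1 + Real.log A := by
  have h := harmonic_le_one_add_log A
  rw [harmonic_eq_sum_Icc] at h
  push_cast at h
  unfold harm
  simpa using h

lemma sum_tau_div_le (A : ℕ) :
    ∑ a ∈ Finset.Icc 1 A, (a.divisors.card : ℝ) / a ≤ harm A ^ 2 := by
  have h1 : ∀ a ∈ Finset.Icc 1 A, (a.divisors.card : ℝ) / a =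
      ∑ d ∈ Finset.Icc 1 A, if d ∣ a then (1 : ℝ) / a else 0 := by
    intro a ha
    rw [Finset.mem_Icc] at ha
    rw [← Finset.sum_filter, Finset.sum_const, nsmul_eq_mul, mul_one_div]
    congr 3
    ext d
    rw [Nat.mem_divisors, Finset.mem_filter, Finset.mem_Icc]
    constructor
    · rintro ⟨h, _⟩
      exact ⟨⟨Nat.pos_of_dvd_of_pos h (by omega), (Nat.le_of_dvd (by omega) h).trans ha.2⟩, h⟩
    · rintro ⟨_, h⟩; exact ⟨h, by omega⟩
  rw [Finset.sum_congr rfl h1, Finset.sum_comm, pow_two]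
  have h2 : ∀ d ∈ Finset.Icc 1 A, (∑ a ∈ Finset.Icc 1 A, if d ∣ a then (1 : ℝ) / a else 0) ≤
      (1 : ℝ) / d * harm A := by
    intro d hd
    rw [Finset.mem_Icc] at hd
    rw [← Finset.sum_filter, harm, Finset.mul_sum]
    have hsub : (Finset.Icc 1 A).filter (fun a => d ∣ a) ⊆ (Finset.Icc 1 A).image (fun e => d * e) := by
      intro a ha
      rw [Finset.mem_filter, Finset.mem_Icc] at ha
      obtain ⟨⟨h1, h2⟩, e, rfl⟩ := ha
      rw [Finset.mem_image]
      refine ⟨e, Finset.mem_Icc.2 ⟨Nat.pos_of_ne_zero (by rintro rfl; simp at h1), by nlinarith⟩, rfl⟩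
    refine (Finset.sum_le_sum_of_subset_of_nonneg hsub fun _ _ _ => by positivity).trans ?_
    rw [Finset.sum_image]
    · refine Finset.sum_le_sum fun e _ => ?_
      push_cast
      rw [one_div_mul_one_div]
    · intro x _ y _ hxy
      exact Nat.eq_of_mul_eq_mul_left (by omega) hxy
  refine (Finset.sum_le_sum h2).trans ?_
  rw [← Finset.sum_mul]
  rfl

lemma sum_gcd_div_le (A : ℕ) :
    ∑ a ∈ Finset.Icc 1 A, ∑ b ∈ Finset.Icc 1 A, (Nat.gcd a b : ℝ) / a ≤ A * harm A ^ 2 := by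
  refine le_trans ?_ (mul_le_mul_of_nonneg_left (sum_tau_div_le A) (Nat.cast_nonneg A))
  rw [Finset.mul_sum]
  refine Finset.sum_le_sum ?_
  intro a ha
  rw [Finset.mem_Icc] at ha
  have h := sum_gcd_le a A (by omega)
  have h' : ((∑ t ∈ Finset.Ioc 0 A, Nat.gcd a t : ℕ) : ℝ) ≤ ((A * a.divisors.card : ℕ) : ℝ) := by
    exact_mod_cast h
  push_cast at h'
  rw [← Finset.sum_div, ← mul_div_assoc]
  have e : Finset.Icc 1 A = Finset.Ioc 0 A := by ext; simp [Nat.succ_le_iff]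
  rw [e]
  gcongr

/-! ## Part 4: moments and the Burgess bound -/

lemma sum_pow_four {ι : Type*} (s : Finset ι) (f : ι → ℤ) : (∑ i ∈ s, f i) ^ 4 =
    ∑ b ∈ s, ∑ c ∈ s, ∑ d ∈ s, ∑ e ∈ s, f b * f c * f d * f e := by
  simp only [← Finset.mul_sum, ← Finset.sum_mul]; ring

lemma moment_two (m : ℕ) [NeZero m] (hsq : Squarefree m) (hodd : Odd m) (B : ℕ) :
    ∑ u : ZMod m, (∑ b ∈ Finset.range B, jz m (u + (b : ZMod m))) ^ 2 ≤
      (B : ℤ) * m + 2 * (B : ℤ) ^ 2 * m.divisors.card := by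
  have h1 : ∑ u : ZMod m, (∑ b ∈ Finset.range B, jz m (u + (b : ZMod m))) ^ 2 =
      ∑ b ∈ Finset.range B, ∑ c ∈ Finset.range B, cs2 m b c := by
    simp only [pow_two, Finset.sum_mul_sum]
    rw [Finset.sum_comm]
    refine Finset.sum_congr rfl fun b _ => ?_
    rw [Finset.sum_comm]
    refine Finset.sum_congr rfl fun c _ => ?_
    unfold cs2
    refine Finset.sum_congr rfl fun u _ => ?_
    rw [jz_mul]; simp
  rw [h1]
  have h2 : ∀ b ∈ Finset.range B, ∑ c ∈ Finset.range B, cs2 m b c ≤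
      (m : ℤ) + 2 * B * m.divisors.card := by
    intro b hb
    have h3 : ∀ c ∈ Finset.range B, cs2 m b c ≤ (if b = c then (m : ℤ) else 0) + (gw m b c : ℤ) := by
      intro c _
      unfold gw
      split_ifs with h
      · have := le_of_abs_le (cs2_abs_le m b c)
        simpa using this
      · have := le_of_abs_le (cs2_bound b c m hsq hodd)
        simpa using this
    refine (Finset.sum_le_sum h3).trans ?_
    rw [Finset.sum_add_distrib, Finset.sum_ite_eq, if_pos hb]
    have := sum_gw_le m B (NeZero.ne m) b (Finset.mem_range.1 hb)
    have h4 : ((∑ c ∈ Finset.range B, gw m b c : ℕ) : ℤ) ≤ ((2 * B * m.divisors.card : ℕ) : ℤ) := by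
      exact_mod_cast this
    push_cast at h4
    linarith
  refine (Finset.sum_le_sum h2).trans ?_
  rw [Finset.sum_const, Finset.card_range, nsmul_eq_mul]
  apply le_of_eq; ring

lemma cs4_bound' (m : ℕ) [NeZero m] (hsq : Squarefree m) (b c d e : ℕ)
    (h1 : b ≠ c) (h2 : b ≠ d) (h3 : b ≠ e) :
    |((cs4 m ![(b : ℤ), c, d, e] : ℤ) : ℝ)| ≤ 21 ^ m.primeFactors.card * Real.sqrt m *
      (gw m b c * gw m b d * gw m b e : ℕ) := by
  refine (cs4_bound ![(b : ℤ), c, d, e] m hsq).trans ?_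
  refine mul_le_mul_of_nonneg_left ?_ (by positivity)
  have hg : Int.gcd m (((b : ℤ) - c) * ((b : ℤ) - d) * ((b : ℤ) - e)) ≤
      gw m b c * gw m b d * gw m b e := by
    unfold gw
    rw [if_neg h1, if_neg h2, if_neg h3]
    simp only [Int.gcd, Int.natAbs_mul, Int.natAbs_natCast]
    have hp : ∀ t, 0 < Nat.gcd m t := fun t => Nat.gcd_pos_of_pos_left _ (NeZero.pos m)
    refine Nat.le_of_dvd (Nat.mul_pos (Nat.mul_pos (hp _) (hp _)) (hp _)) ?_
    refine (Nat.gcd_mul_right_dvd_mul_gcd m _ _).trans ?_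
    exact Nat.mul_dvd_mul (Nat.gcd_mul_right_dvd_mul_gcd m _ _) dvd_rfl
  have hg' : Real.sqrt (Int.gcd m (((b : ℤ) - c) * ((b : ℤ) - d) * ((b : ℤ) - e))) ≤
      (Int.gcd m (((b : ℤ) - c) * ((b : ℤ) - d) * ((b : ℤ) - e)) : ℝ) := by
    rw [Real.sqrt_le_left (Nat.cast_nonneg _), pow_two]
    exact_mod_cast Nat.le_mul_self _
  refine le_trans ?_ (hg'.trans (by exact_mod_cast hg))
  simp

lemma cs4_comm (m : ℕ) [NeZero m] (b c d e b' c' d' e' : ℤ)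
    (h : ∀ x : ZMod m, (x + b) * (x + c) * (x + d) * (x + e) =
      (x + b') * (x + c') * (x + d') * (x + e')) :
    cs4 m ![b, c, d, e] = cs4 m ![b', c', d', e'] := by
  unfold cs4
  refine Finset.sum_congr rfl fun x _ => ?_
  congr 1
  simpa using h x

lemma gw_nonneg_sum (m B : ℕ) (hm : m ≠ 0) (b : ℕ) (hb : b < B) :
    ∑ c ∈ Finset.range B, ∑ d ∈ Finset.range B, ∑ e ∈ Finset.range B,
      gw m b c * gw m b d * gw m b e ≤ (2 * B * m.divisors.card) ^ 3 := by
  have : ∑ c ∈ Finset.range B, ∑ d ∈ Finset.range B, ∑ e ∈ Finset.range B,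
      gw m b c * gw m b d * gw m b e = (∑ c ∈ Finset.range B, gw m b c) ^ 3 := by
    simp only [← Finset.mul_sum, ← Finset.sum_mul]; ring
  rw [this]
  exact Nat.pow_le_pow_left (sum_gw_le m B hm b hb) 3

lemma sum_four_rot (s : Finset ℕ) (F : ℕ → ℕ → ℕ → ℕ → ℝ) :
    (∑ b ∈ s, ∑ c ∈ s, ∑ d ∈ s, ∑ e ∈ s, F c b d e) = ∑ b ∈ s, ∑ c ∈ s, ∑ d ∈ s, ∑ e ∈ s, F b c d e := by
  rw [Finset.sum_comm]

lemma sum_four_rot2 (s : Finset ℕ) (F : ℕ → ℕ → ℕ → ℕ → ℝ) :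
    (∑ b ∈ s, ∑ c ∈ s, ∑ d ∈ s, ∑ e ∈ s, F d b c e) = ∑ b ∈ s, ∑ c ∈ s, ∑ d ∈ s, ∑ e ∈ s, F b c d e := by
  rw [← sum_four_rot s F]
  refine Finset.sum_congr rfl fun b _ => ?_
  rw [Finset.sum_comm]

lemma sum_four_rot3 (s : Finset ℕ) (F : ℕ → ℕ → ℕ → ℕ → ℝ) :
    (∑ b ∈ s, ∑ c ∈ s, ∑ d ∈ s, ∑ e ∈ s, F e b c d) = ∑ b ∈ s, ∑ c ∈ s, ∑ d ∈ s, ∑ e ∈ s, F b c d e := by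
  rw [← sum_four_rot2 s F]
  refine Finset.sum_congr rfl fun b _ => ?_
  refine Finset.sum_congr rfl fun c _ => ?_
  rw [Finset.sum_comm]

lemma moment_four (m : ℕ) [NeZero m] (hsq : Squarefree m) (B : ℕ) :
    ((∑ u : ZMod m, (∑ b ∈ Finset.range B, jz m (u + (b : ZMod m))) ^ 4 : ℤ) : ℝ) ≤
      3 * (B : ℝ) ^ 2 * m + 32 * (21 ^ m.primeFactors.card * Real.sqrt m) * (B : ℝ) ^ 4 *
        (m.divisors.card : ℝ) ^ 3 := by
  set Q : ℝ := 21 ^ m.primeFactors.card * Real.sqrt m with hQ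
  have hQ0 : 0 ≤ Q := by positivity
  set s := Finset.range B with hs
  have h1 : ∑ u : ZMod m, (∑ b ∈ s, jz m (u + (b : ZMod m))) ^ 4 =
      ∑ b ∈ s, ∑ c ∈ s, ∑ d ∈ s, ∑ e ∈ s, cs4 m ![(b : ℤ), c, d, e] := by
    simp only [sum_pow_four]
    rw [Finset.sum_comm]
    refine Finset.sum_congr rfl fun b _ => ?_
    rw [Finset.sum_comm]
    refine Finset.sum_congr rfl fun c _ => ?_
    rw [Finset.sum_comm]
    refine Finset.sum_congr rfl fun d _ => ?_
    rw [Finset.sum_comm]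
    refine Finset.sum_congr rfl fun e _ => ?_
    unfold cs4
    refine Finset.sum_congr rfl fun u _ => ?_
    rw [jz_mul, jz_mul, jz_mul]; simp
  rw [h1]
  push_cast
  let Γ : ℕ → ℕ → ℕ → ℕ → ℝ := fun b c d e => Q * (gw m b c * gw m b d * gw m b e : ℕ)
  have hΓ0 : ∀ b c d e, 0 ≤ Γ b c d e := fun b c d e => mul_nonneg hQ0 (Nat.cast_nonneg _)
  let D : ℕ → ℕ → ℕ → ℕ → ℝ := fun b c d e => if b = c ∧ d = e then (m : ℝ) else 0
  have hD0 : ∀ b c d e, 0 ≤ D b c d e := fun b c d e => by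
    simp only [D]; split_ifs <;> positivity
  have hpt : ∀ b c d e : ℕ, ((cs4 m ![(b : ℤ), c, d, e] : ℤ) : ℝ) ≤
      (D b c d e + D b d c e + D b e c d) + (Γ b c d e + Γ c b d e + Γ d b c e + Γ e b c d) := by
    intro b c d e
    have htriv : ((cs4 m ![(b : ℤ), c, d, e] : ℤ) : ℝ) ≤ m := by
      have := le_of_abs_le (cs4_abs_le m ![(b : ℤ), c, d, e])
      exact_mod_cast this
    have g1 := hΓ0 b c d e
    have g2 := hΓ0 c b d e
    have g3 := hΓ0 d b c e
    have g4 := hΓ0 e b c d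
    have d1 := hD0 b c d e
    have d2 := hD0 b d c e
    have d3 := hD0 b e c d
    by_cases p1 : b = c ∧ d = e
    · have : D b c d e = m := if_pos p1
      linarith
    by_cases p2 : b = d ∧ c = e
    · have : D b d c e = m := if_pos p2
      linarith
    by_cases p3 : b = e ∧ c = d
    · have : D b e c d = m := if_pos p3
      linarith
    by_cases q1 : b ≠ c ∧ b ≠ d ∧ b ≠ e
    · have := le_of_abs_le (cs4_bound' m hsq b c d e q1.1 q1.2.1 q1.2.2)
      change _ ≤ Γ b c d e at this
      linarith
    by_cases q2 : c ≠ b ∧ c ≠ d ∧ c ≠ e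
    · have := le_of_abs_le (cs4_bound' m hsq c b d e q2.1 q2.2.1 q2.2.2)
      change _ ≤ Γ c b d e at this
      rw [cs4_comm m c b d e b c d e (fun x => by ring)] at this
      linarith
    by_cases q3 : d ≠ b ∧ d ≠ c ∧ d ≠ e
    · have := le_of_abs_le (cs4_bound' m hsq d b c e q3.1 q3.2.1 q3.2.2)
      change _ ≤ Γ d b c e at this
      rw [cs4_comm m d b c e b c d e (fun x => by ring)] at this
      linarith
    by_cases q4 : e ≠ b ∧ e ≠ c ∧ e ≠ d
    · have := le_of_abs_le (cs4_bound' m hsq e b c d q4.1 q4.2.1 q4.2.2)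
      change _ ≤ Γ e b c d at this
      rw [cs4_comm m e b c d b c d e (fun x => by ring)] at this
      linarith
    exfalso
    omega
  have hDs : ∑ b ∈ s, ∑ c ∈ s, ∑ d ∈ s, ∑ e ∈ s, D b c d e = (B : ℝ) ^ 2 * m := by
    have : ∀ b ∈ s, ∀ c ∈ s, ∑ d ∈ s, ∑ e ∈ s, D b c d e = if b = c then (B : ℝ) * m else 0 := by
      intro b _ c _
      by_cases hbc : b = c
      · simp only [D, hbc, true_and, if_true]
        rw [Finset.sum_congr rfl (g := fun _ => (m : ℝ))]
        · rw [Finset.sum_const, nsmul_eq_mul, hs, Finset.card_range]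
        · intro d hd; rw [Finset.sum_ite_eq, if_pos hd]
      · simp [D, hbc]
    rw [Finset.sum_congr rfl fun b hb => Finset.sum_congr rfl fun c hc => this b hb c hc]
    rw [Finset.sum_congr rfl (g := fun _ => (B : ℝ) * m)]
    · rw [Finset.sum_const, nsmul_eq_mul, hs, Finset.card_range]; ring
    · intro b hb; rw [Finset.sum_ite_eq, if_pos hb]
  have hGs : ∑ b ∈ s, ∑ c ∈ s, ∑ d ∈ s, ∑ e ∈ s, Γ b c d e ≤
      B * (Q * (2 * B * m.divisors.card) ^ 3) := by
    have : ∀ b ∈ s, ∑ c ∈ s, ∑ d ∈ s, ∑ e ∈ s, Γ b c d e ≤ Q * (2 * B * m.divisors.card) ^ 3 := by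
      intro b hb
      simp only [Γ, ← Finset.mul_sum]
      refine mul_le_mul_of_nonneg_left ?_ hQ0
      have := gw_nonneg_sum m B (NeZero.ne m) b (Finset.mem_range.1 hb)
      exact_mod_cast this
    refine (Finset.sum_le_sum this).trans ?_
    rw [Finset.sum_const, nsmul_eq_mul, hs, Finset.card_range]
  have e1 := sum_four_rot s Γ
  have e2 := sum_four_rot2 s Γ
  have e3 := sum_four_rot3 s Γ
  have f1 : ∑ b ∈ s, ∑ c ∈ s, ∑ d ∈ s, ∑ e ∈ s, D b d c e = ∑ b ∈ s, ∑ c ∈ s, ∑ d ∈ s, ∑ e ∈ s, D b c d e := by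
    refine Finset.sum_congr rfl fun b _ => ?_
    rw [Finset.sum_comm]
  have f2 : ∑ b ∈ s, ∑ c ∈ s, ∑ d ∈ s, ∑ e ∈ s, D b e c d = ∑ b ∈ s, ∑ c ∈ s, ∑ d ∈ s, ∑ e ∈ s, D b c d e := by
    rw [← f1]
    refine Finset.sum_congr rfl fun b _ => Finset.sum_congr rfl fun c _ => ?_
    rw [Finset.sum_comm]
  refine (Finset.sum_le_sum fun b _ => Finset.sum_le_sum fun c _ => Finset.sum_le_sum fun d _ =>
    Finset.sum_le_sum fun e _ => hpt b c d e).trans ?_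
  simp only [Finset.sum_add_distrib]
  rw [f1, f2, e1, e2, e3, hDs]
  nlinarith [hGs]

/-- two applications of Cauchy-Schwarz -/
lemma holder_count {ι U : Type*} [Fintype U] [DecidableEq U] (P : Finset ι) (u : ι → U) (T : U → ℝ)
    (hT : ∀ x, 0 ≤ T x) :
    (∑ p ∈ P, T (u p)) ^ 4 ≤ (P.card : ℝ) ^ 2 *
      (((P ×ˢ P).filter fun z => u z.1 = u z.2).card : ℝ) * ∑ x, T x ^ 4 := by
  have h1 : (∑ p ∈ P, T (u p)) ^ 2 ≤ P.card * ∑ p ∈ P, T (u p) ^ 2 := sq_sum_le_card_mul_sum_sq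
  set ν : U → ℝ := fun x => ((P.filter fun p => u p = x).card : ℝ) with hν
  have h2 : ∑ p ∈ P, T (u p) ^ 2 = ∑ x, ν x * T x ^ 2 := by
    rw [← Finset.sum_fiberwise P u]
    refine Finset.sum_congr rfl fun x _ => ?_
    rw [Finset.sum_congr rfl (g := fun _ => T x ^ 2)]
    · rw [Finset.sum_const, nsmul_eq_mul]
    · intro p hp; rw [(Finset.mem_filter.1 hp).2]
  have h3 : (∑ x, ν x * T x ^ 2) ^ 2 ≤ (∑ x, ν x ^ 2) * ∑ x, (T x ^ 2) ^ 2 :=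
    Finset.sum_mul_sq_le_sq_mul_sq _ _ _
  have h4 : ∑ x, ν x ^ 2 = (((P ×ˢ P).filter fun z => u z.1 = u z.2).card : ℝ) := by
    rw [Finset.card_filter, Finset.sum_product]
    push_cast
    have : ∀ p ∈ P, ∑ p' ∈ P, (if u p = u p' then (1 : ℝ) else 0) = ν (u p) := by
      intro p _
      simp only [hν]
      rw [Finset.card_filter]; push_cast
      refine Finset.sum_congr rfl fun q _ => ?_
      simp only [eq_comm]
    rw [Finset.sum_congr rfl this, ← Finset.sum_fiberwise P u]
    refine Finset.sum_congr rfl fun x _ => ?_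
    rw [Finset.sum_congr rfl (g := fun _ => ν x)]
    · rw [Finset.sum_const, nsmul_eq_mul, pow_two]
    · intro p hp; rw [(Finset.mem_filter.1 hp).2]
  have h0 : 0 ≤ ∑ p ∈ P, T (u p) := Finset.sum_nonneg fun p _ => hT _
  calc (∑ p ∈ P, T (u p)) ^ 4 = ((∑ p ∈ P, T (u p)) ^ 2) ^ 2 := by ring
    _ ≤ (P.card * ∑ p ∈ P, T (u p) ^ 2) ^ 2 := pow_le_pow_left₀ (by positivity) h1 2
    _ = (P.card : ℝ) ^ 2 * (∑ x, ν x * T x ^ 2) ^ 2 := by rw [h2]; ring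
    _ ≤ (P.card : ℝ) ^ 2 * ((∑ x, ν x ^ 2) * ∑ x, (T x ^ 2) ^ 2) :=
        mul_le_mul_of_nonneg_left h3 (by positivity)
    _ = _ := by rw [h4, mul_assoc]; congr 2; exact Finset.sum_congr rfl fun x _ => by ring

/-! ## Part 5: the Burgess bound -/

/-- incomplete character sum -/
noncomputable def Sx (m : ℕ) (M : ℤ) (N : ℕ) : ℤ := ∑ i ∈ Finset.range N, jacobiSym (M + i) m

lemma Sx_add (m : ℕ) (M : ℤ) (N1 N2 : ℕ) : Sx m M (N1 + N2) = Sx m M N1 + Sx m (M + N1) N2 := by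
  unfold Sx
  rw [Finset.sum_range_add]
  congr 1
  refine Finset.sum_congr rfl fun i _ => ?_
  push_cast; rw [add_assoc]

lemma Sx_abs_le (m : ℕ) (M : ℤ) (N : ℕ) : |Sx m M N| ≤ N := by
  unfold Sx
  refine (Finset.abs_sum_le_sum_abs _ _).trans ?_
  calc _ ≤ ∑ i ∈ Finset.range N, (1 : ℤ) := by
        refine Finset.sum_le_sum fun i _ => ?_
        rcases jacobiSym.trichotomy (M + i) m with h | h | h <;> rw [h] <;> norm_num
    _ = N := by simp

lemma Sx_shift (m : ℕ) (M : ℤ) (N h : ℕ) :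
    Sx m M N = Sx m (M + h) N + (Sx m M h - Sx m (M + N) h) := by
  have h1 := Sx_add m M N h
  have h2 := Sx_add m M h N
  rw [add_comm h N] at h2
  linarith

/-- A sum over an interval of length at most `m` is dominated by a complete sum. -/
lemma sum_interval_le (m : ℕ) [NeZero m] (M : ℤ) (N : ℕ) (hN : N ≤ m) (F : ZMod m → ℤ)
    (hF : ∀ x, 0 ≤ F x) : ∑ i ∈ Finset.range N, F ((M + i : ℤ) : ZMod m) ≤ ∑ x, F x := by
  rw [← Finset.sum_image (f := F) (g := fun i : ℕ => ((M + i : ℤ) : ZMod m))]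
  · exact Finset.sum_le_sum_of_subset_of_nonneg (Finset.subset_univ _) fun _ _ _ => hF _
  · intro i hi j hj hij
    have hi' := Finset.mem_range.1 hi
    have hj' := Finset.mem_range.1 hj
    simp only at hij
    push_cast at hij
    have h2 : (i : ZMod m) = j := add_left_cancel hij
    rw [ZMod.natCast_eq_natCast_iff'] at h2
    rwa [Nat.mod_eq_of_lt (by omega), Nat.mod_eq_of_lt (by omega)] at h2

lemma Sx_period (m : ℕ) (hm : 1 < m) (hsq : Squarefree m) (hodd : Odd m) (M : ℤ) :
    Sx m M m = 0 := by
  haveI : NeZero m := ⟨by omega⟩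
  have h1 : Sx m M m = ∑ x : ZMod m, jz m x := by
    have hinj : Set.InjOn (fun i : ℕ => ((M + i : ℤ) : ZMod m)) (Finset.range m) := by
      intro i hi j hj hij
      have hi' := Finset.mem_range.1 hi
      have hj' := Finset.mem_range.1 hj
      simp only at hij
      push_cast at hij
      have h2 : (i : ZMod m) = j := add_left_cancel hij
      rw [ZMod.natCast_eq_natCast_iff'] at h2
      rwa [Nat.mod_eq_of_lt (by omega), Nat.mod_eq_of_lt (by omega)] at h2
    have himg : (Finset.range m).image (fun i : ℕ => ((M + i : ℤ) : ZMod m)) = Finset.univ := by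
      apply Finset.eq_univ_of_card
      rw [Finset.card_image_of_injOn hinj, Finset.card_range, ZMod.card]
    rw [← himg, Finset.sum_image hinj]
    unfold Sx
    exact Finset.sum_congr rfl fun i _ => (jz_intCast m _).symm
  rw [h1]
  obtain ⟨p, hp, k, rfl⟩ := Nat.exists_prime_and_dvd hm.ne'
  have hcop : p.Coprime k := Nat.coprime_of_squarefree_mul hsq
  haveI : Fact p.Prime := ⟨hp⟩
  haveI : NeZero k := ⟨by rintro rfl; simp at hm⟩
  have h2 := cs_crt p k hcop id id id (fun x => by simp)
  simp only [id] at h2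
  rw [h2, Finset.sum_congr rfl fun x _ => jz_prime p x, quadraticChar_sum_zero, zero_mul]
  rw [ZMod.ringChar_zmod_n]
  rintro rfl
  have := (Nat.odd_mul.1 hodd).1
  exact absurd this (by decide)

lemma shift_average {ι : Type*} (m : ℕ) (M : ℤ) (N : ℕ) (hN : 0 < N) (E : ℝ) (hE0 : 0 ≤ E)
    (hE : ∀ (M' : ℤ) (N' : ℕ), N' < N → |(Sx m M' N' : ℝ)| ≤ E * Real.sqrt N')
    (T : Finset ι) (h : ι → ℕ) (hT : ∀ t ∈ T, 16 * h t ≤ N) :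
    (T.card : ℝ) * |(Sx m M N : ℝ)| ≤ T.card * (E * Real.sqrt N / 2) +
      |∑ t ∈ T, (Sx m (M + h t) N : ℝ)| := by
  have key : ∀ t ∈ T, |(Sx m M N : ℝ) - Sx m (M + h t) N| ≤ E * Real.sqrt N / 2 := by
    intro t ht
    have hs := Sx_shift m M N (h t)
    have hs' : (Sx m M N : ℝ) - Sx m (M + h t) N = Sx m M (h t) - Sx m (M + N) (h t) := by
      rw [hs]; push_cast; ring
    rw [hs']
    have hlt : h t < N := by have := hT t ht; omega
    have a1 := hE M (h t) hlt
    have a2 := hE (M + N) (h t) hlt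
    have hsq : Real.sqrt (h t) ≤ Real.sqrt N / 4 := by
      rw [Real.sqrt_le_left (by positivity), div_pow, Real.sq_sqrt (Nat.cast_nonneg _)]
      have : ((16 * h t : ℕ) : ℝ) ≤ N := by exact_mod_cast hT t ht
      push_cast at this
      linarith
    have a3 : E * Real.sqrt (h t) ≤ E * (Real.sqrt N / 4) := mul_le_mul_of_nonneg_left hsq hE0
    refine (abs_sub _ _).trans ?_
    linarith
  have e : (T.card : ℝ) * (Sx m M N : ℝ) = ∑ t ∈ T, ((Sx m M N : ℝ) - Sx m (M + h t) N) +
      ∑ t ∈ T, (Sx m (M + h t) N : ℝ) := by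
    rw [← Finset.sum_add_distrib]; simp
  calc (T.card : ℝ) * |(Sx m M N : ℝ)| = |(T.card : ℝ) * (Sx m M N : ℝ)| := by
        rw [abs_mul, Nat.abs_cast]
    _ ≤ |∑ t ∈ T, ((Sx m M N : ℝ) - Sx m (M + h t) N)| + |∑ t ∈ T, (Sx m (M + h t) N : ℝ)| := by
        rw [e]; exact abs_add_le _ _
    _ ≤ _ := by
        gcongr
        refine (Finset.abs_sum_le_sum_abs _ _).trans ?_
        refine (Finset.sum_le_sum key).trans ?_
        rw [Finset.sum_const, nsmul_eq_mul]

/-- the `r = 1` step -/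
lemma burgess_one (m : ℕ) (hsq : Squarefree m) (hodd : Odd m) (M : ℤ) (N B : ℕ) (hN : 0 < N)
    (hNm : N ≤ m) (hB : 0 < B) (hBN : 16 * B ≤ N) (E : ℝ) (hE0 : 0 ≤ E)
    (hE : ∀ (M' : ℤ) (N' : ℕ), N' < N → |(Sx m M' N' : ℝ)| ≤ E * Real.sqrt N') :
    |(Sx m M N : ℝ)| ≤ E * Real.sqrt N / 2 +
      Real.sqrt N * Real.sqrt (m / B + 2 * m.divisors.card) := by
  haveI : NeZero m := ⟨by omega⟩
  have h1 := shift_average m M N hN E hE0 hE (Finset.range B) (fun b => b) (fun b hb => by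
    have := Finset.mem_range.1 hb; omega)
  rw [Finset.card_range] at h1
  set T : ZMod m → ℤ := fun u => ∑ b ∈ Finset.range B, jz m (u + (b : ZMod m)) with hT
  have h2 : ∑ b ∈ Finset.range B, (Sx m (M + b) N : ℝ) =
      ((∑ n ∈ Finset.range N, T ((M + n : ℤ) : ZMod m) : ℤ) : ℝ) := by
    rw [← Int.cast_sum]
    congr 1
    unfold Sx
    rw [Finset.sum_comm]
    refine Finset.sum_congr rfl fun n _ => ?_
    refine Finset.sum_congr rfl fun b _ => ?_
    rw [← jz_intCast]; congr 1; push_cast; ring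
  have h3 : (∑ n ∈ Finset.range N, T ((M + n : ℤ) : ZMod m)) ^ 2 ≤
      (N : ℤ) * ((B : ℤ) * m + 2 * (B : ℤ) ^ 2 * m.divisors.card) := by
    have a1 := sq_sum_le_card_mul_sum_sq (s := Finset.range N) (f := fun n : ℕ => T ((M + n : ℤ) : ZMod m))
    rw [Finset.card_range] at a1
    refine a1.trans (mul_le_mul_of_nonneg_left ?_ (Nat.cast_nonneg _))
    refine (sum_interval_le m M N hNm (fun x => T x ^ 2) (fun x => sq_nonneg _)).trans ?_
    exact moment_two m hsq hodd B
  have h3r : ((∑ n ∈ Finset.range N, T ((M + n : ℤ) : ZMod m) : ℤ) : ℝ) ^ 2 ≤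
      (N : ℝ) * ((B : ℝ) * m + 2 * (B : ℝ) ^ 2 * m.divisors.card) := by exact_mod_cast h3
  have hB' : (0 : ℝ) < B := by exact_mod_cast hB
  have h4 : |((∑ n ∈ Finset.range N, T ((M + n : ℤ) : ZMod m) : ℤ) : ℝ)| ≤
      B * (Real.sqrt N * Real.sqrt (m / B + 2 * m.divisors.card)) := by
    rw [← Real.sqrt_mul (Nat.cast_nonneg _)]
    refine Real.abs_le_sqrt h3r |>.trans ?_
    rw [Real.sqrt_le_left (by positivity), mul_pow, Real.sq_sqrt (by positivity)]
    apply le_of_eq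
    field_simp
  rw [h2] at h1
  have h5 : (B : ℝ) * |(Sx m M N : ℝ)| ≤ B * (E * Real.sqrt N / 2 +
      Real.sqrt N * Real.sqrt (m / B + 2 * m.divisors.card)) := by
    rw [mul_add]; linarith
  exact le_of_mul_le_mul_left h5 hB'

lemma pair_count (m A N : ℕ) (h2 : 2 * A * N ≤ m) (M : ℤ) (a1 a2 : ℕ) (ha1 : a1 ∈ copSet m A)
    (ha2 : a2 ∈ copSet m A) :
    (((Finset.range N ×ˢ Finset.range N).filter fun z : ℕ × ℕ =>
      (((M + z.1 : ℤ) : ZMod m) * (a1 : ZMod m)⁻¹ = ((M + z.2 : ℤ) : ZMod m) * (a2 : ZMod m)⁻¹)).card : ℝ)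
      ≤ 1 + N * ((Nat.gcd a1 a2 : ℝ) / a1) := by
  rw [copSet, Finset.mem_filter, Finset.mem_Icc] at ha1 ha2
  obtain ⟨⟨p1, q1⟩, c1⟩ := ha1
  obtain ⟨⟨p2, q2⟩, c2⟩ := ha2
  set R := (Finset.range N ×ˢ Finset.range N).filter fun z : ℕ × ℕ =>
      (((M + z.1 : ℤ) : ZMod m) * (a1 : ZMod m)⁻¹ = ((M + z.2 : ℤ) : ZMod m) * (a2 : ZMod m)⁻¹) with hR
  have i1 := ZMod.coe_mul_inv_eq_one a1 c1
  have i2 := ZMod.coe_mul_inv_eq_one a2 c2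
  have hdvd : ∀ z ∈ R, (m : ℤ) ∣ (M + z.1) * a2 - (M + z.2) * a1 := by
    intro z hz
    have h := (Finset.mem_filter.1 hz).2
    rw [← ZMod.intCast_zmod_eq_zero_iff_dvd]
    push_cast at h ⊢
    linear_combination (a1 : ZMod m) * a2 * h - ((M : ZMod m) + z.1) * a2 * i1 +
      ((M : ZMod m) + z.2) * a1 * i2
  have hrng : ∀ z ∈ R, z.1 < N ∧ z.2 < N := by
    intro z hz
    have h := (Finset.mem_filter.1 hz).1
    rw [Finset.mem_product, Finset.mem_range, Finset.mem_range] at h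
    exact h
  have heq : ∀ z ∈ R, ∀ w ∈ R, ((z.1 : ℤ) - w.1) * a2 = ((z.2 : ℤ) - w.2) * a1 := by
    intro z hz w hw
    have d := dvd_sub (hdvd z hz) (hdvd w hw)
    have e : (M + z.1) * a2 - (M + z.2) * a1 - ((M + w.1) * a2 - (M + w.2) * a1) =
        ((z.1 : ℤ) - w.1) * a2 - ((z.2 : ℤ) - w.2) * a1 := by ring
    rw [e] at d
    have hz' := hrng z hz
    have hw' := hrng w hw
    have b1 : |(z.1 : ℤ) - w.1| ≤ N - 1 := by rw [abs_le]; constructor <;> omega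
    have b2 : |(z.2 : ℤ) - w.2| ≤ N - 1 := by rw [abs_le]; constructor <;> omega
    have hN1 : (0 : ℤ) ≤ (N : ℤ) - 1 := by omega
    have q1' : (a1 : ℤ) ≤ A := by exact_mod_cast q1
    have q2' : (a2 : ℤ) ≤ A := by exact_mod_cast q2
    have b3 : |((z.1 : ℤ) - w.1) * a2| ≤ (N - 1) * A := by
      rw [abs_mul, Nat.abs_cast]
      exact mul_le_mul b1 q2' (by positivity) hN1
    have b4 : |((z.2 : ℤ) - w.2) * a1| ≤ (N - 1) * A := by
      rw [abs_mul, Nat.abs_cast]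
      exact mul_le_mul b2 q1' (by positivity) hN1
    have hm : 2 * (A : ℤ) * N ≤ m := by exact_mod_cast h2
    have hA : (1 : ℤ) ≤ A := by omega
    have := Int.eq_zero_of_abs_lt_dvd d (by
      refine lt_of_le_of_lt (abs_sub _ _) ?_
      nlinarith)
    linarith
  set g := Nat.gcd a1 a2 with hg
  have hgpos : 0 < g := Nat.gcd_pos_of_pos_left _ p1
  obtain ⟨k, hk⟩ : g ∣ a1 := Nat.gcd_dvd_left _ _
  obtain ⟨l, hl⟩ : g ∣ a2 := Nat.gcd_dvd_right _ _
  have hkpos : 0 < k := Nat.pos_of_ne_zero (by rintro rfl; omega)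
  have hkl : IsCoprime (k : ℤ) l := by
    have : Nat.Coprime k l := by
      have h3 : g * Nat.gcd k l = g * 1 := by rw [← Nat.gcd_mul_left, ← hk, ← hl, mul_one]
      exact Nat.eq_of_mul_eq_mul_left hgpos h3
    exact Nat.isCoprime_iff_coprime.2 this
  have hcong : ∀ z ∈ R, ∀ w ∈ R, (k : ℤ) ∣ (z.1 : ℤ) - w.1 := by
    intro z hz w hw
    have h := heq z hz w hw
    rw [hk, hl] at h
    push_cast at h
    have h' : (g : ℤ) * (((z.1 : ℤ) - w.1) * l) = g * (((z.2 : ℤ) - w.2) * k) := by linarith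
    have h3 := mul_left_cancel₀ (by exact_mod_cast hgpos.ne') h'
    exact hkl.dvd_of_dvd_mul_right (Dvd.intro_left _ h3.symm)
  have hcard : R.card ≤ N / k + 1 := by
    rw [← Finset.card_range (N / k + 1)]
    refine Finset.card_le_card_of_injOn (fun z => z.1 / k) ?_ ?_
    · intro z hz
      have := (hrng z hz).1
      simp only [Finset.coe_range, Set.mem_Iio]
      have := Nat.div_le_div_right (c := k) this.le
      omega
    · intro z hz w hw hzw
      simp only at hzw
      have hc := hcong z hz w hw
      have hmod : z.1 % k = w.1 % k := by
        have := (Nat.modEq_iff_dvd (n := k) (a := w.1) (b := z.1)).2 hc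
        exact this.symm
      have h1 : z.1 = w.1 := by
        rw [← Nat.div_add_mod z.1 k, ← Nat.div_add_mod w.1 k, hzw, hmod]
      have h := heq z hz w hw
      rw [h1, sub_self, zero_mul] at h
      have h3 : (z.2 : ℤ) - w.2 = 0 := by
        rcases mul_eq_zero.1 h.symm with h4 | h4
        · exact h4
        · exfalso; omega
      exact Prod.ext h1 (by omega)
  have hkr : (g : ℝ) / a1 = 1 / k := by
    rw [hk]; push_cast
    have : (g : ℝ) ≠ 0 := by positivity
    field_simp
  rw [hkr, mul_one_div]
  calc (R.card : ℝ) ≤ ((N / k + 1 : ℕ) : ℝ) := by exact_mod_cast hcard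
    _ ≤ 1 + N / k := by push_cast; linarith [Nat.cast_div_le (α := ℝ) (m := N) (n := k)]

set_option maxHeartbeats 1000000 in
/-- the `r = 2` step -/
lemma burgess_two (m : ℕ) (hsq : Squarefree m) (M : ℤ) (N A B : ℕ) (hN : 0 < N)
    (h2 : 2 * A * N ≤ m) (hAB : 16 * (A * B) ≤ N) (hm : 0 < m) (E : ℝ) (hE0 : 0 ≤ E)
    (hE : ∀ (M' : ℤ) (N' : ℕ), N' < N → |(Sx m M' N' : ℝ)| ≤ E * Real.sqrt N')
    (R : ℝ) (hR0 : 0 ≤ R) (hR : E * Real.sqrt N / 2 + R ≤ |(Sx m M N : ℝ)|) :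
    (((copSet m A).card : ℝ) * B * R) ^ 4 ≤ ((copSet m A).card * N : ℝ) ^ 2 *
      ((A : ℝ) ^ 2 + N * (A * harm A ^ 2)) *
      (3 * (B : ℝ) ^ 2 * m + 32 * (21 ^ m.primeFactors.card * Real.sqrt m) * (B : ℝ) ^ 4 *
        (m.divisors.card : ℝ) ^ 3) := by
  haveI : NeZero m := ⟨hm.ne'⟩
  set 𝒜 := copSet m A with h𝒜
  have hmem : ∀ a ∈ 𝒜, 1 ≤ a ∧ a ≤ A ∧ a.Coprime m := by
    intro a ha
    rw [h𝒜, copSet, Finset.mem_filter, Finset.mem_Icc] at ha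
    exact ⟨ha.1.1, ha.1.2, ha.2⟩
  have h1 := shift_average m M N hN E hE0 hE (𝒜 ×ˢ Finset.range B) (fun z => z.1 * z.2) (by
    intro z hz
    rw [Finset.mem_product, Finset.mem_range] at hz
    have h3 := (hmem z.1 hz.1).2.1
    have : z.1 * z.2 ≤ A * B := Nat.mul_le_mul h3 hz.2.le
    omega)
  rw [Finset.card_product, Finset.card_range] at h1
  set T : ZMod m → ℝ := fun u => |((∑ b ∈ Finset.range B, jz m (u + (b : ZMod m)) : ℤ) : ℝ)| with hT
  set P := 𝒜 ×ˢ Finset.range N with hP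
  set u : ℕ × ℕ → ZMod m := fun z => ((M + z.2 : ℤ) : ZMod m) * (z.1 : ZMod m)⁻¹ with hu
  have h3 : |∑ t ∈ 𝒜 ×ˢ Finset.range B, (Sx m (M + ((t.1 * t.2 : ℕ) : ℤ)) N : ℝ)| ≤ ∑ p ∈ P, T (u p) := by
    rw [hP, Finset.sum_product, Finset.sum_product]
    refine (Finset.abs_sum_le_sum_abs _ _).trans ?_
    refine Finset.sum_le_sum fun a ha => ?_
    have e : ∑ b ∈ Finset.range B, (Sx m (M + ((a * b : ℕ) : ℤ)) N : ℝ) =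
        ∑ n ∈ Finset.range N, (jz m (a : ZMod m) : ℝ) *
          ((∑ b ∈ Finset.range B, jz m (u (a, n) + (b : ZMod m)) : ℤ) : ℝ) := by
      unfold Sx
      push_cast
      rw [Finset.sum_comm]
      refine Finset.sum_congr rfl fun n _ => ?_
      rw [Finset.mul_sum]
      refine Finset.sum_congr rfl fun b _ => ?_
      rw [← Int.cast_mul, ← jz_mul, ← jz_intCast]
      congr 2
      have i1 := ZMod.coe_mul_inv_eq_one a (hmem a ha).2.2
      simp only [hu]
      push_cast
      linear_combination (-((M : ZMod m) + n)) * i1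
    simp only at e ⊢
    rw [e]
    refine (Finset.abs_sum_le_sum_abs _ _).trans ?_
    refine Finset.sum_le_sum fun n _ => ?_
    rw [abs_mul]
    have : |(jz m (a : ZMod m) : ℝ)| ≤ 1 := by exact_mod_cast jz_abs_le m (a : ZMod m)
    exact mul_le_of_le_one_left (abs_nonneg _) this
  have h4 := holder_count P u T (fun x => abs_nonneg _)
  have h5 : ∑ x, T x ^ 4 ≤ 3 * (B : ℝ) ^ 2 * m + 32 * (21 ^ m.primeFactors.card * Real.sqrt m) *
      (B : ℝ) ^ 4 * (m.divisors.card : ℝ) ^ 3 := by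
    refine le_trans (le_of_eq ?_) (moment_four m hsq B)
    push_cast
    refine Finset.sum_congr rfl fun x _ => ?_
    simp only [hT]
    rw [show (4 : ℕ) = 2 * 2 by rfl, pow_mul, sq_abs, ← pow_mul]
    push_cast; rfl
  have h6 : (((P ×ˢ P).filter fun z => u z.1 = u z.2).card : ℝ) ≤ (A : ℝ) ^ 2 + N * (A * harm A ^ 2) := by
    have a1 : (((P ×ˢ P).filter fun z => u z.1 = u z.2).card : ℝ) =
        ∑ a ∈ 𝒜, ∑ b ∈ 𝒜, (((Finset.range N ×ˢ Finset.range N).filter fun z : ℕ × ℕ =>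
          (((M + z.1 : ℤ) : ZMod m) * (a : ZMod m)⁻¹ = ((M + z.2 : ℤ) : ZMod m) * (b : ZMod m)⁻¹)).card : ℝ) := by
      simp only [Finset.card_filter]
      push_cast
      rw [Finset.sum_product, hP, Finset.sum_product]
      refine Finset.sum_congr rfl fun a _ => ?_
      simp only [Finset.sum_product]
      rw [Finset.sum_comm]
      refine Finset.sum_congr rfl fun b _ => ?_
      simp only [hu]
      push_cast
      rfl
    rw [a1]
    calc _ ≤ ∑ a ∈ 𝒜, ∑ b ∈ 𝒜, (1 + N * ((Nat.gcd a b : ℝ) / a)) :=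
          Finset.sum_le_sum fun a ha => Finset.sum_le_sum fun b hb => pair_count m A N h2 M a b ha hb
      _ ≤ ∑ a ∈ Finset.Icc 1 A, ∑ b ∈ Finset.Icc 1 A, (1 + N * ((Nat.gcd a b : ℝ) / a)) := by
          have hsub : 𝒜 ⊆ Finset.Icc 1 A := Finset.filter_subset _ _
          refine (Finset.sum_le_sum_of_subset_of_nonneg hsub fun _ _ _ => ?_).trans ?_
          · exact Finset.sum_nonneg fun _ _ => by positivity
          · refine Finset.sum_le_sum fun a _ => ?_
            exact Finset.sum_le_sum_of_subset_of_nonneg hsub fun _ _ _ => by positivity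
      _ = (A : ℝ) ^ 2 + N * ∑ a ∈ Finset.Icc 1 A, ∑ b ∈ Finset.Icc 1 A, ((Nat.gcd a b : ℝ) / a) := by
          simp only [Finset.sum_add_distrib, ← Finset.mul_sum]
          simp [pow_two]
      _ ≤ _ := by
          gcongr
          exact sum_gcd_div_le A
  have hPc : (P.card : ℝ) = 𝒜.card * N := by
    rw [hP, Finset.card_product, Finset.card_range]; push_cast; rfl
  have h7 : (𝒜.card : ℝ) * B * R ≤ ∑ p ∈ P, T (u p) := by
    push_cast at h1 h3
    have : (𝒜.card : ℝ) * B * (E * Real.sqrt N / 2 + R) ≤ 𝒜.card * B * |(Sx m M N : ℝ)| :=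
      mul_le_mul_of_nonneg_left hR (by positivity)
    nlinarith
  refine (pow_le_pow_left₀ (by positivity) h7 4).trans (h4.trans ?_)
  rw [hPc]
  have hm4 : 0 ≤ ∑ x, T x ^ 4 := Finset.sum_nonneg fun _ _ => by positivity
  exact mul_le_mul (mul_le_mul_of_nonneg_left h6 (by positivity)) h5 hm4 (by positivity)

lemma divisors_card_le (m : ℕ) (hsq : Squarefree m) : m.divisors.card ≤ 2 ^ m.primeFactors.card := by
  rw [Nat.card_divisors hsq.ne_zero, ← Finset.prod_const]
  refine Finset.prod_le_prod' fun p _ => ?_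
  have := hsq.natFactorization_le_one p
  omega

/-- the real algebra behind the `r = 2` step -/
lemma burgess_algebra (X D C1 C2 C3 a A B N H W t R : ℝ) (hX : 1 ≤ X) (hD : 1 ≤ D) (hC1 : 1 ≤ C1)
    (hC2 : 1 ≤ C2) (hC3 : 1 ≤ C3) (ha : 0 ≤ a) (hA : 1 ≤ A) (hB : 1 ≤ B) (_hN : 0 ≤ N) (hH0 : 0 ≤ H)
    (hW0 : 0 ≤ W) (ht0 : 0 ≤ t) (_hR0 : 0 ≤ R)
    (hAa : A ≤ C2 * D * a) (hNA : N ≤ 32 * B * A) (hBX : B ≤ X ^ 4) (hXB : X ^ 4 ≤ 2 * B)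
    (hH : H ≤ C3 * D) (hW : W ≤ C1 * D) (ht : t ≤ C1 * D)
    (h : (a * B * R) ^ 4 ≤ (a * N) ^ 2 * (A ^ 2 + N * (A * H ^ 2)) *
      (3 * B ^ 2 * X ^ 16 + 32 * (W * X ^ 8) * B ^ 4 * t ^ 3)) :
    R ^ 4 ≤ (1452 * C1 ^ 4 * C2 ^ 2 * C3 ^ 2) * N ^ 2 * X ^ 12 * D ^ 8 := by
  have ha0 : 0 < a := by
    by_contra hcon
    have : a = 0 := le_antisymm (not_lt.1 hcon) ha
    rw [this] at hAa
    linarith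
  have hCD : 1 ≤ C3 * D := one_le_mul_of_one_le_of_one_le hC3 hD
  have hCD1 : 1 ≤ C1 * D := one_le_mul_of_one_le_of_one_le hC1 hD
  have e1 : A ^ 2 + N * (A * H ^ 2) ≤ (33 * C3 ^ 2 * C2 ^ 2 * X ^ 4 * D ^ 4) * a ^ 2 := by
    have s1 : N * (A * H ^ 2) ≤ (32 * B * A) * (A * (C3 * D) ^ 2) := by gcongr
    have s2 : A ^ 2 ≤ A ^ 2 * (B * (C3 * D) ^ 2) := by
      refine le_mul_of_one_le_right (by positivity) ?_
      exact one_le_mul_of_one_le_of_one_le hB (one_le_pow₀ hCD)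
    calc A ^ 2 + N * (A * H ^ 2) ≤ A ^ 2 * (33 * (B * (C3 * D) ^ 2)) := by nlinarith
      _ ≤ (C2 * D * a) ^ 2 * (33 * (X ^ 4 * (C3 * D) ^ 2)) := by gcongr
      _ = _ := by ring
  have e2 : 3 * B ^ 2 * X ^ 16 + 32 * (W * X ^ 8) * B ^ 4 * t ^ 3 ≤ (44 * C1 ^ 4 * X ^ 8 * D ^ 4) * B ^ 4 := by
    have s0 : X ^ 8 ≤ 4 * B ^ 2 := by
      calc X ^ 8 = (X ^ 4) ^ 2 := by ring
        _ ≤ (2 * B) ^ 2 := by gcongr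
        _ = _ := by ring
    have s1 : 3 * B ^ 2 * X ^ 16 ≤ 12 * B ^ 4 * X ^ 8 := by
      calc 3 * B ^ 2 * X ^ 16 = 3 * B ^ 2 * X ^ 8 * X ^ 8 := by ring
        _ ≤ 3 * B ^ 2 * X ^ 8 * (4 * B ^ 2) := by gcongr
        _ = _ := by ring
    have s2 : 32 * (W * X ^ 8) * B ^ 4 * t ^ 3 ≤ 32 * (C1 * D * X ^ 8) * B ^ 4 * (C1 * D) ^ 3 := by gcongr
    have s3 : B ^ 4 * X ^ 8 ≤ B ^ 4 * X ^ 8 * (C1 * D) ^ 4 :=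
      le_mul_of_one_le_right (by positivity) (one_le_pow₀ hCD1)
    calc _ ≤ 12 * (B ^ 4 * X ^ 8 * (C1 * D) ^ 4) + 32 * (C1 * D * X ^ 8) * B ^ 4 * (C1 * D) ^ 3 := by linarith
      _ = _ := by ring
  have e3 : (a * B * R) ^ 4 ≤ (a * N) ^ 2 * ((33 * C3 ^ 2 * C2 ^ 2 * X ^ 4 * D ^ 4) * a ^ 2) *
      ((44 * C1 ^ 4 * X ^ 8 * D ^ 4) * B ^ 4) := by
    refine h.trans ?_
    gcongr
  have e4 : (a * B) ^ 4 * R ^ 4 ≤ (a * B) ^ 4 *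
      ((1452 * C1 ^ 4 * C2 ^ 2 * C3 ^ 2) * N ^ 2 * X ^ 12 * D ^ 8) := by
    calc _ = (a * B * R) ^ 4 := by ring
      _ ≤ _ := e3
      _ = _ := by ring
  exact le_of_mul_le_mul_left e4 (by positivity)

set_option maxHeartbeats 2000000 in
theorem burgess (ε : ℝ) (hε : 0 < ε) : ∃ K : ℝ, 1 ≤ K ∧ ∀ m : ℕ, 1 < m → Squarefree m → Odd m →
    ∀ (N : ℕ) (M : ℤ), |(Sx m M N : ℝ)| ≤ K * (m : ℝ) ^ ((3 : ℝ) / 16 + ε) * Real.sqrt N := by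
  set δ := ε / 2 with hδ
  have hδ0 : 0 < δ := by positivity
  obtain ⟨C1, hC1, h21⟩ := omega_pow_le 21 δ (by norm_num) hδ0
  obtain ⟨C2, hC2, hsm⟩ := smooth_bound (δ / 2) (by positivity)
  set C3 : ℝ := 1 + 1 / δ with hC3d
  have hC3 : 1 ≤ C3 := by rw [hC3d]; have : 0 < 1 / δ := by positivity
                          linarith
  set K1 : ℝ := 1452 * C1 ^ 4 * C2 ^ 2 * C3 ^ 2 with hK1
  have hK11 : 1 ≤ K1 := by
    rw [hK1]
    have a1 := one_le_pow₀ hC1 (n := 4)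
    have a2 := one_le_pow₀ hC2 (n := 2)
    have a3 := one_le_pow₀ hC3 (n := 2)
    have a4 := one_le_mul_of_one_le_of_one_le a1 (one_le_mul_of_one_le_of_one_le a2 a3)
    nlinarith
  set K : ℝ := 4 * K1 + 100 * C1 + 16 with hK
  refine ⟨K, by linarith, ?_⟩
  intro m hm hsq hodd
  have hm0 : (0 : ℝ) < m := by positivity
  have hm1 : (1 : ℝ) ≤ m := by exact_mod_cast hm.le
  set X : ℝ := (m : ℝ) ^ ((1 : ℝ) / 16) with hX
  set D : ℝ := (m : ℝ) ^ δ with hD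
  have hX1 : 1 ≤ X := Real.one_le_rpow hm1 (by norm_num)
  have hD1 : 1 ≤ D := Real.one_le_rpow hm1 hδ0.le
  have hX16 : X ^ 16 = m := by
    rw [hX, ← Real.rpow_natCast, ← Real.rpow_mul hm0.le]; norm_num
  have hsqm : Real.sqrt m = X ^ 8 := by
    rw [← hX16, show X ^ 16 = (X ^ 8) ^ 2 by ring, Real.sqrt_sq (by positivity)]
  have hpow : (m : ℝ) ^ ((3 : ℝ) / 16 + ε) = X ^ 3 * D ^ 2 := by
    rw [hX, hD, ← Real.rpow_natCast, ← Real.rpow_natCast, ← Real.rpow_mul hm0.le,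
      ← Real.rpow_mul hm0.le, ← Real.rpow_add hm0]
    congr 1; rw [hδ]; push_cast; ring
  rw [hpow]
  set E : ℝ := K * (X ^ 3 * D ^ 2) with hE
  have hE0 : 0 ≤ E := by have : 0 ≤ K := by linarith
                         positivity
  have hXD : 1 ≤ X ^ 3 * D ^ 2 := one_le_mul_of_one_le_of_one_le (one_le_pow₀ hX1) (one_le_pow₀ hD1)
  have hX3D : X ^ 3 ≤ X ^ 3 * D ^ 2 := le_mul_of_one_le_right (by positivity) (one_le_pow₀ hD1)
  have hW : (21 : ℝ) ^ m.primeFactors.card ≤ C1 * D := h21 m (by omega)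
  have ht : (m.divisors.card : ℝ) ≤ C1 * D := by
    have h1 : (m.divisors.card : ℝ) ≤ 2 ^ m.primeFactors.card := by exact_mod_cast divisors_card_le m hsq
    have h2 : (2 : ℝ) ^ m.primeFactors.card ≤ 21 ^ m.primeFactors.card :=
      pow_le_pow_left₀ (by norm_num) (by norm_num) _
    linarith
  intro N
  induction N using Nat.strong_induction_on with
  | _ N ih =>
    intro M
    rcases Nat.eq_zero_or_pos N with h0 | hNpos
    · subst h0; simp [Sx]
    have hih : ∀ (M' : ℤ) (N' : ℕ), N' < N → |(Sx m M' N' : ℝ)| ≤ E * Real.sqrt N' :=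
      fun M' N' h => ih N' h M'
    have hNr : (0 : ℝ) < N := by exact_mod_cast hNpos
    have hsN : 0 < Real.sqrt N := Real.sqrt_pos.2 hNr
    have hsNsq : Real.sqrt N * Real.sqrt N = N := Real.mul_self_sqrt hNr.le
    by_cases hb : (N : ℝ) ≤ 256 * X ^ 6
    · have h1 : |(Sx m M N : ℝ)| ≤ N := by exact_mod_cast Sx_abs_le m M N
      have h2 : Real.sqrt N ≤ 16 * X ^ 3 := by
        rw [Real.sqrt_le_left (by positivity)]
        calc (N : ℝ) ≤ _ := hb
          _ = _ := by ring
      have h3 : Real.sqrt N ≤ E := by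
        rw [hE]
        have h4 : 16 * (X ^ 3 * D ^ 2) ≤ K * (X ^ 3 * D ^ 2) :=
          mul_le_mul_of_nonneg_right (by linarith) (by positivity)
        linarith
      calc _ ≤ _ := h1
        _ = Real.sqrt N * Real.sqrt N := hsNsq.symm
        _ ≤ _ := mul_le_mul_of_nonneg_right h3 hsN.le
    push Not at hb
    have hX6 : 1 ≤ X ^ 6 := one_le_pow₀ hX1
    by_cases hc : m ≤ N
    · obtain ⟨N', rfl⟩ := Nat.exists_eq_add_of_le hc
      rw [Sx_add, Sx_period m hm hsq hodd, zero_add]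
      refine (hih _ N' (by omega)).trans ?_
      refine mul_le_mul_of_nonneg_left (Real.sqrt_le_sqrt ?_) hE0
      push_cast; linarith
    push Not at hc
    have hN256 : 256 < N := by
      have : (256 : ℝ) < N := by linarith
      exact_mod_cast this
    by_cases hd : X ^ 10 ≤ N
    · -- the case of long intervals
      have h1 := burgess_one m hsq hodd M N (N / 16) hNpos hc.le (by omega) (by omega) E hE0 hih
      refine h1.trans ?_
      have hB32 : (N : ℝ) ≤ 32 * ((N / 16 : ℕ) : ℝ) := by
        have : N ≤ 32 * (N / 16) := by omega
        exact_mod_cast this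
      have hBpos : (0 : ℝ) < ((N / 16 : ℕ) : ℝ) := by linarith
      have h2 : (m : ℝ) / ((N / 16 : ℕ) : ℝ) ≤ 32 * X ^ 6 := by
        rw [div_le_iff₀ hBpos, ← hX16]
        calc X ^ 16 = X ^ 6 * X ^ 10 := by ring
          _ ≤ X ^ 6 * (32 * ((N / 16 : ℕ) : ℝ)) := by gcongr; linarith
          _ = _ := by ring
      have h3 : Real.sqrt (m / ((N / 16 : ℕ) : ℝ) + 2 * m.divisors.card) ≤ 34 * C1 * (X ^ 3 * D ^ 2) := by
        rw [Real.sqrt_le_left (by positivity)]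
        have s1 : D ≤ X ^ 6 * D ^ 4 := by
          calc D = 1 * D ^ 1 := by ring
            _ ≤ X ^ 6 * D ^ 4 := mul_le_mul hX6 (pow_le_pow_right₀ hD1 (by norm_num)) (by positivity) (by positivity)
        have s2 : X ^ 6 ≤ X ^ 6 * D ^ 4 := le_mul_of_one_le_right (by positivity) (one_le_pow₀ hD1)
        have s3 : C1 * D ≤ C1 * (X ^ 6 * D ^ 4) := mul_le_mul_of_nonneg_left s1 (by linarith)
        have s4 : X ^ 6 ≤ C1 * (X ^ 6 * D ^ 4) :=
          s2.trans (le_mul_of_one_le_left (by positivity) hC1)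
        have s5 : C1 * (X ^ 6 * D ^ 4) ≤ C1 ^ 2 * (X ^ 6 * D ^ 4) := by
          exact mul_le_mul_of_nonneg_right (le_self_pow₀ hC1 two_ne_zero) (by positivity)
        calc _ ≤ 34 * (C1 * (X ^ 6 * D ^ 4)) := by linarith
          _ ≤ 34 ^ 2 * (C1 ^ 2 * (X ^ 6 * D ^ 4)) := by
              have : 0 ≤ C1 ^ 2 * (X ^ 6 * D ^ 4) := by positivity
              linarith
          _ = _ := by ring
      have h4 : 34 * C1 * (X ^ 3 * D ^ 2) ≤ E / 2 := by
        rw [hE]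
        have h6 : 34 * C1 * (X ^ 3 * D ^ 2) ≤ K / 2 * (X ^ 3 * D ^ 2) :=
          mul_le_mul_of_nonneg_right (by linarith) (by positivity)
        linarith
      have h5 := mul_le_mul_of_nonneg_left (h3.trans h4) hsN.le
      linarith
    · push Not at hd
      set B : ℕ := ⌊X ^ 4⌋₊ with hB
      have hX4 : 1 ≤ X ^ 4 := one_le_pow₀ hX1
      have hB1 : 1 ≤ B := Nat.one_le_floor_iff _ |>.2 hX4
      have hBX : (B : ℝ) ≤ X ^ 4 := Nat.floor_le (by positivity)
      have hXB : X ^ 4 ≤ 2 * B := by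
        have h1 : X ^ 4 < B + 1 := Nat.lt_floor_add_one _
        have h2 : (1 : ℝ) ≤ B := by exact_mod_cast hB1
        linarith
      set A : ℕ := N / (16 * B) with hA
      have hAB : 16 * (A * B) ≤ N := by
        have := Nat.div_mul_le_self N (16 * B)
        rw [← hA] at this
        calc 16 * (A * B) = A * (16 * B) := by ring
          _ ≤ N := this
      have hA1 : 1 ≤ A := by
        rw [hA, Nat.one_le_div_iff (by omega)]
        have h1 : X ^ 4 ≤ X ^ 6 := pow_le_pow_right₀ hX1 (by norm_num)
        have : (16 * B : ℝ) ≤ N := by linarith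
        exact_mod_cast this
      have hNA : N ≤ 32 * B * A := by
        have h1 := Nat.lt_mul_div_succ N (b := 16 * B) (by omega)
        rw [← hA] at h1
        have h3 := Nat.le_mul_of_pos_right (16 * B) hA1
        calc N ≤ 16 * B * (A + 1) := h1.le
          _ = 16 * B * A + 16 * B := by ring
          _ ≤ 16 * B * A + 16 * B * A := by omega
          _ = _ := by ring
      have hB1r : (1 : ℝ) ≤ B := by exact_mod_cast hB1
      have hA1r : (1 : ℝ) ≤ A := by exact_mod_cast hA1
      have h2AN : 2 * A * N ≤ m := by
        have h1 : (16 * (A * B) : ℝ) ≤ N := by exact_mod_cast hAB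
        have h3 : (2 * A * N : ℝ) ≤ m := by
          rw [← hX16]
          have h4 : (8 : ℝ) * B * (2 * A * N) ≤ N * N := by
            calc (8 : ℝ) * B * (2 * A * N) = (16 * (A * B)) * N := by ring
              _ ≤ N * N := mul_le_mul_of_nonneg_right h1 hNr.le
          have h5 : (N : ℝ) * N ≤ X ^ 10 * X ^ 10 := by gcongr
          have h6 : X ^ 10 * X ^ 10 ≤ (2 * B) * X ^ 16 := by
            calc X ^ 10 * X ^ 10 = X ^ 4 * X ^ 16 := by ring
              _ ≤ _ := by gcongr
          have h7 : (8 : ℝ) * B * (2 * A * N) ≤ 8 * B * X ^ 16 := by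
            have : 0 ≤ B * X ^ 16 := by positivity
            linarith
          exact le_of_mul_le_mul_left h7 (by positivity)
        exact_mod_cast h3
      have hAm : A ≤ m := by
        calc A ≤ A * (2 * N) := Nat.le_mul_of_pos_right A (by omega)
          _ = 2 * A * N := by ring
          _ ≤ m := h2AN
      by_contra hcon
      push Not at hcon
      have hmain := burgess_two m hsq M N A B hNpos h2AN hAB (by omega) E hE0 hih
        (E * Real.sqrt N / 2) (by positivity) (by linarith)
      rw [hsqm] at hmain
      have hm' : 3 * (B : ℝ) ^ 2 * m = 3 * (B : ℝ) ^ 2 * X ^ 16 := by rw [hX16]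
      rw [hm'] at hmain
      have hsmA : (A : ℝ) ≤ C2 * D * (copSet m A).card := by
        have h1 : (A : ℝ) ≤ (smoothSet m A).card * (copSet m A).card := by
          exact_mod_cast copSet_card m A
        have h2 := hsm m A (by omega)
        have h3 : (A : ℝ) ^ (δ / 2) ≤ (m : ℝ) ^ (δ / 2) :=
          Real.rpow_le_rpow (by positivity) (by exact_mod_cast hAm) (by positivity)
        have h4 : ((smoothSet m A).card : ℝ) ≤ C2 * D := by
          refine h2.trans ?_
          have : D = (m : ℝ) ^ (δ / 2) * (m : ℝ) ^ (δ / 2) := by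
            rw [← Real.rpow_add hm0, hD]; congr 1; ring
          rw [this, ← mul_assoc]
          gcongr
        refine h1.trans ?_
        gcongr
      have hHA : harm A ≤ C3 * D := by
        refine (harm_le A).trans ?_
        have h1 := Real.log_le_rpow_div (x := (A : ℝ)) (by positivity) hδ0
        have h3 : (A : ℝ) ^ δ ≤ D :=
          Real.rpow_le_rpow (by positivity) (by exact_mod_cast hAm) hδ0.le
        have h4 : (A : ℝ) ^ δ / δ ≤ D / δ := by gcongr
        rw [hC3d, add_mul, one_mul, one_div_mul_eq_div]
        linarith
      have hNAr : (N : ℝ) ≤ 32 * B * A := by exact_mod_cast hNA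
      have hfin := burgess_algebra X D C1 C2 C3 (copSet m A).card A B N (harm A)
        (21 ^ m.primeFactors.card) m.divisors.card (E * Real.sqrt N / 2) hX1 hD1 hC1 hC2 hC3
        (by positivity) hA1r hB1r hNr.le (harm_nonneg A) (by positivity) (by positivity) (by positivity)
        hsmA hNAr hBX hXB hHA hW ht hmain
      rw [← hK1] at hfin
      have hlow : K1 * (X ^ 3 * D ^ 2) * Real.sqrt N < E * Real.sqrt N / 2 := by
        rw [hE]
        have : 0 < X ^ 3 * D ^ 2 * Real.sqrt N := by positivity
        have h6 := mul_lt_mul_of_pos_right (show K1 < K / 2 by linarith) this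
        linarith
      have h8 := pow_lt_pow_left₀ hlow (by positivity) (n := 4) (by norm_num)
      have h9 : (K1 * (X ^ 3 * D ^ 2) * Real.sqrt N) ^ 4 = K1 ^ 4 * ((N : ℝ) ^ 2 * X ^ 12 * D ^ 8) := by
        calc _ = K1 ^ 4 * ((Real.sqrt N * Real.sqrt N) ^ 2 * X ^ 12 * D ^ 8) := by ring
          _ = _ := by rw [hsNsq]
      have h10 : K1 * ((N : ℝ) ^ 2 * X ^ 12 * D ^ 8) ≤ K1 ^ 4 * ((N : ℝ) ^ 2 * X ^ 12 * D ^ 8) := by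
        refine mul_le_mul_of_nonneg_right ?_ (by positivity)
        exact le_self_pow₀ hK11 (by norm_num)
      rw [h9] at h8
      have h11 : K1 * (N : ℝ) ^ 2 * X ^ 12 * D ^ 8 = K1 * ((N : ℝ) ^ 2 * X ^ 12 * D ^ 8) := by ring
      rw [h11] at hfin
      exact absurd (h8.trans_le (hfin.trans h10)) (lt_irrefl _)

/-! ## Part 7: the character sum attached to a non-square discriminant -/

lemma sum_multiples {R : Type*} [AddCommMonoid R] (f : ℕ → R) (p z : ℕ) (hp : 0 < p) :
    ∑ l ∈ Finset.Icc 1 z, (if p ∣ l then f l else 0) =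
      ∑ l ∈ Finset.Icc 1 (z / p), f (p * l) := by
  rw [← Finset.sum_filter]
  symm
  refine Finset.sum_nbij' (fun l => p * l) (fun l => l / p) ?_ ?_ ?_ ?_ ?_
  · intro l hl
    simp only [Finset.mem_Icc, Finset.mem_filter] at hl ⊢
    refine ⟨⟨Nat.mul_pos hp hl.1, ?_⟩, Dvd.intro _ rfl⟩
    exact (Nat.mul_le_mul_left p hl.2).trans (Nat.mul_div_le z p)
  · intro l hl
    simp only [Finset.mem_Icc, Finset.mem_filter] at hl ⊢
    obtain ⟨⟨h1, h2⟩, h3⟩ := hl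
    exact ⟨Nat.div_pos (Nat.le_of_dvd h1 h3) hp, Nat.div_le_div_right h2⟩
  · intro l _
    exact Nat.mul_div_cancel_left l hp
  · intro l hl
    simp only [Finset.mem_Icc, Finset.mem_filter] at hl
    exact Nat.mul_div_cancel' hl.2
  · intro l _; rfl

lemma sieve_T (g : ℕ → ℝ) (hg : ∀ p l, g (p * l) = g p * g l) (hg1 : ∀ p, |g p| ≤ 1) (B : ℝ)
    (hB : ∀ z : ℕ, |∑ l ∈ Finset.Icc 1 z, g l| ≤ B * Real.sqrt z) (T : Finset ℕ)
    (hT : ∀ p ∈ T, p.Prime) :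
    ∀ z : ℕ, |∑ l ∈ Finset.Icc 1 z, (if (∀ p ∈ T, ¬ p ∣ l) then g l else 0)| ≤
      2 ^ T.card * (B * Real.sqrt z) := by
  have hB0 : 0 ≤ B := by
    have := (abs_nonneg _).trans (hB 1)
    simpa using this
  induction T using Finset.induction_on with
  | empty => intro z; simpa using hB z
  | insert p T hp ih =>
    intro z
    have ih' := ih (fun q hq => hT q (Finset.mem_insert_of_mem hq))
    have hpp : p.Prime := hT p (Finset.mem_insert_self _ _)
    set F : ℕ → ℝ := fun l => if (∀ p ∈ T, ¬ p ∣ l) then g l else 0 with hF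
    have h1 : ∑ l ∈ Finset.Icc 1 z, (if (∀ q ∈ insert p T, ¬ q ∣ l) then g l else 0) =
        ∑ l ∈ Finset.Icc 1 z, F l - g p * ∑ l ∈ Finset.Icc 1 (z / p), F l := by
      have h2 : g p * ∑ l ∈ Finset.Icc 1 (z / p), F l =
          ∑ l ∈ Finset.Icc 1 z, (if p ∣ l then F l else 0) := by
        rw [sum_multiples F p z hpp.pos, Finset.mul_sum]
        refine Finset.sum_congr rfl fun l _ => ?_
        simp only [hF]
        have : (∀ q ∈ T, ¬ q ∣ p * l) ↔ (∀ q ∈ T, ¬ q ∣ l) := by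
          refine forall₂_congr fun q hq => not_congr ?_
          have hqp : q.Prime := hT q (Finset.mem_insert_of_mem hq)
          have : Nat.Coprime q p := (Nat.coprime_primes hqp hpp).2 (by
            rintro rfl; exact hp hq)
          exact this.dvd_mul_left
        by_cases h : ∀ q ∈ T, ¬ q ∣ l
        · rw [if_pos h, if_pos (this.2 h), hg]
        · rw [if_neg h, if_neg (fun h' => h (this.1 h')), mul_zero]
      rw [h2, ← Finset.sum_sub_distrib]
      refine Finset.sum_congr rfl fun l _ => ?_
      simp only [hF, Finset.forall_mem_insert]
      by_cases h : p ∣ l <;> simp [h]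
    rw [h1, Finset.card_insert_of_notMem hp, pow_succ]
    have hz : Real.sqrt ((z / p : ℕ) : ℝ) ≤ Real.sqrt z :=
      Real.sqrt_le_sqrt (by exact_mod_cast Nat.div_le_self z p)
    have e1 := ih' z
    have e2 : |g p * ∑ l ∈ Finset.Icc 1 (z / p), F l| ≤ 2 ^ T.card * (B * Real.sqrt z) := by
      rw [abs_mul]
      calc _ ≤ 1 * |∑ l ∈ Finset.Icc 1 (z / p), F l| :=
            mul_le_mul_of_nonneg_right (hg1 p) (abs_nonneg _)
        _ = |∑ l ∈ Finset.Icc 1 (z / p), F l| := one_mul _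
        _ ≤ _ := ih' (z / p)
        _ ≤ _ := by
          refine mul_le_mul_of_nonneg_left ?_ (by positivity)
          exact mul_le_mul_of_nonneg_left hz hB0
    calc _ ≤ |∑ l ∈ Finset.Icc 1 z, F l| + |g p * ∑ l ∈ Finset.Icc 1 (z / p), F l| := abs_sub _ _
      _ ≤ 2 ^ T.card * (B * Real.sqrt z) + 2 ^ T.card * (B * Real.sqrt z) := add_le_add e1 e2
      _ = _ := by ring

/-- The Jacobi symbol restricted to odd moduli. -/
def jo (A : ℤ) (l : ℕ) : ℤ := if l % 2 = 1 then jacobiSym A l else 0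

lemma jo_mul (A : ℤ) (p l : ℕ) : jo A (p * l) = jo A p * jo A l := by
  unfold jo
  by_cases hp : p % 2 = 1
  · by_cases hl : l % 2 = 1
    · rw [if_pos hp, if_pos hl, if_pos (by rw [Nat.mul_mod, hp, hl])]
      exact jacobiSym.mul_right' A (by omega) (by omega)
    · rw [if_neg hl, if_neg, mul_zero]
      rw [Nat.mul_mod, show l % 2 = 0 by omega]; simp
  · rw [if_neg hp, if_neg, zero_mul]
    rw [Nat.mul_mod, show p % 2 = 0 by omega]; simp

lemma jo_mul_left (A B : ℤ) (l : ℕ) : jo (A * B) l = jo A l * jo B l := by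
  unfold jo
  split_ifs
  · exact jacobiSym.mul_left _ _ _
  · simp

lemma jo_abs (A : ℤ) (l : ℕ) : |(jo A l : ℝ)| ≤ 1 := by
  unfold jo
  split_ifs
  · rcases jacobiSym.trichotomy A l with h | h | h <;> rw [h] <;> norm_num
  · norm_num

lemma jo_sq (s : ℕ) (hs : s ≠ 0) (l : ℕ) :
    jo ((s : ℤ) ^ 2) l = if (∀ p ∈ s.primeFactors, ¬ p ∣ l) then jo 1 l else 0 := by
  unfold jo
  by_cases hl : l % 2 = 1
  · simp only [if_pos hl, jacobiSym.one_left, jacobiSym.pow_left]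
    split_ifs with h
    · refine jacobiSym.sq_one ?_
      rw [Int.gcd_natCast_natCast]
      refine Nat.coprime_of_dvd ?_
      intro k hk h1 h2
      exact h k (Nat.mem_primeFactors.2 ⟨hk, h1, hs⟩) h2
    · have : jacobiSym (s : ℤ) l = 0 := by
        rw [jacobiSym.eq_zero_iff]
        refine ⟨by omega, ?_⟩
        rw [Int.gcd_natCast_natCast]
        intro h1
        apply h
        intro p hp hpl
        have := Nat.dvd_gcd (Nat.dvd_of_mem_primeFactors hp) hpl
        rw [h1] at this
        exact (Nat.prime_of_mem_primeFactors hp).one_lt.ne' (Nat.dvd_one.1 this)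
      rw [this]; norm_num
  · simp [if_neg hl]

lemma jo_one_mul (A : ℤ) (l : ℕ) : jo A l * jo 1 l = jo A l := by
  rw [← jo_mul_left, mul_one]

lemma sum_mod8 (f : ℕ → ℝ) (z : ℕ) :
    ∑ l ∈ Finset.Icc 1 z, (if l % 2 = 1 then f l else 0) =
      ∑ r ∈ ({1, 3, 5, 7} : Finset ℕ), ∑ j ∈ Finset.range ((z + 8 - r) / 8), f (8 * j + r) := by
  have e : ∀ g : ℕ → ℝ, ∑ r ∈ ({1, 3, 5, 7} : Finset ℕ), g r = g 1 + g 3 + g 5 + g 7 := by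
    intro g
    rw [Finset.sum_insert (by decide), Finset.sum_insert (by decide), Finset.sum_insert (by decide),
      Finset.sum_singleton]; ring
  rw [e]
  induction z with
  | zero => simp
  | succ z ih =>
    rw [Finset.sum_Icc_succ_top (by omega), ih]
    obtain ⟨k, s, hs, rfl⟩ : ∃ k s, s < 8 ∧ z = 8 * k + s :=
      ⟨z / 8, z % 8, Nat.mod_lt _ (by norm_num), by omega⟩
    have hh : ∀ N r : ℕ, ∑ j ∈ Finset.range (N + 1), f (8 * j + r) =
        ∑ j ∈ Finset.range N, f (8 * j + r) + f (8 * N + r) := fun N r => Finset.sum_range_succ _ _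
    interval_cases s
    · rw [if_pos (by omega), show (8 * k + 0 + 1 + 8 - 1) / 8 = k + 1 by omega,
        show (8 * k + 0 + 1 + 8 - 3) / 8 = k by omega, show (8 * k + 0 + 1 + 8 - 5) / 8 = k by omega,
        show (8 * k + 0 + 1 + 8 - 7) / 8 = k by omega, show (8 * k + 0 + 8 - 1) / 8 = k by omega,
        show (8 * k + 0 + 8 - 3) / 8 = k by omega, show (8 * k + 0 + 8 - 5) / 8 = k by omega,
        show (8 * k + 0 + 8 - 7) / 8 = k by omega, hh]
      simp only [add_zero]; ring
    · rw [if_neg (by omega), show (8 * k + 1 + 1 + 8 - 1) / 8 = k + 1 by omega,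
        show (8 * k + 1 + 1 + 8 - 3) / 8 = k by omega, show (8 * k + 1 + 1 + 8 - 5) / 8 = k by omega,
        show (8 * k + 1 + 1 + 8 - 7) / 8 = k by omega, show (8 * k + 1 + 8 - 1) / 8 = k + 1 by omega,
        show (8 * k + 1 + 8 - 3) / 8 = k by omega, show (8 * k + 1 + 8 - 5) / 8 = k by omega,
        show (8 * k + 1 + 8 - 7) / 8 = k by omega]
      ring
    · rw [if_pos (by omega), show (8 * k + 2 + 1 + 8 - 1) / 8 = k + 1 by omega,
        show (8 * k + 2 + 1 + 8 - 3) / 8 = k + 1 by omega,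
        show (8 * k + 2 + 1 + 8 - 5) / 8 = k by omega,
        show (8 * k + 2 + 1 + 8 - 7) / 8 = k by omega, show (8 * k + 2 + 8 - 1) / 8 = k + 1 by omega,
        show (8 * k + 2 + 8 - 3) / 8 = k by omega, show (8 * k + 2 + 8 - 5) / 8 = k by omega,
        show (8 * k + 2 + 8 - 7) / 8 = k by omega, hh k 3, show 8 * k + 2 + 1 = 8 * k + 3 by omega]
      ring
    · rw [if_neg (by omega), show (8 * k + 3 + 1 + 8 - 1) / 8 = k + 1 by omega,
        show (8 * k + 3 + 1 + 8 - 3) / 8 = k + 1 by omega,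
        show (8 * k + 3 + 1 + 8 - 5) / 8 = k by omega,
        show (8 * k + 3 + 1 + 8 - 7) / 8 = k by omega, show (8 * k + 3 + 8 - 1) / 8 = k + 1 by omega,
        show (8 * k + 3 + 8 - 3) / 8 = k + 1 by omega, show (8 * k + 3 + 8 - 5) / 8 = k by omega,
        show (8 * k + 3 + 8 - 7) / 8 = k by omega]
      ring
    · rw [if_pos (by omega), show (8 * k + 4 + 1 + 8 - 1) / 8 = k + 1 by omega,
        show (8 * k + 4 + 1 + 8 - 3) / 8 = k + 1 by omega,
        show (8 * k + 4 + 1 + 8 - 5) / 8 = k + 1 by omega,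
        show (8 * k + 4 + 1 + 8 - 7) / 8 = k by omega, show (8 * k + 4 + 8 - 1) / 8 = k + 1 by omega,
        show (8 * k + 4 + 8 - 3) / 8 = k + 1 by omega, show (8 * k + 4 + 8 - 5) / 8 = k by omega,
        show (8 * k + 4 + 8 - 7) / 8 = k by omega, hh k 5, show 8 * k + 4 + 1 = 8 * k + 5 by omega]
      ring
    · rw [if_neg (by omega), show (8 * k + 5 + 1 + 8 - 1) / 8 = k + 1 by omega,
        show (8 * k + 5 + 1 + 8 - 3) / 8 = k + 1 by omega,
        show (8 * k + 5 + 1 + 8 - 5) / 8 = k + 1 by omega,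
        show (8 * k + 5 + 1 + 8 - 7) / 8 = k by omega, show (8 * k + 5 + 8 - 1) / 8 = k + 1 by omega,
        show (8 * k + 5 + 8 - 3) / 8 = k + 1 by omega, show (8 * k + 5 + 8 - 5) / 8 = k + 1 by omega,
        show (8 * k + 5 + 8 - 7) / 8 = k by omega]
      ring
    · rw [if_pos (by omega), show (8 * k + 6 + 1 + 8 - 1) / 8 = k + 1 by omega,
        show (8 * k + 6 + 1 + 8 - 3) / 8 = k + 1 by omega,
        show (8 * k + 6 + 1 + 8 - 5) / 8 = k + 1 by omega,
        show (8 * k + 6 + 1 + 8 - 7) / 8 = k + 1 by omega,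
        show (8 * k + 6 + 8 - 1) / 8 = k + 1 by omega,
        show (8 * k + 6 + 8 - 3) / 8 = k + 1 by omega, show (8 * k + 6 + 8 - 5) / 8 = k + 1 by omega,
        show (8 * k + 6 + 8 - 7) / 8 = k by omega, hh k 7, show 8 * k + 6 + 1 = 8 * k + 7 by omega]
      ring
    · rw [if_neg (by omega), show (8 * k + 7 + 1 + 8 - 1) / 8 = k + 1 by omega,
        show (8 * k + 7 + 1 + 8 - 3) / 8 = k + 1 by omega,
        show (8 * k + 7 + 1 + 8 - 5) / 8 = k + 1 by omega,
        show (8 * k + 7 + 1 + 8 - 7) / 8 = k + 1 by omega,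
        show (8 * k + 7 + 8 - 1) / 8 = k + 1 by omega,
        show (8 * k + 7 + 8 - 3) / 8 = k + 1 by omega, show (8 * k + 7 + 8 - 5) / 8 = k + 1 by omega,
        show (8 * k + 7 + 8 - 7) / 8 = k + 1 by omega]
      ring


lemma jac_unit_mod8 (u : ℤ) (hu : u = 1 ∨ u = -1 ∨ u = 2 ∨ u = -2) (j r : ℕ) (hr : r % 2 = 1) :
    jacobiSym u (8 * j + r) = jacobiSym u r := by
  rw [jacobiSym.mod_right u (b := 8 * j + r) (Nat.odd_iff.2 (by omega)),
    jacobiSym.mod_right u (b := r) (Nat.odd_iff.2 hr)]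
  congr 1
  rcases hu with rfl | rfl | rfl | rfl <;> simp <;> omega

lemma jac_split (u : ℤ) (hu : u = 1 ∨ u = -1 ∨ u = 2 ∨ u = -2) (m : ℕ) (hm : Odd m)
    (j r : ℕ) (hr : r % 2 = 1) :
    jacobiSym (u * m) (8 * j + r) =
      jacobiSym u r * jacobiSym (ZMod.χ₄ (r : ZMod 4)) m * jacobiSym ((8 * j + r : ℕ) : ℤ) m := by
  rw [jacobiSym.mul_left, jac_unit_mod8 u hu j r hr,
    jacobiSym.quadratic_reciprocity' hm (Nat.odd_iff.2 (by omega)), qrSign, mul_assoc]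
  congr 4
  have : ((8 : ℕ) : ZMod 4) = 0 := by decide
  rw [Nat.cast_add, Nat.cast_mul, this, zero_mul, zero_add]

lemma jz_le_one (a : ℤ) (n : ℕ) : |(jacobiSym a n : ℝ)| ≤ 1 := by
  rcases jacobiSym.trichotomy a n with h | h | h <;> rw [h] <;> norm_num

/-- the inner sum over a residue class modulo `8` -/
lemma class_sum (m : ℕ) (hm : Odd m) (r N : ℕ) :
    ∃ M : ℤ, |∑ j ∈ Finset.range N, (jacobiSym ((8 * j + r : ℕ) : ℤ) m : ℝ)| ≤ |(Sx m M N : ℝ)| := by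
  have hc : IsCoprime (8 : ℤ) (m : ℤ) := by
    have h1 : Nat.Coprime (2 ^ 3) m := (Nat.coprime_two_left.2 hm).pow_left 3
    exact_mod_cast Nat.isCoprime_iff_coprime.2 h1
  obtain ⟨s, t, hst⟩ := hc
  refine ⟨s * r, ?_⟩
  have : ∑ j ∈ Finset.range N, (jacobiSym ((8 * j + r : ℕ) : ℤ) m : ℝ) =
      (jacobiSym 8 m : ℝ) * (Sx m (s * r) N : ℝ) := by
    unfold Sx
    rw [Int.cast_sum, Finset.mul_sum]
    refine Finset.sum_congr rfl fun j _ => ?_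
    rw [← Int.cast_mul, ← jacobiSym.mul_left]
    congr 1
    refine jacobiSym.mod_left' ?_
    refine Int.ModEq.symm ?_
    refine (Int.modEq_iff_dvd).2 ⟨t * r, ?_⟩
    push_cast
    linear_combination (-(r : ℤ)) * hst
  rw [this, abs_mul]
  calc _ ≤ 1 * |(Sx m (s * r) N : ℝ)| := mul_le_mul_of_nonneg_right (jz_le_one _ _) (abs_nonneg _)
    _ = _ := one_mul _

lemma four_sum (g : ℕ → ℝ) : ∑ r ∈ ({1, 3, 5, 7} : Finset ℕ), g r = g 1 + g 3 + g 5 + g 7 := by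
  rw [Finset.sum_insert (by decide), Finset.sum_insert (by decide), Finset.sum_insert (by decide),
      Finset.sum_singleton]; ring

lemma V_formula (u : ℤ) (hu : u = 1 ∨ u = -1 ∨ u = 2 ∨ u = -2) (m : ℕ) (hm : Odd m) (z : ℕ) :
    ∑ l ∈ Finset.Icc 1 z, (jo (u * m) l : ℝ) =
      ∑ r ∈ ({1, 3, 5, 7} : Finset ℕ),
        ((jacobiSym u r : ℝ) * (jacobiSym (ZMod.χ₄ (r : ZMod 4)) m : ℝ)) *
        ∑ j ∈ Finset.range ((z + 8 - r) / 8), (jacobiSym ((8 * j + r : ℕ) : ℤ) m : ℝ) := by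
  have h := sum_mod8 (fun l => (jacobiSym (u * m) l : ℝ)) z
  have h1 : ∑ l ∈ Finset.Icc 1 z, (jo (u * m) l : ℝ) =
      ∑ l ∈ Finset.Icc 1 z, (if l % 2 = 1 then (jacobiSym (u * m) l : ℝ) else 0) := by
    refine Finset.sum_congr rfl fun l _ => ?_
    unfold jo
    split_ifs <;> simp
  rw [h1, h]
  refine Finset.sum_congr rfl fun r hr => ?_
  rw [Finset.mul_sum]
  refine Finset.sum_congr rfl fun j _ => ?_
  have hr2 : r % 2 = 1 := by
    simp only [Finset.mem_insert, Finset.mem_singleton] at hr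
    omega
  rw [jac_split u hu m hm j r hr2]
  push_cast
  ring

lemma V_bound_big (u : ℤ) (hu : u = 1 ∨ u = -1 ∨ u = 2 ∨ u = -2) (m : ℕ) (hm : Odd m) (B : ℝ)
    (hB : ∀ (N : ℕ) (M : ℤ), |(Sx m M N : ℝ)| ≤ B * Real.sqrt N) (z : ℕ) :
    |∑ l ∈ Finset.Icc 1 z, (jo (u * m) l : ℝ)| ≤ 4 * B * Real.sqrt z := by
  have hB0 : 0 ≤ B := by
    have := (abs_nonneg _).trans (hB 1 0)
    simpa using this
  rw [V_formula u hu m hm z]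
  have key : ∀ r ∈ ({1, 3, 5, 7} : Finset ℕ),
      |((jacobiSym u r : ℝ) * (jacobiSym (ZMod.χ₄ (r : ZMod 4)) m : ℝ)) *
        ∑ j ∈ Finset.range ((z + 8 - r) / 8), (jacobiSym ((8 * j + r : ℕ) : ℤ) m : ℝ)| ≤
        B * Real.sqrt z := by
    intro r hr
    simp only [Finset.mem_insert, Finset.mem_singleton] at hr
    obtain ⟨M, hM⟩ := class_sum m hm r ((z + 8 - r) / 8)
    rw [abs_mul, abs_mul]
    have h1 : |(jacobiSym u r : ℝ)| * |(jacobiSym (ZMod.χ₄ (r : ZMod 4)) m : ℝ)| ≤ 1 :=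
      mul_le_one₀ (jz_le_one _ _) (abs_nonneg _) (jz_le_one _ _)
    calc _ ≤ 1 * _ := mul_le_mul_of_nonneg_right h1 (abs_nonneg _)
      _ = _ := one_mul _
      _ ≤ _ := hM
      _ ≤ _ := hB _ _
      _ ≤ _ := by
        refine mul_le_mul_of_nonneg_left (Real.sqrt_le_sqrt ?_) hB0
        have : (z + 8 - r) / 8 ≤ z := by omega
        exact_mod_cast this
  refine (Finset.abs_sum_le_sum_abs _ _).trans ((Finset.sum_le_sum key).trans ?_)
  rw [four_sum]
  exact le_of_eq (by ring)

lemma V_bound_one (u : ℤ) (hu : u = -1 ∨ u = 2 ∨ u = -2) (z : ℕ) :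
    |∑ l ∈ Finset.Icc 1 z, (jo (u * (1 : ℕ)) l : ℝ)| ≤ 4 * Real.sqrt z := by
  rw [V_formula u (Or.inr hu) 1 odd_one z, four_sum]
  simp only [jacobiSym.one_right, Finset.sum_const, Finset.card_range, Nat.cast_one, mul_one,
    nsmul_eq_mul, Int.cast_one]
  rcases Nat.eq_zero_or_pos z with rfl | hz
  · norm_num
  have hs : (1 : ℝ) ≤ Real.sqrt z := Real.one_le_sqrt.2 (by exact_mod_cast hz)
  obtain ⟨k, hk⟩ : ∃ k, k = z / 8 := ⟨_, rfl⟩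
  have key : ∀ r ∈ ({1, 3, 5, 7} : Finset ℕ), ∃ e : ℝ, |e| ≤ 1 ∧ (((z + 8 - r) / 8 : ℕ) : ℝ) = k + e := by
    intro r hr
    simp only [Finset.mem_insert, Finset.mem_singleton] at hr
    have : (z + 8 - r) / 8 = k ∨ (z + 8 - r) / 8 = k + 1 := by omega
    rcases this with h | h
    · exact ⟨0, by norm_num, by rw [h]; simp⟩
    · exact ⟨1, by norm_num, by rw [h]; simp⟩
  obtain ⟨e1, a1, b1⟩ := key 1 (by decide)
  obtain ⟨e3, a3, b3⟩ := key 3 (by decide)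
  obtain ⟨e5, a5, b5⟩ := key 5 (by decide)
  obtain ⟨e7, a7, b7⟩ := key 7 (by decide)
  rw [b1, b3, b5, b7]
  rw [abs_le] at a1 a3 a5 a7 ⊢
  have h3 : (jacobiSym (-1) 3 = -1 ∧ jacobiSym (-1) 5 = 1 ∧ jacobiSym (-1) 7 = -1) ∧
      (jacobiSym 2 3 = -1 ∧ jacobiSym 2 5 = -1 ∧ jacobiSym 2 7 = 1) ∧
      (jacobiSym (-2) 3 = 1 ∧ jacobiSym (-2) 5 = -1 ∧ jacobiSym (-2) 7 = -1) := by
    norm_num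
  obtain ⟨⟨q1, q2, q3⟩, ⟨q4, q5, q6⟩, q7, q8, q9⟩ := h3
  rcases hu with rfl | rfl | rfl
  · rw [q1, q2, q3]; push_cast; constructor <;> linarith
  · rw [q4, q5, q6]; push_cast; constructor <;> linarith
  · rw [q7, q8, q9]; push_cast; constructor <;> linarith

lemma disc_decomp (A : ℤ) (hA : A ≠ 0) : ∃ (u : ℤ) (m s : ℕ), (u = 1 ∨ u = -1 ∨ u = 2 ∨ u = -2) ∧
    Odd m ∧ Squarefree m ∧ s ≠ 0 ∧ A = u * m * (s : ℤ) ^ 2 := by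
  obtain ⟨a, b, ha, hb, hab, hsq⟩ := Nat.sq_mul_squarefree_of_pos (n := A.natAbs) (Int.natAbs_pos.2 hA)
  have key : ∃ (v m : ℕ), (v = 1 ∨ v = 2) ∧ Odd m ∧ Squarefree m ∧ a = v * m := by
    rcases Nat.even_or_odd a with h | h
    · obtain ⟨m, hm⟩ := h
      have hm' : a = 2 * m := by omega
      refine ⟨2, m, Or.inr rfl, ?_, ?_, hm'⟩
      · by_contra hodd
        rw [Nat.not_odd_iff_even] at hodd
        obtain ⟨n, hn⟩ := hodd
        have : 2 * 2 ∣ a := ⟨n, by omega⟩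
        have := hsq 2 this
        simp at this
      · exact hsq.squarefree_of_dvd ⟨2, by omega⟩
    · exact ⟨1, a, Or.inl rfl, h, hsq, by simp⟩
  obtain ⟨v, m, hv, hm, hms, rfl⟩ := key
  have h1 : A = v * m * (b : ℤ) ^ 2 ∨ A = -(v * m * (b : ℤ) ^ 2) := by
    have : (A.natAbs : ℤ) = b ^ 2 * (v * m) := by exact_mod_cast hab.symm
    rcases Int.natAbs_eq A with h | h
    · left; rw [h, this]; ring
    · right; rw [h, this]; ring
  rcases h1 with h | h
  · exact ⟨v, m, b, by rcases hv with rfl | rfl <;> simp, hm, hms, hb.ne', h⟩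
  · exact ⟨-v, m, b, by rcases hv with rfl | rfl <;> simp, hm, hms, hb.ne', by rw [h]; ring⟩

theorem W_bound (ε : ℝ) (hε : 0 < ε) : ∃ K : ℝ, 1 ≤ K ∧ ∀ A : ℤ, A ≠ 0 → ¬ IsSquare A → ∀ z : ℕ,
    |∑ l ∈ Finset.Icc 1 z, (jo A l : ℝ)| ≤
      K * (A.natAbs : ℝ) ^ ((3 : ℝ) / 16 + ε) * Real.sqrt z := by
  obtain ⟨K, hK, hburg⟩ := burgess (ε / 2) (by positivity)
  obtain ⟨C, hC, homega⟩ := omega_pow_le 2 (ε / 2) (by norm_num) (by positivity)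
  refine ⟨4 * K * C, by nlinarith, ?_⟩
  intro A hA hns z
  obtain ⟨u, m, s, hu, hm, hms, hs, rfl⟩ := disc_decomp A hA
  have hm1 : 1 ≤ m := hm.pos
  have hV : ∀ z : ℕ, |∑ l ∈ Finset.Icc 1 z, (jo (u * m) l : ℝ)| ≤
      (4 * (K * (m : ℝ) ^ ((3 : ℝ) / 16 + ε / 2))) * Real.sqrt z := by
    intro z
    rcases hm1.eq_or_lt with h | h
    · subst h
      have hu' : u = -1 ∨ u = 2 ∨ u = -2 := by
        rcases hu with rfl | h
        · exact absurd ⟨(s : ℤ), by push_cast; ring⟩ hns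
        · exact h
      refine (V_bound_one u hu' z).trans ?_
      rw [Nat.cast_one, Real.one_rpow]
      have := Real.sqrt_nonneg (z : ℝ)
      nlinarith
    · exact V_bound_big u hu m hm _ (fun N M => hburg m h hms hm N M) z
  have hT := sieve_T (fun l => (jo (u * m) l : ℝ)) (fun p l => by rw [jo_mul]; push_cast; rfl)
    (fun p => jo_abs _ _) _ hV s.primeFactors (fun p hp => Nat.prime_of_mem_primeFactors hp) z
  have e1 : ∑ l ∈ Finset.Icc 1 z, (jo (u * m * (s : ℤ) ^ 2) l : ℝ) =
      ∑ l ∈ Finset.Icc 1 z,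
        (if (∀ p ∈ s.primeFactors, ¬ p ∣ l) then (jo (u * m) l : ℝ) else 0) := by
    refine Finset.sum_congr rfl fun l _ => ?_
    rw [jo_mul_left, jo_sq s hs]
    split_ifs
    · rw [jo_one_mul]
    · simp
  rw [e1]
  refine hT.trans ?_
  have hsl : (s : ℝ) ≤ ((u * m * (s : ℤ) ^ 2).natAbs : ℝ) := by
    have : s ∣ (u * m * (s : ℤ) ^ 2).natAbs := by
      rw [← Int.natCast_dvd]; exact ⟨u * m * s, by ring⟩
    exact_mod_cast Nat.le_of_dvd (Int.natAbs_pos.2 hA) this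
  have hml : (m : ℝ) ≤ ((u * m * (s : ℤ) ^ 2).natAbs : ℝ) := by
    have : m ∣ (u * m * (s : ℤ) ^ 2).natAbs := by
      rw [← Int.natCast_dvd]; exact ⟨u * s ^ 2, by ring⟩
    exact_mod_cast Nat.le_of_dvd (Int.natAbs_pos.2 hA) this
  generalize (u * m * (s : ℤ) ^ 2).natAbs = n at hsl hml
  have hn0 : (0 : ℝ) < n := lt_of_lt_of_le (by exact_mod_cast hm1) hml
  have i1 : (2 : ℝ) ^ s.primeFactors.card ≤ C * (n : ℝ) ^ (ε / 2) :=
    (homega s hs).trans (mul_le_mul_of_nonneg_left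
      (Real.rpow_le_rpow (by positivity) hsl (by positivity)) (by positivity))
  have i2 : (m : ℝ) ^ ((3 : ℝ) / 16 + ε / 2) ≤ (n : ℝ) ^ ((3 : ℝ) / 16 + ε / 2) :=
    Real.rpow_le_rpow (by positivity) hml (by positivity)
  calc _ ≤ (C * (n : ℝ) ^ (ε / 2)) *
        (4 * (K * (n : ℝ) ^ ((3 : ℝ) / 16 + ε / 2)) * Real.sqrt z) := by
        refine mul_le_mul i1 ?_ (by positivity) (by positivity)
        refine mul_le_mul_of_nonneg_right ?_ (Real.sqrt_nonneg _)
        refine mul_le_mul_of_nonneg_left ?_ (by norm_num)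
        exact mul_le_mul_of_nonneg_left i2 (by positivity)
    _ = 4 * K * C * ((n : ℝ) ^ (ε / 2) * (n : ℝ) ^ ((3 : ℝ) / 16 + ε / 2)) * Real.sqrt z := by ring
    _ = _ := by
      rw [← Real.rpow_add hn0]
      congr 3; ring

lemma totient_div (n : ℕ) (hn : 0 < n) :
    (Nat.totient n : ℝ) / n = ∑ d ∈ n.divisors, (ArithmeticFunction.moebius d : ℝ) / d := by
  have h := (ArithmeticFunction.sum_eq_iff_sum_mul_moebius_eq (R := ℝ)
    (f := fun n => (Nat.totient n : ℝ)) (g := fun n => (n : ℝ))).1 (by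
      intro n _
      exact_mod_cast Nat.sum_totient n) n hn
  rw [← h, Nat.sum_divisorsAntidiagonal (fun x y => ((ArithmeticFunction.moebius x : ℤ) : ℝ) * (y : ℝ)),
    Finset.sum_div]
  refine Finset.sum_congr rfl fun d hd => ?_
  have hd' := Nat.dvd_of_mem_divisors hd
  have hd0 : (d : ℝ) ≠ 0 := by
    exact_mod_cast (Nat.pos_of_dvd_of_pos hd' hn).ne'
  have hn0 : (n : ℝ) ≠ 0 := by exact_mod_cast hn.ne'
  rw [Nat.cast_div hd' hd0]
  field_simp

lemma I_formula (A : ℤ) (y : ℕ) :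
    ∑ n ∈ Finset.Icc 1 y, (jo A n : ℝ) * ((Nat.totient n : ℝ) / n) =
      ∑ d ∈ Finset.Icc 1 y, (ArithmeticFunction.moebius d : ℝ) / d * (jo A d : ℝ) *
        ∑ l ∈ Finset.Icc 1 (y / d), (jo A l : ℝ) := by
  have h1 : ∀ d ∈ Finset.Icc 1 y, (ArithmeticFunction.moebius d : ℝ) / d * (jo A d : ℝ) *
        ∑ l ∈ Finset.Icc 1 (y / d), (jo A l : ℝ) = ∑ n ∈ Finset.Icc 1 y,
        (if d ∣ n then (ArithmeticFunction.moebius d : ℝ) / d * (jo A n : ℝ) else 0) := by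
    intro d hd
    rw [sum_multiples _ d y (Finset.mem_Icc.1 hd).1, Finset.mul_sum]
    refine Finset.sum_congr rfl fun l _ => ?_
    rw [jo_mul]; push_cast; ring
  rw [Finset.sum_congr rfl h1, Finset.sum_comm]
  refine Finset.sum_congr rfl fun n hn => ?_
  rw [Finset.mem_Icc] at hn
  rw [totient_div n hn.1, ← Finset.sum_filter, Finset.mul_sum]
  have : n.divisors = (Finset.Icc 1 y).filter (fun d => d ∣ n) := by
    ext d
    simp only [Nat.mem_divisors, Finset.mem_filter, Finset.mem_Icc]
    constructor
    · rintro ⟨h, _⟩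
      exact ⟨⟨Nat.pos_of_dvd_of_pos h hn.1, (Nat.le_of_dvd hn.1 h).trans hn.2⟩, h⟩
    · rintro ⟨_, h⟩
      exact ⟨h, by omega⟩
  rw [this]
  refine Finset.sum_congr rfl fun d _ => ?_
  ring

theorem I_bound (ε : ℝ) (hε : 0 < ε) : ∃ K : ℝ, 1 ≤ K ∧ ∀ A : ℤ, A ≠ 0 → ¬ IsSquare A → ∀ y : ℕ,
    |∑ n ∈ Finset.Icc 1 y, (jo A n : ℝ) * ((Nat.totient n : ℝ) / n)| ≤
      K * (A.natAbs : ℝ) ^ ((3 : ℝ) / 16 + ε) * (y : ℝ) ^ ((1 : ℝ) / 2 + ε) := by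
  obtain ⟨K, hK, hW⟩ := W_bound ε hε
  refine ⟨K * (1 + 1 / ε), ?_, ?_⟩
  · have : 0 < 1 / ε := by positivity
    nlinarith
  intro A hA hns y
  rcases Nat.eq_zero_or_pos y with rfl | hy
  · simp; positivity
  rw [I_formula]
  have hy1 : (1 : ℝ) ≤ y := by exact_mod_cast hy
  have hlog : harm y ≤ (1 + 1 / ε) * (y : ℝ) ^ ε := by
    have h1 := harm_le y
    have h2 := Real.log_le_rpow_div (x := (y : ℝ)) (by positivity) hε
    have h3 : (1 : ℝ) ≤ (y : ℝ) ^ ε := Real.one_le_rpow hy1 hε.le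
    calc harm y ≤ 1 + Real.log y := h1
      _ ≤ (y : ℝ) ^ ε + (y : ℝ) ^ ε / ε := add_le_add h3 h2
      _ = _ := by field_simp; try ring
  set B : ℝ := K * (A.natAbs : ℝ) ^ ((3 : ℝ) / 16 + ε) with hBdef
  have hB0 : 0 ≤ B := by positivity
  calc _ ≤ ∑ d ∈ Finset.Icc 1 y, |(ArithmeticFunction.moebius d : ℝ) / d * (jo A d : ℝ) *
        ∑ l ∈ Finset.Icc 1 (y / d), (jo A l : ℝ)| := Finset.abs_sum_le_sum_abs _ _
    _ ≤ ∑ d ∈ Finset.Icc 1 y, (1 / (d : ℝ)) * (B * Real.sqrt y) := by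
      refine Finset.sum_le_sum fun d hd => ?_
      rw [abs_mul, abs_mul, abs_div, Nat.abs_cast]
      have m1 : |((ArithmeticFunction.moebius d : ℤ) : ℝ)| ≤ 1 := by
        exact_mod_cast ArithmeticFunction.abs_moebius_le_one (n := d)
      refine mul_le_mul ?_ ?_ (abs_nonneg _) (by positivity)
      · calc _ ≤ (1 / (d : ℝ)) * 1 := by
              refine mul_le_mul ?_ (jo_abs _ _) (abs_nonneg _) (by positivity)
              exact div_le_div_of_nonneg_right m1 (by positivity)
          _ = _ := mul_one _
      · refine (hW A hA hns _).trans ?_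
        refine mul_le_mul_of_nonneg_left (Real.sqrt_le_sqrt ?_) hB0
        exact_mod_cast Nat.div_le_self _ _
    _ = harm y * (B * Real.sqrt y) := by rw [← Finset.sum_mul, harm]
    _ ≤ ((1 + 1 / ε) * (y : ℝ) ^ ε) * (B * Real.sqrt y) :=
      mul_le_mul_of_nonneg_right hlog (by positivity)
    _ = K * (1 + 1 / ε) * (A.natAbs : ℝ) ^ ((3 : ℝ) / 16 + ε) * (y : ℝ) ^ ((1 : ℝ) / 2 + ε) := by
      rw [Real.rpow_add (by positivity : (0 : ℝ) < y), ← Real.sqrt_eq_rpow, hBdef]; ring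


/-! ## Part 9: quadratic Gauss sums -/

/-- quadratic Gauss sum with a linear term -/
noncomputable def gs (q : ℕ) [NeZero q] (α β : ZMod q) : ℂ :=
  ∑ b : ZMod q, ZMod.stdAddChar (α * b ^ 2 + β * b)

lemma std_int (q : ℕ) [NeZero q] (j : ℤ) :
    ZMod.stdAddChar (j : ZMod q) = Complex.exp (2 * Real.pi * Complex.I * j / q) :=
  ZMod.stdAddChar_coe j

lemma std_crt (m n : ℕ) [NeZero m] [NeZero n] [NeZero (m * n)] (u v : ℤ)
    (huv : u * n + v * m = 1) (j : ℤ) :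
    (ZMod.stdAddChar (j : ZMod (m * n)) : ℂ) =
      ZMod.stdAddChar ((u * j : ℤ) : ZMod m) * ZMod.stdAddChar ((v * j : ℤ) : ZMod n) := by
  rw [std_int, std_int, std_int, ← Complex.exp_add]
  congr 1
  have hm : (m : ℂ) ≠ 0 := by exact_mod_cast NeZero.ne m
  have hn : (n : ℂ) ≠ 0 := by exact_mod_cast NeZero.ne n
  have h : (u : ℂ) * n + v * m = 1 := by exact_mod_cast huv
  push_cast
  field_simp
  linear_combination (-(j : ℂ)) * h

lemma std_crt' (m n : ℕ) [NeZero m] [NeZero n] [NeZero (m * n)] (h : m.Coprime n) (u v : ℤ)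
    (huv : u * n + v * m = 1) (x : ZMod (m * n)) :
    (ZMod.stdAddChar x : ℂ) =
      ZMod.stdAddChar ((u : ZMod m) * (ZMod.chineseRemainder h x).1) *
      ZMod.stdAddChar ((v : ZMod n) * (ZMod.chineseRemainder h x).2) := by
  obtain ⟨a, rfl⟩ := ZMod.intCast_surjective x
  rw [std_crt m n u v huv, map_intCast (ZMod.chineseRemainder h)]
  simp only [Prod.fst_intCast, Prod.snd_intCast, Int.cast_mul]

lemma gs_crt (m n : ℕ) [NeZero m] [NeZero n] [NeZero (m * n)] (h : m.Coprime n) (u v : ℤ)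
    (huv : u * n + v * m = 1) (α β : ZMod (m * n)) :
    gs (m * n) α β =
      gs m (u * (ZMod.chineseRemainder h α).1) (u * (ZMod.chineseRemainder h β).1) *
      gs n (v * (ZMod.chineseRemainder h α).2) (v * (ZMod.chineseRemainder h β).2) := by
  unfold gs
  rw [Finset.sum_mul_sum, ← Fintype.sum_prod_type']
  refine Fintype.sum_equiv (ZMod.chineseRemainder h).toEquiv _ _ ?_
  intro x
  rw [std_crt' m n h u v huv]
  simp only [map_add, map_mul, map_pow, Prod.fst_add, Prod.fst_mul, Prod.pow_fst, Prod.snd_add,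
    Prod.snd_mul, Prod.pow_snd, RingEquiv.toEquiv_eq_coe, EquivLike.coe_coe]
  congr 2 <;> ring

lemma gs_scale (q : ℕ) [NeZero q] (u : (ZMod q)ˣ) (α β : ZMod q) :
    gs q (u * α) (u * β) = gs q ((u⁻¹ : (ZMod q)ˣ) * α) β := by
  unfold gs
  refine Fintype.sum_equiv (Units.mulLeft u) _ _ ?_
  intro x
  simp only [Units.mulLeft_apply]
  congr 1
  have : ((u⁻¹ : (ZMod q)ˣ) : ZMod q) * u = 1 := Units.inv_mul u
  linear_combination (-(u : ZMod q) * α * x ^ 2) * this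

/-- vanishing -/
lemma gs_vanish (q : ℕ) [NeZero q] (k : ZMod q) (a c : ℤ) (h : ¬ ((Int.gcd a q : ℕ) : ℤ) ∣ c) :
    gs q (k * a) c = 0 := by
  set g := Int.gcd a q with hg
  obtain ⟨t, ht⟩ : g ∣ q := by
    have : (g : ℤ) ∣ q := Int.gcd_dvd_right _ _
    exact_mod_cast this
  obtain ⟨a', ha'⟩ : (g : ℤ) ∣ a := Int.gcd_dvd_left _ _
  have hq0 : q ≠ 0 := NeZero.ne q
  have hg0 : (g : ℂ) ≠ 0 := by
    have : g ≠ 0 := by rintro h0; rw [h0] at ht; simp at ht; exact hq0 ht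
    exact_mod_cast this
  have ht0 : (t : ℂ) ≠ 0 := by
    have : t ≠ 0 := by rintro h0; rw [h0] at ht; simp at ht; exact hq0 ht
    exact_mod_cast this
  have hat : ((a : ℤ) : ZMod q) * (t : ZMod q) = 0 := by
    have : ((a * t : ℤ) : ZMod q) = 0 := by
      rw [ZMod.intCast_zmod_eq_zero_iff_dvd]
      refine ⟨a', ?_⟩
      rw [ha', ht]; push_cast; ring
    push_cast at this
    exact this
  have h1 : gs q (k * a) c = ZMod.stdAddChar ((c * t : ℤ) : ZMod q) * gs q (k * a) c := by
    conv_lhs => unfold gs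
    rw [gs, Finset.mul_sum]
    refine Fintype.sum_equiv (Equiv.addRight (-(t : ZMod q))) _ _ ?_
    intro x
    rw [← AddChar.map_add_eq_mul]
    congr 1
    simp only [Equiv.coe_addRight]
    push_cast
    linear_combination (k * (2 * x - t)) * hat
  by_contra hne
  have h2 : (ZMod.stdAddChar ((c * t : ℤ) : ZMod q) : ℂ) = 1 := by
    have h3 : (ZMod.stdAddChar ((c * t : ℤ) : ZMod q) - 1) * gs q (k * a) c = 0 := by
      rw [sub_mul, ← h1, one_mul, sub_self]
    rcases mul_eq_zero.1 h3 with h4 | h4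
    · exact sub_eq_zero.1 h4
    · exact absurd h4 hne
  have h3 : ((c * t : ℤ) : ZMod q) = 0 := by
    apply ZMod.injective_stdAddChar
    rw [h2, AddChar.map_zero_eq_one]
  rw [ZMod.intCast_zmod_eq_zero_iff_dvd] at h3
  apply h
  have ht' : (t : ℤ) ≠ 0 := by exact_mod_cast ht0
  have : ((g : ℤ) * t) ∣ c * t := by rw [ht] at h3; exact_mod_cast h3
  exact (mul_dvd_mul_iff_right ht').1 this

lemma std_norm (q : ℕ) [NeZero q] (x : ZMod q) : ‖(ZMod.stdAddChar x : ℂ)‖ = 1 := by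
  rw [ZMod.stdAddChar_apply]; exact Circle.norm_coe _

lemma std_conj (q : ℕ) [NeZero q] (x : ZMod q) :
    (starRingEnd ℂ) (ZMod.stdAddChar x : ℂ) = ZMod.stdAddChar (-x) := by
  rw [AddChar.map_neg_eq_inv, Complex.inv_eq_conj (std_norm q x)]

lemma gs_conj (q : ℕ) [NeZero q] (α β : ZMod q) :
    (starRingEnd ℂ) (gs q α β) = gs q (-α) (-β) := by
  unfold gs
  rw [map_sum]
  refine Finset.sum_congr rfl fun b _ => ?_
  rw [std_conj]
  congr 1; ring

lemma gs_sq (q : ℕ) [NeZero q] (α β : ZMod q) :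
    (starRingEnd ℂ) (gs q α β) * gs q α β =
      q * ∑ h : ZMod q, if 2 * α * h = 0 then (ZMod.stdAddChar (α * h ^ 2 + β * h) : ℂ) else 0 := by
  rw [gs_conj]
  unfold gs
  rw [Finset.sum_mul_sum]
  have h1 : ∀ b : ZMod q, ∑ b' : ZMod q, (ZMod.stdAddChar (-α * b ^ 2 + -β * b) : ℂ) *
      ZMod.stdAddChar (α * b' ^ 2 + β * b') = ∑ h : ZMod q,
      (ZMod.stdAddChar (α * h ^ 2 + β * h) : ℂ) * ZMod.stdAddChar (b * (2 * α * h)) := by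
    intro b
    refine Fintype.sum_equiv (Equiv.addRight (-b)) _ _ ?_
    intro x
    rw [← AddChar.map_add_eq_mul, ← AddChar.map_add_eq_mul]
    congr 1
    simp only [Equiv.coe_addRight]
    ring
  rw [Finset.sum_congr rfl fun b _ => h1 b, Finset.sum_comm, Finset.mul_sum]
  refine Finset.sum_congr rfl fun h _ => ?_
  rw [← Finset.mul_sum, AddChar.sum_mulShift _ (ZMod.isPrimitive_stdAddChar q), ZMod.card]
  split_ifs
  · ring
  · simp

lemma card_ann (q : ℕ) [NeZero q] (a : ℤ) :
    (Finset.univ.filter fun h : ZMod q => (a : ZMod q) * h = 0).card ≤ Int.gcd a q := by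
  set g := Int.gcd a q with hg
  have hq0 : q ≠ 0 := NeZero.ne q
  obtain ⟨t, ht⟩ : g ∣ q := by
    have : (g : ℤ) ∣ q := Int.gcd_dvd_right _ _
    exact_mod_cast this
  have hg0 : 0 < g := by
    rcases Nat.eq_zero_or_pos g with h0 | h0
    · rw [h0] at ht; simp at ht; exact absurd ht hq0
    · exact h0
  have ht0 : 0 < t := by
    rcases Nat.eq_zero_or_pos t with h0 | h0
    · rw [h0] at ht; simp at ht; exact absurd ht hq0
    · exact h0
  calc _ ≤ ((Finset.range g).image fun s : ℕ => ((t * s : ℕ) : ZMod q)).card := by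
        refine Finset.card_le_card ?_
        intro h hh
        simp only [Finset.mem_filter, Finset.mem_univ, true_and] at hh
        simp only [Finset.mem_image, Finset.mem_range]
        have h1 : (q : ℤ) ∣ a * h.val := by
          rw [← ZMod.intCast_zmod_eq_zero_iff_dvd]
          push_cast
          rw [ZMod.natCast_zmod_val]; exact hh
        have h2 : t ∣ h.val := by
          obtain ⟨a', ha'⟩ : (g : ℤ) ∣ a := Int.gcd_dvd_left _ _
          have hco : Int.gcd a' t = 1 := by
            have e : Int.gcd a q = g * Int.gcd a' t := by
              rw [ht, ha']; push_cast; rw [Int.gcd_mul_left]; simp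
            have e2 : g * 1 = g * Int.gcd a' t := by rw [mul_one]; exact hg.trans e
            exact (Nat.eq_of_mul_eq_mul_left hg0 e2).symm
          have h3 : (t : ℤ) ∣ a' * h.val := by
            have : (g : ℤ) * t ∣ g * (a' * h.val) := by
              rw [← mul_assoc, ← ha']
              have e3 : (q : ℤ) = g * t := by exact_mod_cast ht
              rw [← e3]; exact h1
            exact (mul_dvd_mul_iff_left (by exact_mod_cast hg0.ne')).1 this
          have h4 : (t : ℤ) ∣ h.val := by
            refine IsCoprime.dvd_of_dvd_mul_left ?_ h3
            exact (Int.isCoprime_iff_gcd_eq_one.2 hco).symm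
          exact_mod_cast h4
        obtain ⟨s, hs⟩ := h2
        refine ⟨s, ?_, ?_⟩
        · have := ZMod.val_lt h
          rw [hs] at this
          have h5 : t * s < t * g := by rw [mul_comm t g, ← ht]; exact this
          exact lt_of_mul_lt_mul_left h5 (Nat.zero_le _)
        · rw [← hs, ZMod.natCast_zmod_val]
    _ ≤ _ := Finset.card_image_le
    _ = g := Finset.card_range _

lemma gs_norm_sq_le (q : ℕ) [NeZero q] (k : ZMod q) (hk : IsUnit k) (a c : ℤ) :
    ‖gs q (k * a) c‖ ^ 2 ≤ q * (2 * (Int.gcd a q : ℕ)) := by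
  have h := gs_sq q (k * a) c
  rw [← Complex.normSq_eq_conj_mul_self, Complex.normSq_eq_norm_sq] at h
  have h1 : ‖((‖gs q (k * a) c‖ ^ 2 : ℝ) : ℂ)‖ = ‖gs q (k * a) c‖ ^ 2 := by
    rw [Complex.norm_real, Real.norm_of_nonneg (by positivity)]
  rw [← h1, h, norm_mul, Complex.norm_natCast]
  refine mul_le_mul_of_nonneg_left ?_ (by positivity)
  refine (norm_sum_le _ _).trans ?_
  have h2 : ∀ x : ZMod q, ‖(if 2 * (k * (a : ZMod q)) * x = 0 then
      (ZMod.stdAddChar (k * (a : ZMod q) * x ^ 2 + (c : ZMod q) * x) : ℂ) else 0)‖ =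
      if ((2 * a : ℤ) : ZMod q) * x = 0 then (1 : ℝ) else 0 := by
    intro x
    have : 2 * (k * (a : ZMod q)) * x = 0 ↔ ((2 * a : ℤ) : ZMod q) * x = 0 := by
      push_cast
      rw [show 2 * (k * (a : ZMod q)) * x = k * (2 * a * x) by ring]
      exact hk.mul_right_eq_zero
    by_cases h : ((2 * a : ℤ) : ZMod q) * x = 0
    · rw [if_pos h, if_pos (this.2 h), std_norm]
    · rw [if_neg h, if_neg (fun h' => h (this.1 h')), norm_zero]
  rw [Finset.sum_congr rfl fun x _ => h2 x, Finset.sum_boole]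
  have h3 := card_ann q (2 * a)
  have h4 : Int.gcd (2 * a) q ≤ 2 * Int.gcd a q := by
    have h5 : Int.gcd (2 * a) q ∣ 2 * Int.gcd a q := by
      rw [show 2 * Int.gcd a q = Int.gcd (2 * a) (2 * q) by rw [Int.gcd_mul_left]; rfl]
      exact Int.gcd_dvd_gcd_of_dvd_right _ ⟨2, by ring⟩
    refine Nat.le_of_dvd ?_ h5
    have : 0 < Int.gcd a q := Int.gcd_pos_of_ne_zero_right _ (by exact_mod_cast NeZero.ne q)
    omega
  exact_mod_cast h3.trans h4


lemma sum_zmod_range (q : ℕ) [NeZero q] (F : ZMod q → ℂ) :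
    ∑ b : ZMod q, F b = ∑ i ∈ Finset.range q, F (i : ZMod q) := by
  refine Finset.sum_nbij' (fun b => b.val) (fun i => (i : ZMod q)) ?_ ?_ ?_ ?_ ?_
  · intro b _; exact Finset.mem_range.2 (ZMod.val_lt b)
  · intro i _; exact Finset.mem_univ _
  · intro b _; exact ZMod.natCast_zmod_val b
  · intro i hi; exact ZMod.val_cast_of_lt (Finset.mem_range.1 hi)
  · intro b _; rw [ZMod.natCast_zmod_val]

lemma sum_range_periodic (n p : ℕ) [NeZero n] (H : ZMod n → ℂ) :
    ∑ i ∈ Finset.range (p * n), H (i : ZMod n) = p * ∑ b : ZMod n, H b := by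
  induction p with
  | zero => simp
  | succ p ih =>
    rw [Nat.succ_mul, Finset.sum_range_add, ih, sum_zmod_range n H]
    have : ∀ i : ℕ, ((p * n + i : ℕ) : ZMod n) = i := by intro i; simp
    simp only [this]
    push_cast; ring

lemma sum_range_multiples (F : ℕ → ℂ) (p N : ℕ) (hp : 0 < p) :
    ∑ l ∈ Finset.range (p * N), (if p ∣ l then F l else 0) =
      ∑ l ∈ Finset.range N, F (p * l) := by
  rw [← Finset.sum_filter]
  symm
  refine Finset.sum_nbij' (fun l => p * l) (fun l => l / p) ?_ ?_ ?_ ?_ ?_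
  · intro l hl
    simp only [Finset.mem_range, Finset.mem_filter] at hl ⊢
    exact ⟨Nat.mul_lt_mul_of_pos_left hl hp, Dvd.intro _ rfl⟩
  · intro l hl
    simp only [Finset.mem_range, Finset.mem_filter] at hl ⊢
    exact Nat.div_lt_of_lt_mul hl.1
  · intro l _
    exact Nat.mul_div_cancel_left l hp
  · intro l hl
    simp only [Finset.mem_filter] at hl
    exact Nat.mul_div_cancel' hl.2
  · intro l _; rfl

lemma gs_prime_sq (p n : ℕ) [Fact p.Prime] [NeZero n] [NeZero (p * (p * n))] (hp : p ≠ 2) (α : ℤ)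
    (hα : ¬ (p : ℤ) ∣ α) :
    gs (p * (p * n)) (α : ZMod (p * (p * n))) 0 = p * gs n (α : ZMod n) 0 := by
  have hpp : p.Prime := Fact.out
  have hp0 : (p : ℂ) ≠ 0 := by exact_mod_cast hpp.ne_zero
  have hn0 : (n : ℂ) ≠ 0 := by exact_mod_cast NeZero.ne n
  have hqn : (((p * (p * n) : ℕ)) : ZMod (p * (p * n))) = 0 := ZMod.natCast_self _
  have h2α : ¬ (p : ℤ) ∣ 2 * α := by
    intro h
    rcases (Nat.prime_iff_prime_int.1 hpp).dvd_or_dvd h with h | h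
    · have h' : p ∣ 2 := by exact_mod_cast h
      exact hp ((Nat.prime_dvd_prime_iff_eq hpp Nat.prime_two).1 h')
    · exact hα h
  set q := p * (p * n) with hq
  have key : (p : ℂ) * gs q (α : ZMod q) 0 = p * ∑ l ∈ Finset.range q,
      (if p ∣ l then (ZMod.stdAddChar ((α * (l : ℤ) ^ 2 : ℤ) : ZMod q) : ℂ) else 0) := by
    have h1 : ∀ y : ℕ, gs q (α : ZMod q) 0 = ∑ b : ZMod q,
        (ZMod.stdAddChar ((α : ZMod q) * b ^ 2) : ℂ) *
          ZMod.stdAddChar (2 * (α : ZMod q) * b * ((p * n : ℕ) : ZMod q) * (y : ZMod q)) := by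
      intro y
      unfold gs
      refine Fintype.sum_equiv (Equiv.addRight (-(((p * n : ℕ) : ZMod q) * (y : ZMod q)))) _ _ ?_
      intro x
      rw [← AddChar.map_add_eq_mul]
      congr 1
      simp only [Equiv.coe_addRight]
      push_cast
      have hqn' : (p : ZMod q) * (p * n) = 0 := by
        have e : ((p * (p * n) : ℕ) : ZMod q) = 0 := hqn
        push_cast at e
        exact e
      linear_combination (α * n * y ^ 2 : ZMod q) * hqn'
    have h2 : (p : ℂ) * gs q (α : ZMod q) 0 = ∑ y ∈ Finset.range p, gs q (α : ZMod q) 0 := by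
      rw [Finset.sum_const, Finset.card_range, nsmul_eq_mul]
    rw [h2, Finset.sum_congr rfl fun y _ => h1 y, Finset.sum_comm, sum_zmod_range, Finset.mul_sum]
    refine Finset.sum_congr rfl fun l _ => ?_
    rw [← Finset.mul_sum]
    have h3 : ∀ y ∈ Finset.range p,
        (ZMod.stdAddChar (2 * (α : ZMod q) * (l : ZMod q) * ((p * n : ℕ) : ZMod q) * (y : ZMod q)) : ℂ)
        = ZMod.stdAddChar ((y : ZMod p) * ((2 * α * l : ℤ) : ZMod p)) := by
      intro y _
      have e1 : 2 * (α : ZMod q) * (l : ZMod q) * ((p * n : ℕ) : ZMod q) * (y : ZMod q) =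
          ((2 * α * l * ((p * n : ℕ) : ℤ) * y : ℤ) : ZMod q) := by push_cast; ring
      have e2 : (y : ZMod p) * ((2 * α * l : ℤ) : ZMod p) = ((y * (2 * α * l) : ℤ) : ZMod p) := by
        push_cast; ring
      rw [e1, e2, std_int, std_int]
      congr 1
      rw [hq]
      push_cast
      field_simp
    have h4 := AddChar.sum_mulShift ((2 * α * l : ℤ) : ZMod p) (ZMod.isPrimitive_stdAddChar p)
    rw [Finset.sum_congr rfl h3,
      ← sum_zmod_range p (fun y => (ZMod.stdAddChar (y * ((2 * α * l : ℤ) : ZMod p)) : ℂ)), h4,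
      ZMod.card]
    have h5 : ((2 * α * l : ℤ) : ZMod p) = 0 ↔ p ∣ l := by
      rw [ZMod.intCast_zmod_eq_zero_iff_dvd]
      constructor
      · intro h
        rcases (Nat.prime_iff_prime_int.1 hpp).dvd_or_dvd h with h | h
        · exact absurd h h2α
        · exact_mod_cast h
      · intro h
        exact Dvd.dvd.mul_left (by exact_mod_cast h) _
    by_cases hl : p ∣ l
    · rw [if_pos hl, if_pos (h5.2 hl)]
      push_cast; ring
    · rw [if_neg hl, if_neg (fun h => hl (h5.1 h))]
      simp
  rw [mul_left_cancel₀ hp0 key]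
  refine (sum_range_multiples _ p (p * n) hpp.pos).trans ?_
  rw [gs, ← sum_range_periodic n p (fun b => (ZMod.stdAddChar ((α : ZMod n) * b ^ 2 + 0 * b) : ℂ))]
  refine Finset.sum_congr rfl fun l _ => ?_
  have e1 : (α : ZMod n) * (l : ZMod n) ^ 2 + 0 * (l : ZMod n) = ((α * l ^ 2 : ℤ) : ZMod n) := by
    push_cast; ring
  rw [e1, std_int, std_int]
  congr 1
  rw [hq]
  push_cast
  field_simp

lemma gs_prime_char (p : ℕ) [Fact p.Prime] (hp : p ≠ 2) (α : ZMod p) (hα : α ≠ 0) :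
    gs p α 0 = ∑ x : ZMod p, (quadraticChar (ZMod p) x : ℂ) * ZMod.stdAddChar (α * x) := by
  have h1 : gs p α 0 = ∑ x : ZMod p, ((quadraticChar (ZMod p) x : ℂ) + 1) *
      ZMod.stdAddChar (α * x) := by
    unfold gs
    rw [← Finset.sum_fiberwise (s := Finset.univ) (g := fun b : ZMod p => b ^ 2)]
    refine Finset.sum_congr rfl fun x _ => ?_
    have h2 : ∀ b ∈ Finset.univ.filter (fun b : ZMod p => b ^ 2 = x),
        (ZMod.stdAddChar (α * b ^ 2 + 0 * b) : ℂ) = ZMod.stdAddChar (α * x) := by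
      intro b hb
      rw [(Finset.mem_filter.1 hb).2, zero_mul, add_zero]
    rw [Finset.sum_congr rfl h2, Finset.sum_const, nsmul_eq_mul]
    congr 1
    have h3 := quadraticChar_card_sqrts (F := ZMod p) (by rwa [ZMod.ringChar_zmod_n]) x
    have h4 : (Finset.univ.filter (fun b : ZMod p => b ^ 2 = x)) =
        {b : ZMod p | b ^ 2 = x}.toFinset := by ext; simp
    rw [h4]
    exact_mod_cast h3
  rw [h1]
  have h5 : ∑ x : ZMod p, (ZMod.stdAddChar (α * x) : ℂ) = 0 := by
    have := AddChar.sum_mulShift α (ZMod.isPrimitive_stdAddChar p)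
    rw [if_neg hα] at this
    rw [Finset.sum_congr rfl fun x _ => by rw [mul_comm α x]]
    simpa using this
  rw [Finset.sum_congr rfl fun x _ => add_mul _ _ _, Finset.sum_add_distrib]
  simp only [one_mul, h5, add_zero]

lemma gs_prime (p : ℕ) [Fact p.Prime] (hp : p ≠ 2) (α β : ℤ) (hα : (α : ZMod p) ≠ 0)
    (hβ : (β : ZMod p) ≠ 0) :
    gs p ((β * α : ℤ) : ZMod p) 0 = jacobiSym β p * gs p (α : ZMod p) 0 := by
  have hβα : ((β * α : ℤ) : ZMod p) ≠ 0 := by push_cast; exact mul_ne_zero hβ hα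
  rw [gs_prime_char p hp _ hβα, gs_prime_char p hp _ hα, Finset.mul_sum]
  refine Fintype.sum_equiv (Equiv.mulLeft₀ (β : ZMod p) hβ) _ _ ?_
  intro x
  rw [← jacobiSym.legendreSym.to_jacobiSym, legendreSym, Equiv.mulLeft₀_apply, map_mul (quadraticChar (ZMod p)),
    ← mul_assoc]
  have h1 := quadraticChar_sq_one hβ
  have h2 : ((quadraticChar (ZMod p) (β : ZMod p) : ℤ) : ℂ) ^ 2 = 1 := by exact_mod_cast h1
  congr 1
  · push_cast
    linear_combination (-((quadraticChar (ZMod p) x : ℤ) : ℂ)) * h2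
  · congr 1; push_cast; ring

lemma not_dvd_of_gcd (p : ℕ) (hp : p.Prime) (a : ℤ) (ha : Int.gcd a p = 1) : ¬ (p : ℤ) ∣ a := by
  intro h
  have h1 : (p : ℤ) ∣ (Int.gcd a p : ℕ) := Int.dvd_coe_gcd h (dvd_refl _)
  rw [ha] at h1
  have h2 : p ∣ 1 := by exact_mod_cast h1
  exact hp.one_lt.ne' (Nat.dvd_one.1 h2)

lemma gs_jacobi (q : ℕ) : ∀ [NeZero q], Odd q → ∀ α β : ℤ, Int.gcd α q = 1 → Int.gcd β q = 1 →
    gs q ((β * α : ℤ) : ZMod q) 0 = jacobiSym β q * gs q (α : ZMod q) 0 := by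
  induction q using Nat.strong_induction_on with
  | _ q ih =>
    intro hne hodd α β hα hβ
    by_cases h1 : q = 1
    · subst h1
      rw [jacobiSym.one_right, Int.cast_one, one_mul]
      congr 1
      exact Subsingleton.elim _ _
    obtain ⟨p, hpp, hpq⟩ := Nat.exists_prime_and_dvd h1
    haveI : Fact p.Prime := ⟨hpp⟩
    have hp2 : p ≠ 2 := by
      rintro rfl
      exact (Nat.not_even_iff_odd.2 hodd) (even_iff_two_dvd.2 hpq)
    have hdvd : ∀ (a : ℤ) (r : ℕ), Int.gcd a q = 1 → r ∣ q → Int.gcd a r = 1 := by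
      intro a r ha hr
      have : Int.gcd a r ∣ Int.gcd a q :=
        Int.gcd_dvd_gcd_of_dvd_right _ (by exact_mod_cast hr)
      rw [ha] at this
      exact Nat.dvd_one.1 this
    have hnz : ∀ (a : ℤ), Int.gcd a q = 1 → ¬ (p : ℤ) ∣ a := by
      intro a ha
      exact not_dvd_of_gcd p hpp a (hdvd a p ha hpq)
    obtain ⟨m, rfl⟩ := hpq
    have hm0 : m ≠ 0 := by rintro rfl; exact hne.out (mul_zero p)
    haveI : NeZero m := ⟨hm0⟩
    by_cases h2 : p ∣ m
    · obtain ⟨n, rfl⟩ := h2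
      have hn0 : n ≠ 0 := by rintro rfl; simp at hm0
      haveI : NeZero n := ⟨hn0⟩
      have hβα : ¬ (p : ℤ) ∣ β * α := by
        intro h
        rcases (Nat.prime_iff_prime_int.1 hpp).dvd_or_dvd h with h | h
        · exact hnz β hβ h
        · exact hnz α hα h
      rw [gs_prime_sq p n hp2 _ hβα, gs_prime_sq p n hp2 _ (hnz α hα)]
      have hnd : n ∣ p * (p * n) := ⟨p * p, by ring⟩
      have hlt : n < p * (p * n) := by
        have := hpp.two_le
        have : 0 < n := Nat.pos_of_ne_zero hn0
        nlinarith [Nat.mul_le_mul hpp.two_le hpp.two_le]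
      rw [ih n hlt (Odd.of_dvd_nat hodd hnd) α β (hdvd α n hα hnd) (hdvd β n hβ hnd)]
      rw [jacobiSym.mul_right, jacobiSym.mul_right, ← mul_assoc (jacobiSym β p), ← pow_two,
        jacobiSym.sq_one (hdvd β p hβ ⟨p * n, rfl⟩), one_mul]
      ring
    · have hcop : Nat.Coprime p m := (Nat.Prime.coprime_iff_not_dvd hpp).2 h2
      have hbz : IsCoprime (m : ℤ) (p : ℤ) := (Nat.isCoprime_iff_coprime.2 hcop).symm
      obtain ⟨u, v, huv⟩ := hbz
      rw [gs_crt p m hcop u v huv, gs_crt p m hcop u v huv]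
      simp only [map_intCast, Prod.fst_intCast, Prod.snd_intCast, map_zero, Prod.fst_zero,
        Prod.snd_zero, mul_zero]
      have hup : Int.gcd u p = 1 := by
        rw [← Int.isCoprime_iff_gcd_eq_one]; exact ⟨m, v, by linear_combination huv⟩
      have hvm : Int.gcd v m = 1 := by
        rw [← Int.isCoprime_iff_gcd_eq_one]; exact ⟨p, u, by linear_combination huv⟩
      have z : ∀ a : ℤ, Int.gcd a p = 1 → (a : ZMod p) ≠ 0 := by
        intro a ha h
        rw [ZMod.intCast_zmod_eq_zero_iff_dvd] at h
        exact not_dvd_of_gcd p hpp a ha h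
      have c1 : (u : ZMod p) * ((β * α : ℤ) : ZMod p) = ((β * (u * α) : ℤ) : ZMod p) := by
        push_cast; ring
      have c2 : (v : ZMod m) * ((β * α : ℤ) : ZMod m) = ((β * (v * α) : ℤ) : ZMod m) := by
        push_cast; ring
      have c3 : (u : ZMod p) * (α : ZMod p) = ((u * α : ℤ) : ZMod p) := by push_cast; ring
      have c4 : (v : ZMod m) * (α : ZMod m) = ((v * α : ℤ) : ZMod m) := by push_cast; ring
      rw [c1, c2, c3, c4]
      have hmd : m ∣ p * m := Dvd.intro_left p rfl
      have hpd : p ∣ p * m := Dvd.intro m rfl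
      rw [gs_prime p hp2 _ _ (by rw [← c3]; exact mul_ne_zero (z u hup) (z α (hdvd α p hα hpd)))
        (z β (hdvd β p hβ hpd)),
        ih m (by have := hpp.two_le; have := Nat.pos_of_ne_zero hm0; nlinarith)
          (Odd.of_dvd_nat hodd hmd) (v * α) β ?_ (hdvd β m hβ hmd), jacobiSym.mul_right]
      · push_cast; ring
      · rw [← Int.isCoprime_iff_gcd_eq_one]
        exact IsCoprime.mul_left (Int.isCoprime_iff_gcd_eq_one.2 hvm)
          (Int.isCoprime_iff_gcd_eq_one.2 (hdvd α m hα hmd))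

lemma gs_one_fourth (q : ℕ) [NeZero q] (hodd : Odd q) : gs q 1 0 ^ 4 = (q : ℂ) ^ 2 := by
  have h1 := gs_jacobi q hodd 1 (-1) (by simp) (by simp)
  have h2 : gs q (-1) 0 = (jacobiSym (-1) q : ℂ) * gs q 1 0 := by simpa using h1
  have h3 := gs_sq q 1 0
  rw [gs_conj, neg_zero, h2] at h3
  have hu : IsUnit (2 : ZMod q) := by
    have : IsUnit ((2 : ℕ) : ZMod q) :=
      (ZMod.isUnit_iff_coprime 2 q).2 (Nat.coprime_two_left.2 hodd)
    simpa using this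
  have h4 : ∀ h : ZMod q, (2 * 1 * h = 0 ↔ h = 0) := by
    intro h; rw [mul_one]; exact hu.mul_right_eq_zero
  have h5 : ∑ h : ZMod q, (if 2 * 1 * h = 0 then (ZMod.stdAddChar (1 * h ^ 2 + 0 * h) : ℂ) else 0)
      = 1 := by
    simp only [h4]
    rw [Finset.sum_ite_eq' Finset.univ (0 : ZMod q)
      (fun h => (ZMod.stdAddChar (1 * h ^ 2 + 0 * h) : ℂ))]
    simp
  rw [h5, mul_one] at h3
  have h6 : (jacobiSym (-1) q : ℂ) ^ 2 = 1 := by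
    have := jacobiSym.sq_one (a := -1) (b := q) (by simp)
    exact_mod_cast this
  calc gs q 1 0 ^ 4 = (jacobiSym (-1) q : ℂ) ^ 2 * gs q 1 0 ^ 4 := by rw [h6, one_mul]
    _ = ((jacobiSym (-1) q : ℂ) * gs q 1 0 * gs q 1 0) ^ 2 := by ring
    _ = _ := by rw [h3]

lemma gs_complete (q : ℕ) [NeZero q] (α α' t β : ZMod q) (hα : α' * α = 1) (ht : 2 * t = 1) :
    gs q α β = ZMod.stdAddChar (-(t ^ 2 * α' * β ^ 2)) * gs q α 0 := by
  unfold gs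
  rw [Finset.mul_sum]
  refine Fintype.sum_equiv (Equiv.addRight (t * α' * β)) _ _ ?_
  intro x
  rw [← AddChar.map_add_eq_mul]
  congr 1
  simp only [Equiv.coe_addRight]
  linear_combination (-β * x - t ^ 2 * α' * β ^ 2 + β * x * (1 - 2 * t)) * hα - β * x * ht


/-- The complete exponential sum written with Gauss sums. -/
noncomputable def SZ (q : ℕ) [NeZero q] (a c : Fin 4 → ℤ) : ℂ :=
  ∑ k : (ZMod q)ˣ, ∏ i, gs q ((k : ZMod q) * (a i : ZMod q)) (c i : ZMod q)

lemma SZ_scale (q : ℕ) [NeZero q] (a c : Fin 4 → ℤ) (u : (ZMod q)ˣ) :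
    ∑ k : (ZMod q)ˣ, ∏ i, gs q ((u : ZMod q) * ((k : ZMod q) * (a i : ZMod q)))
      ((u : ZMod q) * (c i : ZMod q)) = SZ q a c := by
  unfold SZ
  refine Fintype.sum_equiv (Equiv.mulLeft u⁻¹) _ _ ?_
  intro k
  refine Finset.prod_congr rfl fun i _ => ?_
  rw [gs_scale]
  simp only [Equiv.coe_mulLeft, Units.val_mul]
  rw [mul_assoc]

lemma SZ_mul (m n : ℕ) [NeZero m] [NeZero n] [NeZero (m * n)] (h : m.Coprime n)
    (a c : Fin 4 → ℤ) : SZ (m * n) a c = SZ m a c * SZ n a c := by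
  obtain ⟨u, v, huv⟩ : IsCoprime (n : ℤ) (m : ℤ) := (Nat.isCoprime_iff_coprime.2 h).symm
  have hu : (u : ZMod m) * (n : ZMod m) = 1 := by
    have : ((u * n + v * m : ℤ) : ZMod m) = 1 := by rw [huv]; simp
    simpa using this
  have hv : (v : ZMod n) * (m : ZMod n) = 1 := by
    have : ((u * n + v * m : ℤ) : ZMod n) = 1 := by rw [huv]; simp
    simpa using this
  let U : (ZMod m)ˣ := ⟨u, n, hu, by rw [mul_comm]; exact hu⟩
  let V : (ZMod n)ˣ := ⟨v, m, hv, by rw [mul_comm]; exact hv⟩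
  rw [← SZ_scale m a c U, ← SZ_scale n a c V, Finset.sum_mul_sum, ← Fintype.sum_prod_type']
  unfold SZ
  refine Fintype.sum_equiv
    ((Units.mapEquiv (ZMod.chineseRemainder h).toMulEquiv).trans MulEquiv.prodUnits).toEquiv _ _ ?_
  intro k
  rw [← Finset.prod_mul_distrib]
  refine Finset.prod_congr rfl fun i _ => ?_
  rw [gs_crt m n h u v huv]
  have e : ∀ z : ℤ, ZMod.chineseRemainder h (z : ZMod (m * n)) = ((z : ZMod m), (z : ZMod n)) := by
    intro z; rw [map_intCast (ZMod.chineseRemainder h)]; rfl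
  rw [map_mul (ZMod.chineseRemainder h), e, e]
  rfl

lemma SZ_vanish (q : ℕ) [NeZero q] (a c : Fin 4 → ℤ) (i : Fin 4)
    (h : ¬ ((Int.gcd (a i) q : ℕ) : ℤ) ∣ c i) : SZ q a c = 0 := by
  unfold SZ
  refine Finset.sum_eq_zero fun k _ => ?_
  exact Finset.prod_eq_zero (Finset.mem_univ i) (gs_vanish q _ _ _ h)

lemma SZ_bound (q : ℕ) [NeZero q] (a c : Fin 4 → ℤ) :
    ‖SZ q a c‖ ≤ 4 * (q : ℝ) ^ 3 * ∏ i, Real.sqrt (Int.gcd (a i) q : ℕ) := by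
  have hq0 : (0 : ℝ) ≤ q := Nat.cast_nonneg q
  have h1 : ∀ k : (ZMod q)ˣ, ‖∏ i, gs q ((k : ZMod q) * (a i : ZMod q)) (c i : ZMod q)‖ ≤
      4 * (q : ℝ) ^ 2 * ∏ i, Real.sqrt (Int.gcd (a i) q : ℕ) := by
    intro k
    rw [norm_prod]
    have h2 : ∀ i ∈ (Finset.univ : Finset (Fin 4)),
        ‖gs q ((k : ZMod q) * (a i : ZMod q)) (c i : ZMod q)‖ ≤
        Real.sqrt (2 * q) * Real.sqrt (Int.gcd (a i) q : ℕ) := by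
      intro i _
      rw [← Real.sqrt_mul (by positivity)]
      refine Real.le_sqrt_of_sq_le ?_
      refine (gs_norm_sq_le q _ k.isUnit _ _).trans (le_of_eq (by ring))
    refine (Finset.prod_le_prod (fun _ _ => norm_nonneg _) h2).trans ?_
    rw [Finset.prod_mul_distrib, Finset.prod_const, Finset.card_univ, Fintype.card_fin]
    refine mul_le_mul_of_nonneg_right ?_ (Finset.prod_nonneg fun _ _ => Real.sqrt_nonneg _)
    have : Real.sqrt (2 * q) ^ 4 = (Real.sqrt (2 * q) ^ 2) ^ 2 := by ring
    rw [this, Real.sq_sqrt (by positivity)]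
    exact le_of_eq (by ring)
  unfold SZ
  refine (norm_sum_le _ _).trans ((Finset.sum_le_sum fun k _ => h1 k).trans ?_)
  rw [Finset.sum_const, nsmul_eq_mul, Finset.card_univ, ZMod.card_units_eq_totient]
  have h3 : (Nat.totient q : ℝ) ≤ q := by exact_mod_cast Nat.totient_le q
  calc _ ≤ (q : ℝ) * (4 * (q : ℝ) ^ 2 * ∏ i, Real.sqrt (Int.gcd (a i) q : ℕ)) := by
        refine mul_le_mul_of_nonneg_right h3 ?_
        exact mul_nonneg (by positivity) (Finset.prod_nonneg fun _ _ => Real.sqrt_nonneg _)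
    _ = _ := by ring

lemma SZ_good (q : ℕ) [NeZero q] (hodd : Odd q) (a c : Fin 4 → ℤ)
    (hcop : Int.gcd (∏ i, a i) q = 1)
    (hdual : ∑ i, (∏ j ∈ Finset.univ.erase i, a j) * c i ^ 2 = 0) :
    SZ q a c = (q : ℂ) ^ 2 * Nat.totient q * jacobiSym (∏ i, a i) q := by
  have hu2 : Nat.Coprime 2 q := Nat.coprime_two_left.2 hodd
  obtain ⟨t, ht⟩ : ∃ t : ZMod q, 2 * t = 1 := by
    refine ⟨((2 : ℕ) : ZMod q)⁻¹, ?_⟩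
    have := ZMod.coe_mul_inv_eq_one 2 hu2
    simpa using this
  have hai : ∀ i, Int.gcd (a i) q = 1 := by
    intro i
    have h1 : Int.gcd (a i) q ∣ Int.gcd (∏ i, a i) q :=
      Int.gcd_dvd_gcd_of_dvd_left _ (Finset.dvd_prod_of_mem a (Finset.mem_univ i))
    rw [hcop] at h1
    exact Nat.dvd_one.1 h1
  have hinv : ∀ i, ∃ b : ZMod q, b * (a i : ZMod q) = 1 := by
    intro i
    obtain ⟨s, r, hsr⟩ := Int.isCoprime_iff_gcd_eq_one.2 (hai i)
    refine ⟨s, ?_⟩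
    have : ((s * a i + r * q : ℤ) : ZMod q) = 1 := by rw [hsr]; simp
    simpa using this
  choose b hb using hinv
  have hzero : ∑ i, b i * (c i : ZMod q) ^ 2 = 0 := by
    have h1 : ((∑ i, (∏ j ∈ Finset.univ.erase i, a j) * c i ^ 2 : ℤ) : ZMod q) = 0 := by
      rw [hdual]; simp
    have h2 : ∑ i, b i * (c i : ZMod q) ^ 2 = (∏ i, b i) *
        ((∑ i, (∏ j ∈ Finset.univ.erase i, a j) * c i ^ 2 : ℤ) : ZMod q) := by
      push_cast
      rw [Finset.mul_sum]
      refine Finset.sum_congr rfl fun i _ => ?_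
      rw [← Finset.mul_prod_erase Finset.univ b (Finset.mem_univ i)]
      have h3 : (∏ j ∈ Finset.univ.erase i, b j) * (∏ j ∈ Finset.univ.erase i, (a j : ZMod q)) = 1 := by
        rw [← Finset.prod_mul_distrib]
        exact Finset.prod_eq_one fun j _ => hb j
      linear_combination (-(b i * (c i : ZMod q) ^ 2)) * h3
    rw [h2, h1, mul_zero]
  have key : ∀ k : (ZMod q)ˣ, ∏ i, gs q ((k : ZMod q) * (a i : ZMod q)) (c i : ZMod q) =
      (q : ℂ) ^ 2 * jacobiSym (∏ i, a i) q := by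
    intro k
    have hk : ((k⁻¹ : (ZMod q)ˣ) : ZMod q) * k = 1 := Units.inv_mul k
    have e1 : ∀ i, gs q ((k : ZMod q) * (a i : ZMod q)) (c i : ZMod q) =
        ZMod.stdAddChar (-(t ^ 2 * (((k⁻¹ : (ZMod q)ˣ) : ZMod q) * b i) * (c i : ZMod q) ^ 2)) *
          gs q ((k : ZMod q) * (a i : ZMod q)) 0 := by
      intro i
      refine gs_complete q _ _ t _ ?_ ht
      linear_combination (b i * (a i : ZMod q)) * hk + hb i
    rw [Finset.prod_congr rfl fun i _ => e1 i, Finset.prod_mul_distrib]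
    have e2 : ∏ i, (ZMod.stdAddChar
        (-(t ^ 2 * (((k⁻¹ : (ZMod q)ˣ) : ZMod q) * b i) * (c i : ZMod q) ^ 2)) : ℂ) = 1 := by
      rw [show ∀ f : Fin 4 → ZMod q, ∏ i, (ZMod.stdAddChar (f i) : ℂ) = ZMod.stdAddChar (∑ i, f i) by
        intro f; simp only [Fin.prod_univ_four, Fin.sum_univ_four, AddChar.map_add_eq_mul]]
      have : ∑ i, (-(t ^ 2 * (((k⁻¹ : (ZMod q)ˣ) : ZMod q) * b i) * (c i : ZMod q) ^ 2)) =
          -(t ^ 2 * ((k⁻¹ : (ZMod q)ˣ) : ZMod q)) * ∑ i, b i * (c i : ZMod q) ^ 2 := by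
        rw [Finset.mul_sum]
        exact Finset.sum_congr rfl fun i _ => by ring
      rw [this, hzero, mul_zero, AddChar.map_zero_eq_one]
    rw [e2, one_mul]
    obtain ⟨κ, hκ⟩ : ∃ κ : ℤ, (κ : ZMod q) = k := ZMod.intCast_surjective _
    have hκg : Int.gcd κ q = 1 := by
      have := ZMod.isUnit_iff_coprime (κ.natAbs) q
      have h2 : IsUnit ((κ : ℤ) : ZMod q) := by rw [hκ]; exact k.isUnit
      have h3 : IsUnit ((κ.natAbs : ℕ) : ZMod q) := by
        rcases Int.natAbs_eq κ with h | h
        · rw [h] at h2; simpa using h2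
        · rw [h] at h2; simpa using h2
      have h4 := this.1 h3
      rw [Int.gcd, Int.natAbs_natCast]; exact h4
    have e3 : ∀ i, gs q ((k : ZMod q) * (a i : ZMod q)) 0 =
        (jacobiSym (a i) q : ℂ) * ((jacobiSym κ q : ℂ) * gs q 1 0) := by
      intro i
      have h1 := gs_jacobi q hodd κ (a i) hκg (hai i)
      have h2 := gs_jacobi q hodd 1 κ (by simp) hκg
      rw [← hκ]
      have h3 : (κ : ZMod q) * (a i : ZMod q) = ((a i * κ : ℤ) : ZMod q) := by push_cast; ring
      rw [h3, h1]
      rw [mul_one] at h2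
      rw [h2, Int.cast_one]
    rw [Finset.prod_congr rfl fun i _ => e3 i, Finset.prod_mul_distrib, Finset.prod_const,
      Finset.card_univ, Fintype.card_fin, mul_pow, gs_one_fourth q hodd]
    have h6 : (jacobiSym κ q : ℂ) ^ 2 = 1 := by
      have := jacobiSym.sq_one hκg
      exact_mod_cast this
    have h7 : (jacobiSym κ q : ℂ) ^ 4 = 1 := by
      rw [show (4 : ℕ) = 2 * 2 by norm_num, pow_mul, h6, one_pow]
    have h8 : (∏ i, (jacobiSym (a i) q : ℂ)) = (jacobiSym (∏ i, a i) q : ℂ) := by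
      simp only [Fin.prod_univ_four, jacobiSym.mul_left]
      push_cast; ring
    rw [h7, h8]; ring
  unfold SZ
  rw [Finset.sum_congr rfl fun k _ => key k, Finset.sum_const, Finset.card_univ,
    ZMod.card_units_eq_totient, nsmul_eq_mul]
  ring

theorem eC_int (q : ℕ) [NeZero q] (n : ℤ) : eC ((n : ℝ) / (q : ℝ)) = ZMod.stdAddChar (n : ZMod q) := by
  rw [std_int, eC]
  congr 1
  push_cast
  ring

theorem Sqa_eq_SZ (a c : Fin 4 → ℤ) (q : ℕ) [NeZero q] : Sqa a c q = SZ q a c := by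
  unfold Sqa SZ
  refine Finset.sum_bij (fun k hk => ZMod.unitOfCoprime k (Finset.mem_filter.1 hk).2) ?_ ?_ ?_ ?_
  · intro k hk; exact Finset.mem_univ _
  · intro k hk l hl h
    have h1 : ((k : ℕ) : ZMod q) = l := by
      have := congrArg (fun u : (ZMod q)ˣ => (u : ZMod q)) h
      simpa using this
    rw [ZMod.natCast_eq_natCast_iff'] at h1
    have hk1 := Finset.mem_range.1 (Finset.mem_filter.1 hk).1
    have hl1 := Finset.mem_range.1 (Finset.mem_filter.1 hl).1
    rwa [Nat.mod_eq_of_lt hk1, Nat.mod_eq_of_lt hl1] at h1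
  · intro u _
    refine ⟨(u : ZMod q).val, ?_, ?_⟩
    · rw [Finset.mem_filter, Finset.mem_range]
      exact ⟨ZMod.val_lt _, ZMod.val_coe_unit_coprime u⟩
    · ext
      simp
  · intro k hk
    have e1 : ∀ i, gs q (((ZMod.unitOfCoprime k (Finset.mem_filter.1 hk).2 : (ZMod q)ˣ) : ZMod q) *
        (a i : ZMod q)) (c i : ZMod q) = ∑ b ∈ Finset.range q,
          (ZMod.stdAddChar (((k : ZMod q) * (a i : ZMod q)) * (b : ZMod q) ^ 2 +
            (c i : ZMod q) * (b : ZMod q)) : ℂ) := by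
      intro i
      rw [gs, sum_zmod_range]
      rfl
    rw [Finset.prod_congr rfl fun i _ => e1 i, Finset.prod_univ_sum]
    refine Finset.sum_congr rfl fun b _ => ?_
    rw [eC_int]
    rw [show ∀ f : Fin 4 → ZMod q, ∏ i, (ZMod.stdAddChar (f i) : ℂ) = ZMod.stdAddChar (∑ i, f i) by
        intro f; simp only [Fin.prod_univ_four, Fin.sum_univ_four, AddChar.map_add_eq_mul]]
    congr 1
    simp only [Fin.sum_univ_four]
    push_cast
    ring

theorem delta_val (e0 e1 e2 e3 q : ℕ) (h0 : e0 ∣ q) (h1 : e1 ∣ q) (h2 : e2 ∣ q) (h3 : e3 ∣ q)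
    (hq : q ≠ 0) :
    (e0 * e1 * e2 * e3) ^ 4 ∣ q ^ 4 * (Nat.gcd e0 (e1 * e2 * e3) * Nat.gcd e1 (e0 * e2 * e3) *
      Nat.gcd e2 (e0 * e1 * e3) * Nat.gcd e3 (e0 * e1 * e2)) ^ 3 := by
  have n0 : e0 ≠ 0 := fun h => hq (by rw [h] at h0; exact zero_dvd_iff.1 h0)
  have n1 : e1 ≠ 0 := fun h => hq (by rw [h] at h1; exact zero_dvd_iff.1 h1)
  have n2 : e2 ≠ 0 := fun h => hq (by rw [h] at h2; exact zero_dvd_iff.1 h2)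
  have n3 : e3 ≠ 0 := fun h => hq (by rw [h] at h3; exact zero_dvd_iff.1 h3)
  have g0 : Nat.gcd e0 (e1 * e2 * e3) ≠ 0 := Nat.gcd_ne_zero_left n0
  have g1 : Nat.gcd e1 (e0 * e2 * e3) ≠ 0 := Nat.gcd_ne_zero_left n1
  have g2 : Nat.gcd e2 (e0 * e1 * e3) ≠ 0 := Nat.gcd_ne_zero_left n2
  have g3 : Nat.gcd e3 (e0 * e1 * e2) ≠ 0 := Nat.gcd_ne_zero_left n3
  rw [← Nat.factorization_le_iff_dvd (by positivity) (by positivity)]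
  intro p
  have v0 := (Nat.factorization_le_iff_dvd n0 hq).2 h0 p
  have v1 := (Nat.factorization_le_iff_dvd n1 hq).2 h1 p
  have v2 := (Nat.factorization_le_iff_dvd n2 hq).2 h2 p
  have v3 := (Nat.factorization_le_iff_dvd n3 hq).2 h3 p
  have m2 : ∀ x y : ℕ, x ≠ 0 → y ≠ 0 → (x * y).factorization p =
      x.factorization p + y.factorization p := fun x y hx hy => by
    rw [Nat.factorization_mul hx hy]; rfl
  have mg : ∀ x y : ℕ, x ≠ 0 → y ≠ 0 → (Nat.gcd x y).factorization p =
      min (x.factorization p) (y.factorization p) := fun x y hx hy => by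
    rw [Nat.factorization_gcd hx hy]; rfl
  have mp : ∀ x n : ℕ, (x ^ n).factorization p = n * x.factorization p := fun x n => by
    rw [Nat.factorization_pow]; rfl
  rw [m2 _ _ (by positivity) (by positivity), mp, mp, mp, m2 _ _ (by positivity) n3,
    m2 _ _ (by positivity) n2, m2 _ _ n0 n1, m2 _ _ (by positivity) g3,
    m2 _ _ (by positivity) g2, m2 _ _ g0 g1, mg _ _ n0 (by positivity), mg _ _ n1 (by positivity),
    mg _ _ n2 (by positivity), mg _ _ n3 (by positivity), m2 (e1 * e2) _ (by positivity) n3,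
    m2 _ _ n1 n2, m2 (e0 * e2) _ (by positivity) n3, m2 _ _ n0 n2,
    m2 (e0 * e1) _ (by positivity) n3, m2 (e0 * e1) _ (by positivity) n2, m2 _ _ n0 n1]
  omega

theorem DeltaC_four (a c : Fin 4 → ℤ) : DeltaC a c =
    Nat.gcd (Int.gcd (a 0) (c 0)) (Int.gcd (a 1) (c 1) * Int.gcd (a 2) (c 2) * Int.gcd (a 3) (c 3)) *
    Nat.gcd (Int.gcd (a 1) (c 1)) (Int.gcd (a 0) (c 0) * Int.gcd (a 2) (c 2) * Int.gcd (a 3) (c 3)) *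
    Nat.gcd (Int.gcd (a 2) (c 2)) (Int.gcd (a 0) (c 0) * Int.gcd (a 1) (c 1) * Int.gcd (a 3) (c 3)) *
    Nat.gcd (Int.gcd (a 3) (c 3)) (Int.gcd (a 0) (c 0) * Int.gcd (a 1) (c 1) * Int.gcd (a 2) (c 2)) := by
  unfold DeltaC
  rw [Fin.prod_univ_four]
  have e0 : (Finset.univ.erase (0 : Fin 4)) = {1, 2, 3} := by decide
  have e1 : (Finset.univ.erase (1 : Fin 4)) = {0, 2, 3} := by decide
  have e2 : (Finset.univ.erase (2 : Fin 4)) = {0, 1, 3} := by decide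
  have e3 : (Finset.univ.erase (3 : Fin 4)) = {0, 1, 2} := by decide
  have hp : ∀ (f : Fin 4 → ℤ) (i j k : Fin 4), i ≠ j → i ≠ k → j ≠ k →
      ∏ l ∈ ({i, j, k} : Finset (Fin 4)), f l = f i * f j * f k := by
    intro f i j k h1 h2 h3
    rw [Finset.prod_insert (by simp [h1, h2]), Finset.prod_insert (by simp [h3]),
      Finset.prod_singleton, mul_assoc]
  have hg : ∀ x y z w : ℕ, Int.gcd (x : ℤ) ((y : ℤ) * z * w) = Nat.gcd x (y * z * w) := by
    intro x y z w
    rw [← Int.gcd_natCast_natCast]; push_cast; rfl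
  have d0 : ∏ l ∈ Finset.univ.erase (0 : Fin 4), (Int.gcd (a l) (c l) : ℤ) = _ :=
    (congrArg (fun s => ∏ l ∈ s, (Int.gcd (a l) (c l) : ℤ)) e0).trans
      (hp _ 1 2 3 (by decide) (by decide) (by decide))
  have d1 : ∏ l ∈ Finset.univ.erase (1 : Fin 4), (Int.gcd (a l) (c l) : ℤ) = _ :=
    (congrArg (fun s => ∏ l ∈ s, (Int.gcd (a l) (c l) : ℤ)) e1).trans
      (hp _ 0 2 3 (by decide) (by decide) (by decide))
  have d2 : ∏ l ∈ Finset.univ.erase (2 : Fin 4), (Int.gcd (a l) (c l) : ℤ) = _ :=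
    (congrArg (fun s => ∏ l ∈ s, (Int.gcd (a l) (c l) : ℤ)) e2).trans
      (hp _ 0 1 3 (by decide) (by decide) (by decide))
  have d3 : ∏ l ∈ Finset.univ.erase (3 : Fin 4), (Int.gcd (a l) (c l) : ℤ) = _ :=
    (congrArg (fun s => ∏ l ∈ s, (Int.gcd (a l) (c l) : ℤ)) e3).trans
      (hp _ 0 1 2 (by decide) (by decide) (by decide))
  rw [d0, d1, d2, d3, hg, hg, hg, hg]

theorem DeltaC_ne_zero (a c : Fin 4 → ℤ) (ha : ∀ i, a i ≠ 0) : DeltaC a c ≠ 0 := by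
  rw [DeltaC_four]
  have h : ∀ i, Int.gcd (a i) (c i) ≠ 0 := fun i h => ha i (Int.gcd_eq_zero_iff.1 h).1
  have g : ∀ i x, Nat.gcd (Int.gcd (a i) (c i)) x ≠ 0 := fun i x => Nat.gcd_ne_zero_left (h i)
  exact mul_ne_zero (mul_ne_zero (mul_ne_zero (g _ _) (g _ _)) (g _ _)) (g _ _)

theorem gcd_prod_bound (a c : Fin 4 → ℤ) (ha : ∀ i, a i ≠ 0) (q : ℕ) (hq : q ≠ 0)
    (hd : ∀ i, ((Int.gcd (a i) q : ℕ) : ℤ) ∣ c i) :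
    (∏ i, Int.gcd (a i) q) ^ 4 ≤ q ^ 4 * (DeltaC a c) ^ 3 := by
  have h1 : ∀ i, Int.gcd (a i) q ∣ q := fun i => by
    have := Int.gcd_dvd_right (a i) (q : ℤ)
    exact_mod_cast this
  have h2 : ∀ i, Int.gcd (a i) q ∣ Int.gcd (a i) (c i) := fun i =>
    Int.dvd_gcd (Int.gcd_dvd_left _ _) (hd i)
  have h3 := delta_val _ _ _ _ q (h1 0) (h1 1) (h1 2) (h1 3) hq
  have hD := DeltaC_ne_zero a c ha
  rw [Fin.prod_univ_four]
  refine Nat.le_of_dvd (by positivity) (h3.trans (mul_dvd_mul_left _ (pow_dvd_pow_of_dvd ?_ _)))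
  rw [DeltaC_four]
  refine mul_dvd_mul (mul_dvd_mul (mul_dvd_mul ?_ ?_) ?_) ?_ <;>
    exact Nat.dvd_gcd ((Nat.gcd_dvd_left _ _).trans (h2 _))
      ((Nat.gcd_dvd_right _ _).trans (mul_dvd_mul (mul_dvd_mul (h2 _) (h2 _)) (h2 _)))

theorem smooth_term (a c : Fin 4 → ℤ) (ha : ∀ i, a i ≠ 0) (q : ℕ) (hq : q ≠ 0) :
    ‖(1 / (q : ℂ) ^ 3) * Sqa a c q‖ ≤ 4 * Real.sqrt q * (DeltaC a c : ℝ) ^ ((3 : ℝ) / 8) := by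
  haveI : NeZero q := ⟨hq⟩
  rw [Sqa_eq_SZ]
  by_cases hd : ∀ i, ((Int.gcd (a i) q : ℕ) : ℤ) ∣ c i
  · have h1 := SZ_bound q a c
    have h2 := gcd_prod_bound a c ha q hq hd
    have hq0 : (0 : ℝ) < q := by exact_mod_cast Nat.pos_of_ne_zero hq
    have h3 : ∏ i, Real.sqrt (Int.gcd (a i) q : ℕ) ≤
        Real.sqrt q * (DeltaC a c : ℝ) ^ ((3 : ℝ) / 8) := by
      have hn : (0 : ℝ) ≤ ∏ i, Real.sqrt (Int.gcd (a i) q : ℕ) :=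
        Finset.prod_nonneg fun _ _ => Real.sqrt_nonneg _
      have hr : (0 : ℝ) ≤ Real.sqrt q * (DeltaC a c : ℝ) ^ ((3 : ℝ) / 8) := by positivity
      refine le_of_pow_le_pow_left₀ (n := 8) (by norm_num) hr ?_
      have e1 : (∏ i, Real.sqrt (Int.gcd (a i) q : ℕ)) ^ 8 =
          (((∏ i, Int.gcd (a i) q) ^ 4 : ℕ) : ℝ) := by
        rw [show (8 : ℕ) = 2 * 4 by norm_num, pow_mul, ← Finset.prod_pow]
        push_cast
        congr 1
        exact Finset.prod_congr rfl fun i _ => Real.sq_sqrt (Nat.cast_nonneg _)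
      have e2 : (Real.sqrt q * (DeltaC a c : ℝ) ^ ((3 : ℝ) / 8)) ^ 8 =
          ((q ^ 4 * (DeltaC a c) ^ 3 : ℕ) : ℝ) := by
        rw [mul_pow, ← Real.rpow_mul_natCast (Nat.cast_nonneg _)]
        rw [show (8 : ℕ) = 2 * 4 by norm_num, pow_mul, Real.sq_sqrt hq0.le]
        push_cast
        congr 1
        rw [← Real.rpow_natCast]; norm_num
      rw [e1, e2]
      exact_mod_cast h2
    rw [norm_mul, norm_div, norm_one, norm_pow, Complex.norm_natCast, one_div]
    calc ((q : ℝ) ^ 3)⁻¹ * ‖SZ q a c‖ ≤ ((q : ℝ) ^ 3)⁻¹ *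
          (4 * (q : ℝ) ^ 3 * (Real.sqrt q * (DeltaC a c : ℝ) ^ ((3 : ℝ) / 8))) :=
          mul_le_mul_of_nonneg_left (h1.trans (mul_le_mul_of_nonneg_left h3 (by positivity)))
            (by positivity)
      _ = _ := by field_simp
  · push Not at hd
    obtain ⟨i, hi⟩ := hd
    rw [SZ_vanish q a c i hi, mul_zero, norm_zero]
    positivity

theorem sum_smooth_split (P X : ℕ) (f : ℕ → ℂ)
    (hf : ∀ m n, m ≠ 0 → n ≠ 0 → Nat.Coprime m n → f (m * n) = f m * f n) :
    ∑ q ∈ Finset.Icc 1 X, f q = ∑ d ∈ smoothSet P X, f d *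
      ∑ e ∈ (Finset.Icc 1 (X / d)).filter (fun e => Nat.Coprime e P), f e := by
  have hcop : ∀ d e : ℕ, (∀ p, p.Prime → p ∣ d → p ∣ P) → Nat.Coprime e P → Nat.Coprime d e := by
    intro d e hd he
    refine Nat.coprime_of_dvd fun p hp h1 h2 => ?_
    have := Nat.dvd_gcd h2 (hd p hp h1)
    rw [he] at this
    exact hp.one_lt.ne' (Nat.dvd_one.1 this)
  simp only [Finset.mul_sum]
  rw [Finset.sum_sigma']
  symm
  refine Finset.sum_bij (fun z _ => z.1 * z.2) ?_ ?_ ?_ ?_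
  · rintro ⟨d, e⟩ h
    simp only [smoothSet, Finset.mem_sigma, Finset.mem_filter, Finset.mem_Icc] at h ⊢
    obtain ⟨⟨⟨h1, h2⟩, h3⟩, ⟨h4, h5⟩, h6⟩ := h
    refine ⟨Nat.mul_pos h1 h4, ?_⟩
    rw [mul_comm]
    exact (Nat.le_div_iff_mul_le h1).1 h5
  · rintro ⟨d, e⟩ h ⟨d', e'⟩ h' heq
    simp only [smoothSet, Finset.mem_sigma, Finset.mem_filter, Finset.mem_Icc] at h h' heq
    obtain ⟨⟨⟨h1, h2⟩, h3⟩, ⟨h4, h5⟩, h6⟩ := h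
    obtain ⟨⟨⟨h1', h2'⟩, h3'⟩, ⟨h4', h5'⟩, h6'⟩ := h'
    have a1 : d ∣ d' := (hcop d e' h3 h6').dvd_of_dvd_mul_right (heq ▸ Dvd.intro _ rfl)
    have a2 : d' ∣ d := (hcop d' e h3' h6).dvd_of_dvd_mul_right (heq ▸ Dvd.intro _ rfl)
    have a3 : d = d' := Nat.dvd_antisymm a1 a2
    subst a3
    have a4 : e = e' := Nat.eq_of_mul_eq_mul_left h1 heq
    subst a4
    rfl
  · intro n hn
    rw [Finset.mem_Icc] at hn
    obtain ⟨d, e, hde, hd, he⟩ := exists_smooth_decomp P n (by omega)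
    have hd0 : 0 < d := Nat.pos_of_ne_zero fun h => by rw [h, zero_mul] at hde; omega
    have he0 : 0 < e := Nat.pos_of_ne_zero fun h => by rw [h, mul_zero] at hde; omega
    refine ⟨⟨d, e⟩, ?_, hde.symm⟩
    simp only [smoothSet, Finset.mem_sigma, Finset.mem_filter, Finset.mem_Icc]
    refine ⟨⟨⟨hd0, ?_⟩, hd⟩, ⟨he0, ?_⟩, he⟩
    · exact (Nat.le_mul_of_pos_right d he0).trans (hde ▸ hn.2)
    · rw [Nat.le_div_iff_mul_le hd0, mul_comm]; exact hde ▸ hn.2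
  · rintro ⟨d, e⟩ h
    simp only [smoothSet, Finset.mem_sigma, Finset.mem_filter, Finset.mem_Icc] at h
    obtain ⟨⟨⟨h1, h2⟩, h3⟩, ⟨h4, h5⟩, h6⟩ := h
    exact (hf d e (by omega) (by omega) (hcop d e h3 h6)).symm

theorem good_sum (a c : Fin 4 → ℤ) (hdual : dualForm a c = 0) (y : ℕ) :
    ∑ e ∈ (Finset.Icc 1 y).filter (fun e => Nat.Coprime e (2 * (∏ i, a i).natAbs)),
      (1 / (e : ℂ) ^ 3) * Sqa a c e =
    ((∑ n ∈ Finset.Icc 1 y, (jo (∏ i, a i) n : ℝ) * ((Nat.totient n : ℝ) / n) : ℝ) : ℂ) := by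
  rw [Finset.sum_filter]
  push_cast
  refine Finset.sum_congr rfl fun n hn => ?_
  have hn1 := (Finset.mem_Icc.1 hn).1
  haveI : NeZero n := ⟨by omega⟩
  have hn0 : (n : ℂ) ≠ 0 := by exact_mod_cast (NeZero.ne n)
  by_cases h : Nat.Coprime n (2 * (∏ i, a i).natAbs)
  · rw [if_pos h]
    have h2 : Nat.Coprime n 2 := Nat.Coprime.coprime_mul_right_right h
    have h3 : Nat.Coprime n (∏ i, a i).natAbs := Nat.Coprime.coprime_mul_left_right h
    have hodd : Odd n := Nat.coprime_two_right.1 h2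
    have hg : Int.gcd (∏ i, a i) n = 1 := by
      rw [Int.gcd, Int.natAbs_natCast]; exact h3.symm
    rw [Sqa_eq_SZ, SZ_good n hodd a c hg hdual, jo, if_pos (Nat.odd_iff.1 hodd)]
    field_simp
  · rw [if_neg h]
    have : jo (∏ i, a i) n = 0 := by
      unfold jo
      split_ifs with h1
      · rw [jacobiSym.eq_zero_iff_not_coprime]
        intro hg
        apply h
        have h2 : Nat.Coprime n 2 := Nat.coprime_two_right.2 (Nat.odd_iff.2 h1)
        refine Nat.Coprime.mul_right h2 ?_
        rw [Int.gcd, Int.natAbs_natCast] at hg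
        exact Nat.Coprime.symm hg
      · rfl
    rw [this]; simp

/-- Lemma 4.6: the bound for `Σ(x; c)` when `F*_a(c) = 0`. -/
theorem statement_8 (ε : ℝ) (hε : 0 < ε) :
    ∃ C : ℝ, 0 < C ∧
      ∀ (a c : Fin 4 → ℤ) (x : ℝ),
        (∀ i, a i ≠ 0) → ¬ IsSquare (∏ i, a i) → dualForm a c = 0 → 1 ≤ x →
        ‖∑ q ∈ Finset.Icc 1 ⌊x⌋₊, (1 / (q : ℂ) ^ 3) * Sqa a c q‖ ≤
          C * (((∏ i, a i).natAbs : ℝ)) ^ ((3 : ℝ) / 16 + ε) *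
            (DeltaC a c : ℝ) ^ ((3 : ℝ) / 8) * x ^ ((1 : ℝ) / 2 + ε) := by
  obtain ⟨K, hK1, hK⟩ := I_bound (ε / 2) (by linarith)
  obtain ⟨S, hS1, hS⟩ := smooth_bound (ε / 2) (by linarith)
  refine ⟨S * (2 : ℝ) ^ (ε / 2) * (4 * K), by positivity, ?_⟩
  intro a c x ha hsq hdual hx
  have hx0 : (0 : ℝ) < x := by linarith
  have hA0 : (∏ i, a i) ≠ 0 := Finset.prod_ne_zero_iff.2 fun i _ => ha i
  have hAn : (∏ i, a i).natAbs ≠ 0 := Int.natAbs_ne_zero.2 hA0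
  have hP : 2 * (∏ i, a i).natAbs ≠ 0 := by omega
  have hXx : ((⌊x⌋₊ : ℕ) : ℝ) ≤ x := Nat.floor_le hx0.le
  have hmul : ∀ m n : ℕ, m ≠ 0 → n ≠ 0 → Nat.Coprime m n →
      (1 / ((m * n : ℕ) : ℂ) ^ 3) * Sqa a c (m * n) =
        ((1 / (m : ℂ) ^ 3) * Sqa a c m) * ((1 / (n : ℂ) ^ 3) * Sqa a c n) := by
    intro m n hm hn hc
    haveI : NeZero m := ⟨hm⟩
    haveI : NeZero n := ⟨hn⟩
    haveI : NeZero (m * n) := ⟨mul_ne_zero hm hn⟩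
    rw [Sqa_eq_SZ, Sqa_eq_SZ, Sqa_eq_SZ, SZ_mul m n hc]
    have hm0 : (m : ℂ) ≠ 0 := by exact_mod_cast hm
    have hn0 : (n : ℂ) ≠ 0 := by exact_mod_cast hn
    push_cast
    field_simp
  rw [sum_smooth_split (2 * (∏ i, a i).natAbs) ⌊x⌋₊ (fun q => (1 / (q : ℂ) ^ 3) * Sqa a c q) hmul]
  have hA : (0 : ℝ) < ((∏ i, a i).natAbs : ℝ) := by exact_mod_cast Nat.pos_of_ne_zero hAn
  have hD : (0 : ℝ) ≤ (DeltaC a c : ℝ) ^ ((3 : ℝ) / 8) := by positivity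
  have hcard := hS (2 * (∏ i, a i).natAbs) ⌊x⌋₊ hP
  have key : ∀ d ∈ smoothSet (2 * (∏ i, a i).natAbs) ⌊x⌋₊,
      ‖(1 / (d : ℂ) ^ 3) * Sqa a c d * ∑ e ∈ (Finset.Icc 1 (⌊x⌋₊ / d)).filter
        (fun e => Nat.Coprime e (2 * (∏ i, a i).natAbs)), (1 / (e : ℂ) ^ 3) * Sqa a c e‖ ≤
      4 * K * ((∏ i, a i).natAbs : ℝ) ^ ((3 : ℝ) / 16 + ε / 2) *
        (DeltaC a c : ℝ) ^ ((3 : ℝ) / 8) * x ^ ((1 : ℝ) / 2 + ε / 2) := by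
    intro d hd
    have hd1 : 1 ≤ d := by
      have := (Finset.mem_filter.1 hd).1
      exact (Finset.mem_Icc.1 this).1
    have hdR : (1 : ℝ) ≤ d := by exact_mod_cast hd1
    have hd0 : (0 : ℝ) < d := by linarith
    rw [norm_mul, good_sum a c hdual, Complex.norm_real, Real.norm_eq_abs]
    have b1 := smooth_term a c ha d (by omega)
    have b2 := hK (∏ i, a i) hA0 hsq (⌊x⌋₊ / d)
    have b3 : ((⌊x⌋₊ / d : ℕ) : ℝ) ^ ((1 : ℝ) / 2 + ε / 2) ≤
        x ^ ((1 : ℝ) / 2 + ε / 2) / Real.sqrt d := by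
      have c1 : ((⌊x⌋₊ / d : ℕ) : ℝ) ≤ x / d :=
        Nat.cast_div_le.trans (div_le_div_of_nonneg_right hXx hd0.le)
      refine (Real.rpow_le_rpow (Nat.cast_nonneg _) c1 (by linarith)).trans ?_
      rw [Real.div_rpow hx0.le hd0.le, Real.sqrt_eq_rpow]
      exact div_le_div_of_nonneg_left (by positivity) (by positivity)
        (Real.rpow_le_rpow_of_exponent_le hdR (by linarith))
    have b4 := b2.trans (mul_le_mul_of_nonneg_left b3 (by positivity))
    refine (mul_le_mul b1 b4 (abs_nonneg _) (by positivity)).trans (le_of_eq ?_)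
    have hs : Real.sqrt d ≠ 0 := (Real.sqrt_pos.2 hd0).ne'
    field_simp
  refine (norm_sum_le _ _).trans ((Finset.sum_le_card_nsmul _ _ _ key).trans ?_)
  rw [nsmul_eq_mul]
  have hXp : ((⌊x⌋₊ : ℕ) : ℝ) ^ (ε / 2) ≤ x ^ (ε / 2) :=
    Real.rpow_le_rpow (Nat.cast_nonneg _) hXx (by linarith)
  have hcard2 := hcard.trans (mul_le_mul_of_nonneg_left hXp (by positivity))
  refine (mul_le_mul_of_nonneg_right hcard2 (by positivity)).trans (le_of_eq ?_)
  have e1 : ((2 * (∏ i, a i).natAbs : ℕ) : ℝ) ^ (ε / 2) =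
      (2 : ℝ) ^ (ε / 2) * ((∏ i, a i).natAbs : ℝ) ^ (ε / 2) := by
    rw [Nat.cast_mul, Real.mul_rpow (by positivity) (by positivity)]; norm_num
  have e2 : ((∏ i, a i).natAbs : ℝ) ^ ((3 : ℝ) / 16 + ε) =
      ((∏ i, a i).natAbs : ℝ) ^ ((3 : ℝ) / 16 + ε / 2) * ((∏ i, a i).natAbs : ℝ) ^ (ε / 2) := by
    rw [← Real.rpow_add hA]; congr 1; ring
  have e3 : x ^ ((1 : ℝ) / 2 + ε) = x ^ ((1 : ℝ) / 2 + ε / 2) * x ^ (ε / 2) := by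
    rw [← Real.rpow_add hx0]; congr 1; ring
  rw [e1, e2, e3]
  ring
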